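/- arXiv:2602.21051 — 12 statements merged into one kernel-verified Lean document; each statement's English description precedes it below -/
import Mathlib

section
/- Let d ≥ 2 and let p be a polynomial in the d complex variables (z_1,…,z_{d−1},w). Suppose there is ε > 0 such that p(z,w) ≠ 0 for every point (z,w) of the Siegel half-space U_d with |(z,w)| < ε, and suppose p(0) = 0 and ∇p(0) ≠ 0. Then ∂p/∂z_j(0) = 0 for every j = 1,…,d−1, and consequently ∂p/∂w(0) ≠ 0. -/
open MvPolynomial

open Filter Topology

/-- The evaluation map of a polynomial is strictly differentiable, with derivative given by the
formal partial derivatives. -/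
theorem MvPolynomial.hasStrictFDerivAt_eval {σ : Type*} [Fintype σ] (p : MvPolynomial σ ℂ)
    (x : σ → ℂ) :
    HasStrictFDerivAt (fun v => eval v p)
      (∑ i, eval x (pderiv i p) • ContinuousLinearMap.proj (R := ℂ) (φ := fun _ : σ => ℂ) i) x := by
  classical
  induction p using MvPolynomial.induction_on with
  | C a =>
    simp only [eval_C]
    refine (hasStrictFDerivAt_const a x).congr_fderiv ?_
    ext v
    simp
  | add p q hp hq =>
    simp only [map_add]
    refine (hp.fun_add hq).congr_fderiv ?_
    ext v
    simp [add_mul, Finset.sum_add_distrib]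
  | mul_X p i hp =>
    simp only [map_mul, eval_X]
    refine (hp.fun_mul (hasStrictFDerivAt_apply i x)).congr_fderiv ?_
    ext v
    simp [pderiv_X, Pi.single_apply, apply_ite (eval x), add_mul, Finset.sum_add_distrib,
      Finset.mul_sum, mul_assoc, ite_mul]

/-- If `∂p/∂x_k (0) ≠ 0` and `p 0 = 0`, then in the plane of the coordinates `l ≠ k` the zero set
of `p` near `0` contains a graph `x_k = ψ (x_l)` with `ψ w = O(w)`. -/
theorem MvPolynomial.exists_zero_graph {σ : Type*} [Fintype σ] [DecidableEq σ]
    (p : MvPolynomial σ ℂ) {k l : σ} (h0 : eval 0 p = 0)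
    (hk : eval 0 (pderiv k p) ≠ 0) :
    ∃ ψ : ℂ → ℂ, ψ =O[𝓝 0] (fun w => w) ∧
      ∀ᶠ w in 𝓝 0, eval (Pi.single l w + Pi.single k (ψ w)) p = 0 := by
  let L : ℂ × ℂ →L[ℂ] (σ → ℂ) :=
    ContinuousLinearMap.single ℂ (fun _ : σ => ℂ) l ∘L .fst ℂ ℂ ℂ +
      ContinuousLinearMap.single ℂ (fun _ : σ => ℂ) k ∘L .snd ℂ ℂ ℂ
  have hL (w z : ℂ) : L (w, z) = Pi.single l w + Pi.single k z := rfl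
  obtain ⟨f', hf, hinv⟩ : ∃ f' : ℂ × ℂ →L[ℂ] ℂ,
      HasStrictFDerivAt (fun x => eval (L x) p) f' 0 ∧ (f' ∘L .inr ℂ ℂ ℂ).IsInvertible := by
    have hp := p.hasStrictFDerivAt_eval (L 0)
    refine ⟨_, hp.comp (0 : ℂ × ℂ) L.hasStrictFDerivAt,
      ContinuousLinearEquiv.unitsEquivAut ℂ (Units.mk0 _ hk), ?_⟩
    ext
    simp [hL, Pi.single_apply]
  refine ⟨hf.implicitFunctionOfProdDomain hinv, ?_, ?_⟩
  · have hψ := (hf.hasStrictFDerivAt_implicitFunctionOfProdDomain hinv).hasFDerivAt.isBigO_sub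
    have hψ0 := (hf.eventually_apply_eq_iff_implicitFunctionOfProdDomain hinv).self_of_nhds.mp rfl
    rw [hψ0] at hψ
    simpa using hψ
  · filter_upwards [hf.eventually_apply_implicitFunctionOfProdDomain hinv] with w hw
    rw [← hL, hw, map_zero, h0]

/-- If a polynomial `p` in `d = m+1 ≥ 2` complex variables
`(z_1, …, z_m, w)` is non-vanishing on the part of the Siegel half-space
`U_d = {(z,w) : Im w > ∑ |z_j|²}` within distance `ε` of the origin, vanishes at `0`,
and has nonzero gradient at `0`, then all the `z`-partial derivatives of `p` vanish
at `0` and hence `∂p/∂w(0) ≠ 0`. -/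
theorem statement0 (m : ℕ) (hm : 1 ≤ m) (p : MvPolynomial (Fin (m + 1)) ℂ)
    (ε : ℝ) (hε : 0 < ε)
    (hstable : ∀ v : Fin (m + 1) → ℂ,
      (∑ j : Fin m, ‖v j.castSucc‖ ^ 2) < (v (Fin.last m)).im →
      (∑ j : Fin (m + 1), ‖v j‖ ^ 2) < ε ^ 2 →
      eval v p ≠ 0)
    (h0 : eval 0 p = 0)
    (hgrad : ∃ j : Fin (m + 1), eval 0 (pderiv j p) ≠ 0) :
    (∀ j : Fin m, eval 0 (pderiv j.castSucc p) = 0) ∧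
      eval 0 (pderiv (Fin.last m) p) ≠ 0 := by
  have key (j : Fin m) : eval 0 (pderiv j.castSucc p) = 0 := by
    by_contra hj
    obtain ⟨ψ, hO, hzero⟩ := p.exists_zero_graph (l := Fin.last m) h0 hj
    obtain ⟨C, hC⟩ := hO.bound
    have htend : Tendsto (fun t : ℝ => (t : ℂ) * Complex.I) (𝓝[>] 0) (𝓝 0) := by
      have : ContinuousAt (fun t : ℝ => (t : ℂ) * Complex.I) 0 := by fun_prop
      simpa using this.tendsto.mono_left nhdsWithin_le_nhds
    have h1 : ∀ᶠ t : ℝ in 𝓝[>] 0, C ^ 2 * t < 1 := by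
      have : ContinuousAt (fun t : ℝ => C ^ 2 * t) 0 := by fun_prop
      exact nhdsWithin_le_nhds (this.eventually_lt_const (by simp))
    have h2 : ∀ᶠ t : ℝ in 𝓝[>] 0, C ^ 2 * t ^ 2 + t ^ 2 < ε ^ 2 := by
      have : ContinuousAt (fun t : ℝ => C ^ 2 * t ^ 2 + t ^ 2) 0 := by fun_prop
      exact nhdsWithin_le_nhds (this.eventually_lt_const (by simpa using pow_pos hε 2))
    obtain ⟨t, ht, hzt, hCt, h1t, h2t⟩ := (eventually_mem_nhdsWithin.and
      ((htend.eventually hzero).and ((htend.eventually hC).and (h1.and h2)))).exists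
    have ht0 : 0 < t := ht
    set z := ψ (t * Complex.I)
    have hz : ‖z‖ ≤ C * t := by simpa [abs_of_pos ht0] using hCt
    have hz2 : ‖z‖ ^ 2 ≤ C ^ 2 * t ^ 2 := by
      rw [← mul_pow]
      gcongr
    have hsum : ∑ i : Fin m, ‖(Pi.single (Fin.last m) (t * Complex.I) +
        Pi.single j.castSucc z : Fin (m + 1) → ℂ) i.castSucc‖ ^ 2 = ‖z‖ ^ 2 := by
      rw [Finset.sum_eq_single j]
      · simp [(Fin.castSucc_lt_last _).ne]
      · intro i _ hi
        simp [(Fin.castSucc_lt_last _).ne, hi]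
      · simp
    refine hstable _ ?_ ?_ hzt
    · rw [hsum]
      simp [(Fin.castSucc_lt_last _).ne']
      nlinarith
    · rw [Fin.sum_univ_castSucc, hsum]
      simp [(Fin.castSucc_lt_last _).ne']
      linarith
  refine ⟨key, ?_⟩
  obtain ⟨i, hi⟩ := hgrad
  induction i using Fin.lastCases with
  | last => exact hi
  | cast j => exact absurd (key j) hi
end

section
/- Let A be a complex symmetric (d−1)×(d−1) matrix (Aᵀ = A) such that Im(zᵀAz) ≤ 1 for every z ∈ ℂ^{d−1} with Euclidean norm |z| = 1, where zᵀAz = Σ_{j,k} A_{jk} z_j z_k. Then A is contractive: ‖Av‖ ≤ ‖v‖ for every v ∈ ℂ^{d−1}. -/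
open Matrix in
/-- A bound on the imaginary part of a quadratic form on the unit sphere extends to all vectors
by homogeneity. -/
theorem im_dotProduct_mulVec_le_of_sphere {ι : Type*} [Fintype ι] (A : Matrix ι ι ℂ)
    (h : ∀ z : ι → ℂ, (∑ j, ‖z j‖ ^ 2) = 1 → (z ⬝ᵥ A *ᵥ z).im ≤ 1) (z : ι → ℂ) :
    (z ⬝ᵥ A *ᵥ z).im ≤ ∑ j, ‖z j‖ ^ 2 := by
  have hN : 0 ≤ ∑ j, ‖z j‖ ^ 2 := by positivity
  rcases hN.eq_or_lt with h0 | hpos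
  · have hz : z = 0 := by
      funext j
      have := (Finset.sum_eq_zero_iff_of_nonneg (fun j _ => by positivity)).1 h0.symm j
        (Finset.mem_univ j)
      simpa using this
    simp [hz]
  · set N := ∑ j, ‖z j‖ ^ 2 with hNdef
    have hr : (√N)⁻¹ ^ 2 = N⁻¹ := by rw [inv_pow, Real.sq_sqrt hN]
    have key := h ((((√N)⁻¹ : ℝ) : ℂ) • z) (by
      simp only [Pi.smul_apply, smul_eq_mul, norm_mul, mul_pow, Complex.norm_real,
        Real.norm_eq_abs, sq_abs, ← Finset.mul_sum]
      rw [← hNdef, hr, inv_mul_cancel₀ hpos.ne'])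
    rw [mulVec_smul, smul_dotProduct, dotProduct_smul, smul_smul, ← pow_two,
      ← Complex.ofReal_pow, hr, smul_eq_mul, Complex.im_ofReal_mul] at key
    rwa [inv_mul_le_iff₀ hpos, mul_one] at key

open Matrix in
/-- Polarization of a bound on the imaginary part of a complex symmetric quadratic form. -/
theorem im_dotProduct_mulVec_le_of_isSymm {ι : Type*} [Fintype ι] {A : Matrix ι ι ℂ}
    (hA : A.IsSymm) (h : ∀ z : ι → ℂ, (z ⬝ᵥ A *ᵥ z).im ≤ ∑ j, ‖z j‖ ^ 2) (u v : ι → ℂ) :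
    2 * (u ⬝ᵥ A *ᵥ v).im ≤ ∑ j, ‖u j‖ ^ 2 + ∑ j, ‖v j‖ ^ 2 := by
  have hsymm : v ⬝ᵥ A *ᵥ u = u ⬝ᵥ A *ᵥ v := by
    rw [dotProduct_mulVec, ← mulVec_transpose, hA.eq, dotProduct_comm]
  have h₁ := h (u + v)
  have h₂ := h (Complex.I • (u - v))
  have hpar : ∑ j, ‖(u + v) j‖ ^ 2 + ∑ j, ‖(Complex.I • (u - v)) j‖ ^ 2
      = 2 * (∑ j, ‖u j‖ ^ 2 + ∑ j, ‖v j‖ ^ 2) := by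
    simp only [← Finset.sum_add_distrib, Finset.mul_sum]
    refine Finset.sum_congr rfl fun j _ => ?_
    have := parallelogram_law_with_norm ℝ (u j) (v j)
    simp only [Pi.add_apply, Pi.smul_apply, Pi.sub_apply, smul_eq_mul, norm_mul,
      Complex.norm_I, one_mul]
    linarith
  rw [mulVec_smul, smul_dotProduct, dotProduct_smul, smul_smul, Complex.I_mul_I] at h₂
  simp only [mulVec_add, mulVec_sub, add_dotProduct, dotProduct_add, sub_dotProduct,
    dotProduct_sub, hsymm, neg_smul, one_smul, Complex.add_im, Complex.sub_im,
    Complex.neg_im] at h₁ h₂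
  linarith


/-- A complex symmetric matrix `A` with `Im(zᵀAz) ≤ 1` on the Euclidean
unit sphere is contractive: `‖Av‖ ≤ ‖v‖` for all `v` (Euclidean norms, expressed via
sums of squares). -/
theorem statement1 (n : ℕ) (A : Matrix (Fin n) (Fin n) ℂ) (hA : A.transpose = A)
    (h : ∀ z : Fin n → ℂ, (∑ j, ‖z j‖ ^ 2) = 1 →
      (∑ j, ∑ k, A j k * z j * z k).im ≤ 1) :
    ∀ v : Fin n → ℂ, ∑ j, ‖A.mulVec v j‖ ^ 2 ≤ ∑ j, ‖v j‖ ^ 2 := by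
  intro v
  have hquad : ∀ z : Fin n → ℂ, z ⬝ᵥ A.mulVec z = ∑ j, ∑ k, A j k * z j * z k := fun z => by
    simp only [dotProduct, Matrix.mulVec, Finset.mul_sum]
    exact Finset.sum_congr rfl fun j _ => Finset.sum_congr rfl fun k _ => by ring
  have hbound := im_dotProduct_mulVec_le_of_sphere A fun z hz => by
    rw [hquad]
    exact h z hz
  have key := im_dotProduct_mulVec_le_of_isSymm hA hbound (Complex.I • star (A.mulVec v)) v
  have hval : ((Complex.I • star (A.mulVec v)) ⬝ᵥ A.mulVec v).im = ∑ j, ‖A.mulVec v j‖ ^ 2 := by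
    rw [smul_dotProduct, smul_eq_mul, Complex.I_mul_im, dotProduct, Complex.re_sum]
    refine Finset.sum_congr rfl fun j _ => ?_
    rw [Pi.star_apply, Complex.star_def, Complex.conj_mul', ← Complex.ofReal_pow,
      Complex.ofReal_re]
  have hnorm : ∑ j, ‖(Complex.I • star (A.mulVec v)) j‖ ^ 2 = ∑ j, ‖A.mulVec v j‖ ^ 2 := by
    simp
  rw [hval, hnorm] at key
  linarith
end

section
/- Let d ≥ 2 and let p be a polynomial in the d complex variables (z_1,…,z_{d−1},w) such that for some ε > 0, p(z,w) ≠ 0 for every (z,w) in the Siegel half-space U_d with |(z,w)| < ε. Assume p(0) = 0 and ∇p(0) ≠ 0. Then ∇p(0) is a nonzero multiple of the last standard basis vector e_d (i.e., ∂p/∂z_j(0) = 0 for all j = 1,…,d−1 and ∂p/∂w(0) ≠ 0), and the Hessian matrix Hp(0) = (∂²p/∂z_j∂z_k(0))_{j,k=1,…,d−1} with respect to the z-variables satisfies: the matrix (1/(2|∇p(0)|)) Hp(0) is contractive, i.e., ‖Hp(0)·v‖ ≤ 2|∂p/∂w(0)|·‖v‖ for all v ∈ ℂ^{d−1}. -/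
open MvPolynomial

open Filter Topology

theorem MvPolynomial.derivative_aeval {R σ : Type*} [CommRing R] [Fintype σ]
    (γ : σ → Polynomial R) (p : MvPolynomial σ R) :
    Polynomial.derivative (aeval γ p) =
      ∑ i, aeval γ (pderiv i p) * Polynomial.derivative (γ i) := by
  classical
  induction p using MvPolynomial.induction_on with
  | C a => simp [algHom_C]
  | add p q hp hq => simp [hp, hq, add_mul, Finset.sum_add_distrib]
  | mul_X p j hp =>
    have hj : ∑ i, aeval γ (p * pderiv i (X j)) * Polynomial.derivative (γ i) =
        aeval γ p * Polynomial.derivative (γ j) := by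
      rw [Finset.sum_eq_single j]
      · rw [pderiv_X_self, mul_one]
      · intro i _ hi
        rw [pderiv_X_of_ne hi.symm, mul_zero, map_zero, zero_mul]
      · simp
    simp only [Derivation.leibniz, smul_eq_mul, map_add, add_mul, Finset.sum_add_distrib, hj]
    simp only [map_mul, aeval_X, Polynomial.derivative_mul, hp, Finset.sum_mul]
    rw [add_comm]
    refine congrArg (aeval γ p * Polynomial.derivative (γ j) + ·) ?_
    exact Finset.sum_congr rfl fun i _ => by ring

theorem MvPolynomial.pderiv_comm {R σ : Type*} [CommRing R] (i j : σ) (p : MvPolynomial σ R) :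
    pderiv i (pderiv j p) = pderiv j (pderiv i p) := by
  classical
  have h : ⁅pderiv i, pderiv j⁆ = (0 : Derivation R (MvPolynomial σ R) (MvPolynomial σ R)) :=
    MvPolynomial.derivation_ext fun k => by
      rw [Derivation.commutator_apply, pderiv_X, pderiv_X]
      simp only [Pi.single_apply]
      split_ifs <;> simp
  simpa [Derivation.commutator_apply, sub_eq_zero] using DFunLike.congr_fun h p

theorem MvPolynomial.polynomial_eval_aeval {R σ : Type*} [CommRing R]
    (γ : σ → Polynomial R) (p : MvPolynomial σ R) (t : R) :
    Polynomial.eval t (aeval γ p) = eval (fun i => (γ i).eval t) p := by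
  induction p using MvPolynomial.induction_on with
  | C a => simp [algHom_C]
  | add p q hp hq => simp [hp, hq]
  | mul_X p j hp => simp [hp]

/-- Laguerre-type bound: the Newton quotient at `0` controls the distance to the nearest root. -/
theorem Polynomial.norm_eval_derivative_mul_le {q : Polynomial ℂ} {r : ℝ} (hr : 0 < r)
    (hq : ∀ s : ℂ, ‖s‖ < r → q.eval s ≠ 0) :
    ‖q.derivative.eval 0‖ * r ≤ q.natDegree * ‖q.eval 0‖ := by
  have h0 : q.eval 0 ≠ 0 := hq 0 (by simpa using hr)
  have hdiv := (IsAlgClosed.splits q).eval_derivative_div_eval_of_ne_zero h0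
  have hroot : ∀ z ∈ q.roots, r ≤ ‖z‖ := fun z hz => by
    by_contra! hlt
    exact hq z hlt (Polynomial.isRoot_of_mem_roots hz)
  have hsum : ‖q.derivative.eval 0 / q.eval 0‖ ≤ q.natDegree * r⁻¹ := by
    rw [hdiv]
    refine (norm_multiset_sum_le _).trans ?_
    refine (Multiset.sum_le_card_nsmul _ r⁻¹ ?_).trans ?_
    · simp only [Multiset.map_map, Multiset.mem_map, Function.comp_apply, forall_exists_index,
        and_imp]
      rintro _ z hz rfl
      simpa using inv_anti₀ hr (hroot z hz)
    · simp only [Multiset.card_map, nsmul_eq_mul]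
      gcongr
      exact q.card_roots'
  rw [norm_div, div_le_iff₀ (norm_pos_iff.2 h0)] at hsum
  calc _ ≤ q.natDegree * r⁻¹ * ‖q.eval 0‖ * r := by gcongr
    _ = _ := by field_simp

/-- If a polynomial curve `γ` through the origin has contact of order greater than `k` with the
zero set of `p`, and the discs of radius `c * t ^ k` around `γ t` in the `j`-th coordinate
direction avoid that zero set, then the `j`-th partial derivative of `p` vanishes at the origin. -/
theorem MvPolynomial.eval_pderiv_eq_zero_of_contact {σ : Type*} [Fintype σ] [DecidableEq σ]
    {p : MvPolynomial σ ℂ} {γ : σ → Polynomial ℂ} (hγ : ∀ i, (γ i).eval 0 = 0) {j : σ}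
    {k : ℕ} {c : ℝ} (hc : 0 < c) (hdvd : Polynomial.X ^ (k + 1) ∣ aeval γ p)
    (hne : ∀ᶠ t : ℝ in 𝓝[>] 0, ∀ s : ℂ, ‖s‖ < c * t ^ k →
      eval (fun i => (γ i).eval (t : ℂ) + (Pi.single j s : σ → ℂ) i) p ≠ 0) :
    eval 0 (pderiv j p) = 0 := by
  obtain ⟨R, hR⟩ := hdvd
  have key : ∀ᶠ t : ℝ in 𝓝[>] 0,
      ‖eval (fun i => (γ i).eval (t : ℂ)) (pderiv j p)‖ * c ≤
        p.totalDegree * (t * ‖R.eval (t : ℂ)‖) := by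
    filter_upwards [hne, self_mem_nhdsWithin] with t ht htpos
    have htpos : 0 < t := htpos
    let δ : σ → Polynomial ℂ := fun i =>
      Polynomial.C ((γ i).eval (t : ℂ)) + (Pi.single j Polynomial.X : σ → Polynomial ℂ) i
    have heval : ∀ s (f : MvPolynomial σ ℂ), (aeval δ f).eval s =
        eval (fun i => (γ i).eval (t : ℂ) + (Pi.single j s : σ → ℂ) i) f := fun s f => by
      rw [MvPolynomial.polynomial_eval_aeval]
      congr 2 with i
      by_cases h : i = j
      · subst h; simp [δ]
      · simp [δ, h]
    have h := Polynomial.norm_eval_derivative_mul_le (q := aeval δ p)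
      (show 0 < c * t ^ k by positivity) fun s hs => by rw [heval]; exact ht s hs
    have hder : (aeval δ p).derivative.eval 0 =
        eval (fun i => (γ i).eval (t : ℂ)) (pderiv j p) := by
      rw [derivative_aeval, Polynomial.eval_finsetSum, Finset.sum_eq_single j]
      · rw [Polynomial.eval_mul, heval]
        simp [δ]
      · intro i _ hi
        simp [δ, hi]
      · simp
    have hdeg : ((aeval δ p).natDegree : ℝ) ≤ p.totalDegree := by
      have := MvPolynomial.aeval_natDegree_le (n := 1) p le_rfl δ fun i => by
        refine (Polynomial.natDegree_C_add).trans_le ?_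
        by_cases h : i = j
        · subst h; simp
        · simp [h]
      exact_mod_cast this.trans_eq (mul_one _)
    have hval : ‖(aeval δ p).eval 0‖ = t ^ (k + 1) * ‖R.eval (t : ℂ)‖ := by
      have h2 := congrArg (Polynomial.eval (t : ℂ)) hR
      rw [MvPolynomial.polynomial_eval_aeval] at h2
      rw [heval]
      simp only [Pi.single_zero, Pi.zero_apply, add_zero, h2]
      simp [abs_of_pos htpos]
    rw [hder, hval] at h
    have hk : 0 < t ^ k := by positivity
    refine le_of_mul_le_mul_right ?_ hk
    calc _ = ‖eval (fun i => (γ i).eval (t : ℂ)) (pderiv j p)‖ * (c * t ^ k) := by ring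
      _ ≤ _ := h
      _ ≤ p.totalDegree * (t ^ (k + 1) * ‖R.eval (t : ℂ)‖) := by gcongr
      _ = _ := by ring
  have hL : Tendsto (fun t : ℝ => ‖eval (fun i => (γ i).eval (t : ℂ)) (pderiv j p)‖ * c)
      (𝓝[>] 0) (𝓝 (‖eval 0 (pderiv j p)‖ * c)) := by
    have : Continuous fun t : ℝ => ‖eval (fun i => (γ i).eval (t : ℂ)) (pderiv j p)‖ * c := by
      simp only [← MvPolynomial.polynomial_eval_aeval]
      fun_prop
    have h := this.tendsto 0
    simp only [Complex.ofReal_zero, hγ] at h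
    exact h.mono_left nhdsWithin_le_nhds
  have hRt : Tendsto (fun t : ℝ => (p.totalDegree : ℝ) * (t * ‖R.eval (t : ℂ)‖))
      (𝓝[>] 0) (𝓝 0) := by
    have : Continuous fun t : ℝ => (p.totalDegree : ℝ) * (t * ‖R.eval (t : ℂ)‖) := by fun_prop
    have h := this.tendsto 0
    simp only [zero_mul, mul_zero] at h
    exact h.mono_left nhdsWithin_le_nhds
  have hle := le_of_tendsto_of_tendsto hL hRt key
  have : ‖eval 0 (pderiv j p)‖ ≤ 0 := by
    by_contra! hpos
    exact absurd hle (not_le.2 (mul_pos hpos hc))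
  exact norm_le_zero_iff.1 this

theorem eventually_sum_norm_sq_lt {σ : Type*} [Fintype σ] [DecidableEq σ] {γ : σ → Polynomial ℂ}
    (hγ : ∀ i, (γ i).eval 0 = 0) (j : σ) {k : ℕ} (hk : k ≠ 0) (c : ℝ) {ρ : ℝ} (hρ : 0 < ρ) :
    ∀ᶠ t : ℝ in 𝓝[>] 0, ∀ s : ℂ, ‖s‖ < c * t ^ k →
      ∑ i, ‖(γ i).eval (t : ℂ) + (Pi.single j s : σ → ℂ) i‖ ^ 2 < ρ := by
  have hb : ∀ t : ℝ, ∀ s : ℂ, ‖s‖ < c * t ^ k →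
      ∑ i, ‖(γ i).eval (t : ℂ) + (Pi.single j s : σ → ℂ) i‖ ^ 2 ≤
        ∑ i, (‖(γ i).eval (t : ℂ)‖ + c * t ^ k) ^ 2 := fun t s hs => by
    gcongr with i
    refine (norm_add_le _ _).trans ?_
    gcongr
    by_cases h : i = j
    · subst h; simpa using hs.le
    · simpa [h] using (norm_nonneg s).trans hs.le
  have hcont : Continuous fun t : ℝ => ∑ i, (‖(γ i).eval (t : ℂ)‖ + c * t ^ k) ^ 2 := by fun_prop
  have h := hcont.tendsto 0
  simp only [Complex.ofReal_zero, hγ, norm_zero, zero_pow hk, mul_zero, add_zero,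
    zero_pow two_ne_zero, Finset.sum_const_zero] at h
  filter_upwards [nhdsWithin_le_nhds (h.eventually_lt_const hρ)] with t ht s hs
  exact (hb t s hs).trans_lt ht

/-- The polynomial curve `t ↦ t x + t² y`. -/
noncomputable def quadraticCurve {σ : Type*} (x y : σ → ℂ) (i : σ) : Polynomial ℂ :=
  Polynomial.C (x i) * Polynomial.X + Polynomial.C (y i) * Polynomial.X ^ 2

theorem eval_quadraticCurve {σ : Type*} (x y : σ → ℂ) (i : σ) (t : ℂ) :
    (quadraticCurve x y i).eval t = x i * t + y i * t ^ 2 := by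
  simp [quadraticCurve]

theorem derivative_quadraticCurve {σ : Type*} (x y : σ → ℂ) (i : σ) :
    Polynomial.derivative (quadraticCurve x y i) =
      Polynomial.C (x i) + Polynomial.C (2 * y i) * Polynomial.X := by
  simp only [quadraticCurve, Polynomial.derivative_add, Polynomial.derivative_C_mul,
    Polynomial.derivative_X, Polynomial.derivative_X_pow, map_mul]
  simp
  ring

theorem eval_zero_aeval_quadraticCurve {σ : Type*} (p : MvPolynomial σ ℂ) (x y : σ → ℂ) :
    (aeval (quadraticCurve x y) p).eval 0 = eval 0 p := by
  rw [MvPolynomial.polynomial_eval_aeval]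
  congr 2
  ext i
  simp [eval_quadraticCurve]

theorem eval_zero_derivative_aeval_quadraticCurve {σ : Type*} [Fintype σ] (p : MvPolynomial σ ℂ)
    (x y : σ → ℂ) :
    (Polynomial.derivative (aeval (quadraticCurve x y) p)).eval 0 =
      ∑ i, eval 0 (pderiv i p) * x i := by
  simp [MvPolynomial.derivative_aeval, Polynomial.eval_finsetSum, derivative_quadraticCurve,
    eval_zero_aeval_quadraticCurve]

theorem sq_dvd_aeval_quadraticCurve {σ : Type*} [Fintype σ] (p : MvPolynomial σ ℂ)
    (x y : σ → ℂ) (h0 : eval 0 p = 0)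
    (h1 : ∑ i, eval 0 (pderiv i p) * x i = 0) :
    Polynomial.X ^ 2 ∣ aeval (quadraticCurve x y) p := by
  rw [Polynomial.X_pow_dvd_iff]
  intro d hd
  interval_cases d
  · rw [Polynomial.coeff_zero_eq_eval_zero, eval_zero_aeval_quadraticCurve, h0]
  · rw [← eval_zero_derivative_aeval_quadraticCurve p x y, ← Polynomial.coeff_zero_eq_eval_zero,
      Polynomial.coeff_derivative] at h1
    simpa using h1

theorem cube_dvd_aeval_quadraticCurve {σ : Type*} [Fintype σ] (p : MvPolynomial σ ℂ)
    (x y : σ → ℂ) (h0 : eval 0 p = 0)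
    (h1 : ∑ i, eval 0 (pderiv i p) * x i = 0)
    (h2 : ∑ i, ((∑ k, eval 0 (pderiv k (pderiv i p)) * x k) * x i +
      eval 0 (pderiv i p) * (2 * y i)) = 0) :
    Polynomial.X ^ 3 ∣ aeval (quadraticCurve x y) p := by
  rw [Polynomial.X_pow_dvd_iff]
  intro d hd
  rcases Nat.lt_succ_iff_lt_or_eq.1 hd with hd | rfl
  · exact Polynomial.X_pow_dvd_iff.1 (sq_dvd_aeval_quadraticCurve p x y h0 h1) d hd
  · have h : (Polynomial.derivative (Polynomial.derivative
        (aeval (quadraticCurve x y) p))).eval 0 = 0 := by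
      rw [MvPolynomial.derivative_aeval, Polynomial.derivative_sum, Polynomial.eval_finsetSum]
      refine (Finset.sum_congr rfl fun i _ => ?_).trans h2
      rw [Polynomial.derivative_mul, Polynomial.eval_add, Polynomial.eval_mul, Polynomial.eval_mul,
        eval_zero_derivative_aeval_quadraticCurve, eval_zero_aeval_quadraticCurve,
        derivative_quadraticCurve]
      simp
    rw [← Polynomial.coeff_zero_eq_eval_zero, Polynomial.coeff_derivative,
      Polynomial.coeff_derivative] at h
    norm_num at h
    exact h

section Siegel

variable {m : ℕ} {p : MvPolynomial (Fin (m + 1)) ℂ} {ε : ℝ}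

theorem eval_pderiv_castSucc_eq_zero_of_siegel (hε : 0 < ε)
    (hstable : ∀ v : Fin (m + 1) → ℂ,
      (∑ j : Fin m, ‖v j.castSucc‖ ^ 2) < (v (Fin.last m)).im →
      (∑ j : Fin (m + 1), ‖v j‖ ^ 2) < ε ^ 2 → eval v p ≠ 0)
    (h0 : eval 0 p = 0) (j : Fin m) : eval 0 (pderiv j.castSucc p) = 0 := by
  by_contra hj
  set a := eval 0 (pderiv j.castSucc p) with ha
  set b := eval 0 (pderiv (Fin.last m) p) with hb
  let x : Fin (m + 1) → ℂ :=
    Pi.single j.castSucc (-(b * Complex.I) / a) + Pi.single (Fin.last m) Complex.I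
  have hcurve : ∀ i, (quadraticCurve x 0 i).eval 0 = 0 := fun i => by simp [eval_quadraticCurve]
  have hlast : x (Fin.last m) = Complex.I := by simp [x]
  have hx : ∑ i, eval 0 (pderiv i p) * x i = 0 := by
    simp only [x, Pi.add_apply, mul_add, Finset.sum_add_distrib, Pi.single_apply, mul_ite,
      mul_zero, Finset.sum_ite_eq', Finset.mem_univ, if_true, ← ha, ← hb]
    field_simp
    ring
  refine hj (MvPolynomial.eval_pderiv_eq_zero_of_contact (k := 1) hcurve one_pos
    (sq_dvd_aeval_quadraticCurve p x 0 h0 hx) ?_)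
  have hK : ∀ᶠ t : ℝ in 𝓝[>] 0, t * ∑ i : Fin m, (‖x i.castSucc‖ + 1) ^ 2 < 1 := by
    have hc : Continuous fun t : ℝ => t * ∑ i : Fin m, (‖x i.castSucc‖ + 1) ^ 2 := by fun_prop
    have h := hc.tendsto 0
    rw [zero_mul] at h
    exact nhdsWithin_le_nhds (h.eventually_lt_const one_pos)
  filter_upwards [eventually_sum_norm_sq_lt hcurve j.castSucc one_ne_zero 1
    (show 0 < ε ^ 2 by positivity), hK, self_mem_nhdsWithin] with t ht htK htpos s hs
  have htpos : 0 < t := htpos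
  refine hstable _ ?_ (ht s hs)
  have him : ((quadraticCurve x 0 (Fin.last m)).eval (t : ℂ) +
      (Pi.single j.castSucc s : Fin (m + 1) → ℂ) (Fin.last m)).im = t := by
    rw [eval_quadraticCurve, hlast, Pi.single_eq_of_ne (Fin.castSucc_lt_last j).ne']
    simp
  rw [him]
  calc _ ≤ ∑ i : Fin m, (t * (‖x i.castSucc‖ + 1)) ^ 2 := by
        gcongr with i
        refine (norm_add_le _ _).trans ?_
        rw [mul_add]
        refine add_le_add ?_ ?_
        · simp [eval_quadraticCurve, abs_of_pos htpos, mul_comm]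
        · by_cases h : i = j
          · subst h; simpa using hs.le
          · have : i.castSucc ≠ j.castSucc := fun h' => h (Fin.castSucc_injective m h')
            simpa [this] using htpos.le
    _ = t * (t * ∑ i : Fin m, (‖x i.castSucc‖ + 1) ^ 2) := by
        rw [Finset.mul_sum, Finset.mul_sum]
        exact Finset.sum_congr rfl fun i _ => by ring
    _ < t * 1 := by gcongr
    _ = t := mul_one t

theorem im_le_of_siegel (hε : 0 < ε)
    (hstable : ∀ v : Fin (m + 1) → ℂ,
      (∑ j : Fin m, ‖v j.castSucc‖ ^ 2) < (v (Fin.last m)).im →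
      (∑ j : Fin (m + 1), ‖v j‖ ^ 2) < ε ^ 2 → eval v p ≠ 0)
    (h0 : eval 0 p = 0) (hz : ∀ j : Fin m, eval 0 (pderiv j.castSucc p) = 0)
    (hw : eval 0 (pderiv (Fin.last m) p) ≠ 0) (u : Fin m → ℂ) :
    (-(∑ j : Fin m, (∑ k : Fin m, eval 0 (pderiv j.castSucc (pderiv k.castSucc p)) * u k) * u j) /
      (2 * eval 0 (pderiv (Fin.last m) p))).im ≤ ∑ j, ‖u j‖ ^ 2 := by
  set s₀ : ℂ := -(∑ j : Fin m,
    (∑ k : Fin m, eval 0 (pderiv j.castSucc (pderiv k.castSucc p)) * u k) * u j) /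
      (2 * eval 0 (pderiv (Fin.last m) p)) with hs₀
  by_contra! hlt
  let x : Fin (m + 1) → ℂ := Fin.snoc u 0
  let y : Fin (m + 1) → ℂ := Pi.single (Fin.last m) s₀
  have hxc : ∀ i : Fin m, x i.castSucc = u i := fun i => by simp [x]
  have hxl : x (Fin.last m) = 0 := by simp [x]
  have hyc : ∀ i : Fin m, y i.castSucc = 0 := fun i => by simp [y, (Fin.castSucc_lt_last i).ne]
  have hyl : y (Fin.last m) = s₀ := by simp [y]
  have hcurve : ∀ i, (quadraticCurve x y i).eval 0 = 0 := fun i => by simp [eval_quadraticCurve]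
  refine hw (MvPolynomial.eval_pderiv_eq_zero_of_contact (k := 2) hcurve (sub_pos.2 hlt)
    (cube_dvd_aeval_quadraticCurve p x y h0 ?_ ?_) ?_)
  · simp only [Fin.sum_univ_castSucc, hz, hxl, zero_mul, mul_zero, Finset.sum_const_zero,
      add_zero]
  · simp only [Fin.sum_univ_castSucc, hz, hxl, hxc, hyc, hyl, mul_zero, add_zero, zero_add]
    have hcomm : ∑ j : Fin m,
        (∑ k : Fin m, eval 0 (pderiv k.castSucc (pderiv j.castSucc p)) * u k) * u j =
          ∑ j : Fin m,
            (∑ k : Fin m, eval 0 (pderiv j.castSucc (pderiv k.castSucc p)) * u k) * u j :=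
      Finset.sum_congr rfl fun j _ => congrArg (· * u j) <|
        Finset.sum_congr rfl fun k _ => by rw [MvPolynomial.pderiv_comm]
    rw [hcomm, hs₀]
    field_simp
    ring
  · filter_upwards [eventually_sum_norm_sq_lt hcurve (Fin.last m) two_ne_zero _
      (show 0 < ε ^ 2 by positivity), self_mem_nhdsWithin] with t ht htpos s hs
    have htpos : 0 < t := htpos
    refine hstable _ ?_ (ht s hs)
    have him : ((quadraticCurve x y (Fin.last m)).eval (t : ℂ) +
        (Pi.single (Fin.last m) s : Fin (m + 1) → ℂ) (Fin.last m)).im =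
          s₀.im * t ^ 2 + s.im := by
      rw [eval_quadraticCurve, hxl, hyl, Pi.single_eq_same, ← Complex.ofReal_pow,
        zero_mul, zero_add, Complex.add_im, Complex.im_mul_ofReal]
    have hsum : ∑ i : Fin m, ‖(quadraticCurve x y i.castSucc).eval (t : ℂ) +
        (Pi.single (Fin.last m) s : Fin (m + 1) → ℂ) i.castSucc‖ ^ 2 =
          (∑ i, ‖u i‖ ^ 2) * t ^ 2 := by
      rw [Finset.sum_mul]
      refine Finset.sum_congr rfl fun i _ => ?_
      rw [eval_quadraticCurve, hxc, hyc, Pi.single_eq_of_ne (Fin.castSucc_lt_last i).ne]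
      simp [mul_pow]
    rw [him, hsum]
    have := (abs_le.1 (Complex.abs_im_le_norm s)).1
    linarith

end Siegel

theorem Complex.exists_sq_mul_eq_norm_mul_I (q : ℂ) :
    ∃ c : ℂ, ‖c‖ = 1 ∧ c ^ 2 * q = ‖q‖ * Complex.I := by
  by_cases hq : q = 0
  · exact ⟨1, by simp [hq]⟩
  obtain ⟨c, hc⟩ := IsAlgClosed.exists_pow_nat_eq ((‖q‖ : ℂ) * Complex.I / q) two_pos
  refine ⟨c, ?_, by rw [hc, div_mul_cancel₀ _ hq]⟩
  have h := congrArg norm hc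
  have hq' : ‖q‖ ≠ 0 := norm_ne_zero_iff.2 hq
  rw [norm_pow, norm_div, norm_mul, Complex.norm_I, Complex.norm_real, norm_norm, mul_one,
    div_self hq'] at h
  exact (pow_eq_one_iff_of_nonneg (norm_nonneg c) two_ne_zero).1 h

theorem sqrt_sum_norm_sq_le_of_symm {n : Type*} [Fintype n] {A : n → n → ℂ}
    (hA : ∀ i j, A i j = A j i) {M : ℝ}
    (hM : ∀ u : n → ℂ, ‖∑ j, (∑ k, A j k * u k) * u j‖ ≤ M * ∑ j, ‖u j‖ ^ 2) (v : n → ℂ) :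
    √(∑ j, ‖∑ k, A j k * v k‖ ^ 2) ≤ M * √(∑ k, ‖v k‖ ^ 2) := by
  set B : (n → ℂ) → (n → ℂ) → ℂ := fun x y => ∑ j, (∑ k, A j k * x k) * y j with hB
  have hpol : ∀ x y, B (x + y) (x + y) - B (x - y) (x - y) = 4 * B x y := fun x y => by
    have hsymm : B y x = B x y := by
      simp only [hB, Finset.sum_mul]
      rw [Finset.sum_comm]
      exact Finset.sum_congr rfl fun i _ => Finset.sum_congr rfl fun j _ => by rw [hA]; ring
    have h : B (x + y) (x + y) - B (x - y) (x - y) = 2 * B x y + 2 * B y x := by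
      simp only [hB, Pi.add_apply, Pi.sub_apply, mul_add, mul_sub, add_mul, sub_mul,
        Finset.sum_add_distrib, Finset.sum_sub_distrib]
      ring
    rw [h, hsymm]
    ring
  have hpar : ∀ x y : n → ℂ, ∑ j, ‖(x + y) j‖ ^ 2 + ∑ j, ‖(x - y) j‖ ^ 2 =
      2 * (∑ j, ‖x j‖ ^ 2 + ∑ j, ‖y j‖ ^ 2) := fun x y => by
    rw [← Finset.sum_add_distrib, ← Finset.sum_add_distrib, Finset.mul_sum]
    refine Finset.sum_congr rfl fun j _ => ?_
    have := parallelogram_law_with_norm ℂ (x j) (y j)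
    simp only [Pi.add_apply, Pi.sub_apply]
    linarith
  have hbound : ∀ x y : n → ℂ, 2 * ‖B x y‖ ≤ M * (∑ j, ‖x j‖ ^ 2 + ∑ j, ‖y j‖ ^ 2) :=
    fun x y => by
      have h := (norm_sub_le (B (x + y) (x + y)) (B (x - y) (x - y))).trans
        (add_le_add (hM (x + y)) (hM (x - y)))
      rw [hpol, ← mul_add, hpar, norm_mul] at h
      norm_num at h
      linarith
  set N := √(∑ k, ‖v k‖ ^ 2) with hN
  set H := √(∑ j, ‖∑ k, A j k * v k‖ ^ 2) with hH
  have hN2 : N ^ 2 = ∑ k, ‖v k‖ ^ 2 := Real.sq_sqrt (by positivity)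
  have hH2 : H ^ 2 = ∑ j, ‖∑ k, A j k * v k‖ ^ 2 := Real.sq_sqrt (by positivity)
  have hN0 : 0 ≤ N := Real.sqrt_nonneg _
  have hH0 : 0 ≤ H := Real.sqrt_nonneg _
  rcases hN0.eq_or_lt with hN' | hN'
  · have hv : ∀ k, v k = 0 := by
      rw [← hN', eq_comm, zero_pow two_ne_zero,
        Finset.sum_eq_zero_iff_of_nonneg fun _ _ => by positivity] at hN2
      simpa using hN2
    simp [hH, ← hN', hv]
  rcases hH0.eq_or_lt with hH' | hH'
  · have h := (norm_nonneg _).trans (hM v)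
    rw [← hN2] at h
    rw [← hH']
    exact mul_nonneg (nonneg_of_mul_nonneg_left h (by positivity)) hN0
  have hBv : B (fun k => (H : ℂ) * v k)
      (fun j => (N : ℂ) * (starRingEnd ℂ) (∑ k, A j k * v k)) = (H * N * H ^ 2 : ℝ) := by
    rw [hH2]
    push_cast
    simp only [hB, Finset.mul_sum]
    refine Finset.sum_congr rfl fun j _ => ?_
    rw [← Complex.mul_conj']
    simp only [mul_left_comm _ (H : ℂ), ← Finset.mul_sum]
    ring
  have h := hbound (fun k => (H : ℂ) * v k)
    (fun j => (N : ℂ) * (starRingEnd ℂ) (∑ k, A j k * v k))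
  rw [hBv, Complex.norm_real, Real.norm_of_nonneg (by positivity)] at h
  simp only [norm_mul, Complex.norm_real, RCLike.norm_conj, mul_pow, ← Finset.mul_sum, ← hN2,
    ← hH2, Real.norm_eq_abs, sq_abs] at h
  have hpos : 0 < 2 * H ^ 2 * N := by positivity
  refine le_of_mul_le_mul_left ?_ hpos
  linarith

theorem norm_quadratic_form_le_of_im_le {n : Type*} [Fintype n] {A : n → n → ℂ} {w : ℂ}
    (hw : w ≠ 0)
    (h : ∀ u : n → ℂ, (-(∑ j, (∑ k, A j k * u k) * u j) / (2 * w)).im ≤ ∑ j, ‖u j‖ ^ 2)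
    (u : n → ℂ) :
    ‖∑ j, (∑ k, A j k * u k) * u j‖ ≤ 2 * ‖w‖ * ∑ j, ‖u j‖ ^ 2 := by
  obtain ⟨c, hc, hcq⟩ := Complex.exists_sq_mul_eq_norm_mul_I
    (-(∑ j, (∑ k, A j k * u k) * u j) / (2 * w))
  have h := h fun j => c * u j
  have hscale : ∑ j, (∑ k, A j k * (c * u k)) * (c * u j) =
      c ^ 2 * ∑ j, (∑ k, A j k * u k) * u j := by
    simp only [Finset.mul_sum, Finset.sum_mul]
    exact Finset.sum_congr rfl fun j _ => Finset.sum_congr rfl fun k _ => by ring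
  rw [hscale, ← mul_neg, mul_div_assoc, hcq] at h
  have hw' : 0 < ‖w‖ := norm_pos_iff.2 hw
  simp only [norm_mul, hc, one_mul, norm_div, norm_neg, Complex.norm_ofNat] at h
  rw [Complex.im_ofReal_mul, Complex.I_im, mul_one, div_le_iff₀ (by positivity)] at h
  rwa [mul_comm]

/-- If a polynomial `p` in `d = m+1 ≥ 2` complex variables
`(z_1,…,z_m,w)` is non-vanishing on the part of the Siegel half-space
`U_d = {(z,w) : Im w > ∑ |z_j|²}` within distance `ε` of the origin, `p(0) = 0`,
and `∇p(0) ≠ 0`, then `∇p(0)` is a nonzero multiple of `e_d` (all `z`-partials vanish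
at `0` and `∂p/∂w(0) ≠ 0`), and the Hessian `Hp(0) = (∂²p/∂z_j∂z_k(0))` satisfies
`‖Hp(0)·v‖ ≤ 2|∂p/∂w(0)|·‖v‖` for all `v ∈ ℂ^m` (Euclidean norms), i.e.
`(1/(2|∇p(0)|))Hp(0)` is contractive. -/
theorem statement2 (m : ℕ) (hm : 1 ≤ m) (p : MvPolynomial (Fin (m + 1)) ℂ)
    (ε : ℝ) (hε : 0 < ε)
    (hstable : ∀ v : Fin (m + 1) → ℂ,
      (∑ j : Fin m, ‖v j.castSucc‖ ^ 2) < (v (Fin.last m)).im →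
      (∑ j : Fin (m + 1), ‖v j‖ ^ 2) < ε ^ 2 →
      eval v p ≠ 0)
    (h0 : eval 0 p = 0)
    (hgrad : ∃ j : Fin (m + 1), eval 0 (pderiv j p) ≠ 0) :
    (∀ j : Fin m, eval 0 (pderiv j.castSucc p) = 0) ∧
    eval 0 (pderiv (Fin.last m) p) ≠ 0 ∧
    ∀ v : Fin m → ℂ,
      Real.sqrt (∑ j : Fin m,
          ‖∑ k : Fin m, eval 0 (pderiv j.castSucc (pderiv k.castSucc p)) * v k‖ ^ 2)
        ≤ 2 * ‖eval 0 (pderiv (Fin.last m) p)‖ * Real.sqrt (∑ k : Fin m, ‖v k‖ ^ 2) := by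
  have hz := eval_pderiv_castSucc_eq_zero_of_siegel hε hstable h0
  have hw : eval 0 (pderiv (Fin.last m) p) ≠ 0 := by
    obtain ⟨j, hj⟩ := hgrad
    induction j using Fin.lastCases with
    | last => exact hj
    | cast j => exact absurd (hz j) hj
  have hsymm : ∀ j k : Fin m, eval 0 (pderiv j.castSucc (pderiv k.castSucc p)) =
      eval 0 (pderiv k.castSucc (pderiv j.castSucc p)) := fun j k => by
    rw [MvPolynomial.pderiv_comm]
  have hbound := im_le_of_siegel hε hstable h0 hz hw
  refine ⟨hz, hw, ?_⟩
  generalize hA : (fun j k : Fin m => eval 0 (pderiv j.castSucc (pderiv k.castSucc p))) = A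
  have hA' : ∀ j k : Fin m, eval 0 (pderiv j.castSucc (pderiv k.castSucc p)) = A j k :=
    fun j k => congrFun (congrFun hA j) k
  simp only [hA'] at hsymm hbound ⊢
  exact sqrt_sum_norm_sq_le_of_symm hsymm (norm_quadratic_form_le_of_im_le hw hbound)
end

section
/- Let d ≥ 2 and let p be a polynomial in the d complex variables (z_1,…,z_{d−1},w) with p(0) = 0, ∂p/∂z_j(0) = 0 for all j = 1,…,d−1, ∂p/∂w(0) ≠ 0, and suppose the Hessian matrix Hp(0) = (∂²p/∂z_j∂z_k(0))_{j,k=1,…,d−1} satisfies the strict contraction bound: ‖Hp(0)·v‖ < 2|∂p/∂w(0)|·‖v‖ for all nonzero v ∈ ℂ^{d−1}, where the operator norm of (1/(2|∂p/∂w(0)|))Hp(0) is strictly less than 1. Then there exists ε > 0 such that p(z,w) ≠ 0 for every (z,w) in the Siegel half-space U_d with |(z,w)| < ε. -/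
open MvPolynomial

/-- A polynomial minus its constant term lies in the ideal generated by the variables. -/
theorem exists_eq_C_add_sum_X_mul {σ R : Type*} [Fintype σ] [CommSemiring R]
    (p : MvPolynomial σ R) :
    ∃ q : σ → MvPolynomial σ R, p = C (eval 0 p) + ∑ i, X i * q i := by
  classical
  induction p using MvPolynomial.induction_on with
  | C a => exact ⟨0, by simp⟩
  | add p₁ p₂ h₁ h₂ =>
    obtain ⟨q₁, h₁⟩ := h₁
    obtain ⟨q₂, h₂⟩ := h₂
    refine ⟨q₁ + q₂, ?_⟩
    simp only [Pi.add_apply, mul_add, Finset.sum_add_distrib, map_add]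
    nth_rewrite 1 [h₁, h₂]
    ring
  | mul_X p n _ =>
    exact ⟨Pi.single n p, by simp [Pi.single_apply, mul_comm]⟩

/-- The coefficients of the linear decomposition at `0` are the first-order derivatives. -/
theorem eval_zero_pderiv_of_eq {σ R : Type*} [Fintype σ] [CommSemiring R]
    {p : MvPolynomial σ R} {a : R} {q : σ → MvPolynomial σ R}
    (h : p = C a + ∑ i, X i * q i) (j : σ) :
    eval 0 (pderiv j p) = eval 0 (q j) := by
  classical
  simp [h, Derivation.leibniz, pderiv_X, Pi.single_apply, apply_ite, eq_comm]

/-- The second-order derivatives at `0` in terms of the linear decomposition. -/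
theorem eval_zero_pderiv_pderiv_of_eq {σ R : Type*} [Fintype σ] [CommSemiring R]
    {p : MvPolynomial σ R} {a : R} {q : σ → MvPolynomial σ R}
    (h : p = C a + ∑ i, X i * q i) (j k : σ) :
    eval 0 (pderiv j (pderiv k p)) =
      eval 0 (pderiv k (q j)) + eval 0 (pderiv j (q k)) := by
  classical
  have hp : pderiv k p = q k + ∑ i, X i * pderiv k (q i) := by
    simp [h, Derivation.leibniz, pderiv_X, Pi.single_apply, Finset.sum_add_distrib, add_comm]
  rw [hp, map_add, map_add, add_comm]
  congr 1
  simp [Derivation.leibniz, pderiv_X, Pi.single_apply, apply_ite, eq_comm]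

/-- A polynomial singular at `0` in all variables but the last one is a multiple of the last
variable plus a quadratic form in the others, with polynomial coefficients. -/
theorem exists_eval_eq_mul_add_quadratic {m : ℕ} (p : MvPolynomial (Fin (m + 1)) ℂ)
    (h0 : eval 0 p = 0) (hz : ∀ j : Fin m, eval 0 (pderiv j.castSucc p) = 0) :
    ∃ (A : MvPolynomial (Fin (m + 1)) ℂ) (B : Fin m → Fin m → MvPolynomial (Fin (m + 1)) ℂ),
      eval 0 A = eval 0 (pderiv (Fin.last m) p) ∧
      (∀ j k, eval 0 (B j k) = eval 0 (pderiv j.castSucc (pderiv k.castSucc p))) ∧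
      ∀ v, 2 * eval v p = 2 * (v (Fin.last m) * eval v A) +
        ∑ j : Fin m, v j.castSucc * ∑ k : Fin m, eval v (B j k) * v k.castSucc := by
  obtain ⟨q, hq⟩ := exists_eq_C_add_sum_X_mul p
  choose r hr using fun i => exists_eq_C_add_sum_X_mul (q i)
  refine ⟨q (Fin.last m) + ∑ j : Fin m, X j.castSucc * r j.castSucc (Fin.last m),
    fun j k => r j.castSucc k.castSucc + r k.castSucc j.castSucc, ?_, ?_, ?_⟩
  · rw [eval_zero_pderiv_of_eq hq]
    simp
  · intro j k
    rw [eval_zero_pderiv_pderiv_of_eq hq, eval_zero_pderiv_of_eq (hr _),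
      eval_zero_pderiv_of_eq (hr _), map_add]
  · intro v
    have hp : eval v p = ∑ i, v i * eval v (q i) := by
      nth_rewrite 1 [hq]
      rw [h0]
      simp
    have hqj (j : Fin m) : eval v (q j.castSucc) = ∑ i, v i * eval v (r j.castSucc i) := by
      nth_rewrite 1 [hr]
      rw [← eval_zero_pderiv_of_eq hq, hz]
      simp
    have hswap : ∑ j : Fin m, ∑ k : Fin m,
        v j.castSucc * (eval v (r k.castSucc j.castSucc) * v k.castSucc) =
        ∑ j : Fin m, ∑ k : Fin m,
          v j.castSucc * (v k.castSucc * eval v (r j.castSucc k.castSucc)) := by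
      rw [Finset.sum_comm]
      refine Finset.sum_congr rfl fun j _ => Finset.sum_congr rfl fun k _ => by ring
    have hcomm : ∑ j : Fin m, ∑ k : Fin m,
        v j.castSucc * (eval v (r j.castSucc k.castSucc) * v k.castSucc) =
        ∑ j : Fin m, ∑ k : Fin m,
          v j.castSucc * (v k.castSucc * eval v (r j.castSucc k.castSucc)) := by
      refine Finset.sum_congr rfl fun j _ => Finset.sum_congr rfl fun k _ => by ring
    have hlast : ∑ j : Fin m, v j.castSucc *
        (v (Fin.last m) * eval v (r j.castSucc (Fin.last m))) =
        v (Fin.last m) * ∑ j : Fin m, v j.castSucc * eval v (r j.castSucc (Fin.last m)) := by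
      rw [Finset.mul_sum]
      refine Finset.sum_congr rfl fun j _ => by ring
    rw [hp, Fin.sum_univ_castSucc]
    simp only [hqj, two_mul, Fin.sum_univ_castSucc, map_add, map_sum, map_mul, eval_X, mul_add, add_mul,
      Finset.sum_add_distrib, Finset.mul_sum] at hlast ⊢
    rw [hlast, hswap, hcomm]
    ring

/-- Cauchy–Schwarz: a bilinear form is controlled by the norm of the associated vector. -/
theorem norm_sum_mul_le_sqrt_mul_sqrt {ι : Type*} [Fintype ι] (u x : ι → ℂ) :
    ‖∑ j, u j * x j‖ ≤ √(∑ j, ‖u j‖ ^ 2) * √(∑ j, ‖x j‖ ^ 2) :=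
  (norm_sum_le _ _).trans <| by
    simpa only [norm_mul] using Real.sum_mul_le_sqrt_mul_sqrt Finset.univ (‖u ·‖) (‖x ·‖)

/-- A strict bound on a quadratic form persists under small continuous perturbations of its
coefficients. -/
theorem eventually_forall_norm_quadratic_lt {E ι : Type*} [TopologicalSpace E] [Fintype ι]
    {b : E → ι → ι → ℂ} {c : E → ℝ} (hb : ∀ j k, Continuous fun x => b x j k)
    (hc : Continuous c) {x₀ : E}
    (h : ∀ u : ι → ℂ, u ≠ 0 →
      ‖∑ j, u j * ∑ k, b x₀ j k * u k‖ < c x₀ * ∑ j, ‖u j‖ ^ 2) :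
    ∀ᶠ x in nhds x₀, ∀ u : ι → ℂ, u ≠ 0 →
      ‖∑ j, u j * ∑ k, b x j k * u k‖ < c x * ∑ j, ‖u j‖ ^ 2 := by
  have key : ∀ᶠ x in nhds x₀, ∀ u ∈ Metric.sphere (0 : ι → ℂ) 1,
      ‖∑ j, u j * ∑ k, b x j k * u k‖ < c x * ∑ j, ‖u j‖ ^ 2 := by
    refine (isCompact_sphere (0 : ι → ℂ) 1).eventually_forall_of_forall_eventually fun u hu => ?_
    have hu0 : u ≠ 0 := ne_zero_of_mem_unit_sphere ⟨u, hu⟩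
    refine ContinuousAt.eventually_lt (f := fun y : E × (ι → ℂ) =>
      ‖∑ j, y.2 j * ∑ k, b y.1 j k * y.2 k‖)
      (g := fun y => c y.1 * ∑ j, ‖y.2 j‖ ^ 2) ?_ ?_ (h u hu0)
    all_goals
      refine Continuous.continuousAt ?_
      fun_prop
  filter_upwards [key] with x hx u hu
  obtain ⟨t, ht0, htn⟩ : ∃ t : ℂ, t ≠ 0 ∧ ‖t‖ = ‖u‖ :=
    ⟨(‖u‖ : ℂ), by simpa using hu, by simp⟩
  obtain ⟨e, rfl⟩ : ∃ e : ι → ℂ, u = t • e := ⟨t⁻¹ • u, by simp [smul_smul, ht0]⟩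
  have he : e ∈ Metric.sphere (0 : ι → ℂ) 1 := by
    rw [norm_smul] at htn
    have : ‖t‖ ≠ 0 := norm_ne_zero_iff.2 ht0
    rw [mem_sphere_zero_iff_norm]
    exact (mul_eq_left₀ this).1 htn.symm
  have h₁ : ∑ j, (t • e) j * ∑ k, b x j k * (t • e) k =
      t ^ 2 * ∑ j, e j * ∑ k, b x j k * e k := by
    simp only [Pi.smul_apply, smul_eq_mul, Finset.mul_sum]
    refine Finset.sum_congr rfl fun j _ => Finset.sum_congr rfl fun k _ => by ring
  have h₂ : ∑ j, ‖(t • e) j‖ ^ 2 = ‖t‖ ^ 2 * ∑ j, ‖e j‖ ^ 2 := by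
    simp only [Pi.smul_apply, smul_eq_mul, norm_mul, mul_pow, Finset.mul_sum]
  rw [h₁, h₂, norm_mul, norm_pow, mul_left_comm]
  exact mul_lt_mul_of_pos_left (hx e he) (pow_pos (norm_pos_iff.2 ht0) 2)

/-- (Partial converse.) If a polynomial `p` in `d = m+1 ≥ 2` complex
variables `(z_1,…,z_m,w)` satisfies `p(0) = 0`, `∂p/∂z_j(0) = 0` for all `j`,
`∂p/∂w(0) ≠ 0`, and the Hessian `Hp(0) = (∂²p/∂z_j∂z_k(0))` satisfies the strict
contraction bound `‖Hp(0)·v‖ < 2|∂p/∂w(0)|·‖v‖` for all nonzero `v ∈ ℂ^m`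
(Euclidean norms), then `p` is non-vanishing near `0` within the Siegel half-space
`U_d = {(z,w) : Im w > ∑ |z_j|²}`. -/
theorem statement3 (m : ℕ) (hm : 1 ≤ m) (p : MvPolynomial (Fin (m + 1)) ℂ)
    (h0 : eval 0 p = 0)
    (hz : ∀ j : Fin m, eval 0 (pderiv j.castSucc p) = 0)
    (hw : eval 0 (pderiv (Fin.last m) p) ≠ 0)
    (hH : ∀ v : Fin m → ℂ, v ≠ 0 →
      Real.sqrt (∑ j : Fin m,
          ‖∑ k : Fin m, eval 0 (pderiv j.castSucc (pderiv k.castSucc p)) * v k‖ ^ 2)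
        < 2 * ‖eval 0 (pderiv (Fin.last m) p)‖ * Real.sqrt (∑ k : Fin m, ‖v k‖ ^ 2)) :
    ∃ ε : ℝ, 0 < ε ∧ ∀ v : Fin (m + 1) → ℂ,
      (∑ j : Fin m, ‖v j.castSucc‖ ^ 2) < (v (Fin.last m)).im →
      (∑ j : Fin (m + 1), ‖v j‖ ^ 2) < ε ^ 2 →
      eval v p ≠ 0 := by
  obtain ⟨A, B, hA, hB, hp⟩ := exists_eval_eq_mul_add_quadratic p h0 hz
  have hquad : ∀ᶠ v : Fin (m + 1) → ℂ in nhds 0, ∀ u : Fin m → ℂ, u ≠ 0 →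
      ‖∑ j, u j * ∑ k, eval v (B j k) * u k‖ < 2 * ‖eval v A‖ * ∑ j, ‖u j‖ ^ 2 := by
    refine eventually_forall_norm_quadratic_lt (b := fun v j k => eval v (B j k))
      (c := fun v => 2 * ‖eval v A‖) (fun j k => (B j k).continuous_eval)
      (continuous_const.mul A.continuous_eval.norm) fun u hu => ?_
    have hpos : 0 < √(∑ j, ‖u j‖ ^ 2) := by
      obtain ⟨i, hi⟩ := Function.ne_iff.1 hu
      exact Real.sqrt_pos.2 <| Finset.sum_pos' (fun _ _ => by positivity)
        ⟨i, Finset.mem_univ i, pow_pos (norm_pos_iff.2 hi) 2⟩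
    have hlt := mul_lt_mul_of_pos_left (hH u hu) hpos
    simp only [hB, hA]
    refine (norm_sum_mul_le_sqrt_mul_sqrt _ _).trans_lt (hlt.trans_eq ?_)
    rw [mul_left_comm, Real.mul_self_sqrt (by positivity)]
  have hne : ∀ᶠ v : Fin (m + 1) → ℂ in nhds 0, eval v A ≠ 0 :=
    A.continuous_eval.continuousAt.eventually_ne (hA ▸ hw)
  obtain ⟨ε, hε, hball⟩ := Metric.eventually_nhds_iff.1 (hquad.and hne)
  refine ⟨ε, hε, fun v hv hvε hpv => ?_⟩
  have hdist : dist v 0 < ε := by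
    rw [dist_zero_right, pi_norm_lt_iff hε]
    intro i
    refine lt_of_pow_lt_pow_left₀ 2 hε.le (lt_of_le_of_lt ?_ hvε)
    exact Finset.single_le_sum (f := fun j => ‖v j‖ ^ 2) (fun _ _ => by positivity)
      (Finset.mem_univ i)
  obtain ⟨hq, hAv⟩ := hball hdist
  have hlt : ∑ j : Fin m, ‖v j.castSucc‖ ^ 2 < ‖v (Fin.last m)‖ :=
    hv.trans_le ((le_abs_self _).trans (Complex.abs_im_le_norm _))
  have hApos : 0 < ‖eval v A‖ := norm_pos_iff.2 hAv
  have heq : ‖∑ j : Fin m, v j.castSucc * ∑ k : Fin m, eval v (B j k) * v k.castSucc‖ =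
      2 * ‖eval v A‖ * ‖v (Fin.last m)‖ := by
    have h := hp v
    rw [hpv, mul_zero] at h
    rw [eq_neg_of_add_eq_zero_right h.symm]
    simp only [norm_neg, norm_mul, Complex.norm_ofNat]
    ring
  have hle : 2 * ‖eval v A‖ * ‖v (Fin.last m)‖ ≤
      2 * ‖eval v A‖ * ∑ j : Fin m, ‖v j.castSucc‖ ^ 2 := by
    rw [← heq]
    by_cases hu : (fun j : Fin m => v j.castSucc) = 0
    · simp [fun j : Fin m => congrFun hu j]
    · exact (hq _ hu).le
  exact absurd (le_of_mul_le_mul_left hle (by positivity)) hlt.not_ge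
end

section
/- Let d ≥ 2 and let φ be a function of z ∈ ℂ^{d−1}, analytic on a neighborhood of 0, such that φ(z) = zᵀAz + O(|z|³) as z → 0, where A is a complex symmetric (d−1)×(d−1) matrix of operator norm strictly less than 1 and zᵀAz = Σ_{j,k} A_{jk} z_j z_k. Then there exist constants c, C, ε > 0 such that for every (z,w) in the Siegel half-space U_d with |(z,w)| < ε, c·(|w| + |z|²) ≤ |w − φ(z)| ≤ C·(|w| + |z|²). In particular, the graph w = φ(z) does not meet U_d near the origin. -/
/-- If `A` has operator norm at most `r`, then `|zᵀAz| ≤ r |z|²`. -/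
lemma norm_quadratic_form_le {m : ℕ} (A : Matrix (Fin m) (Fin m) ℂ) (r : ℝ) (z : Fin m → ℂ)
    (hA : Real.sqrt (∑ j, ‖A.mulVec z j‖ ^ 2) ≤ r * Real.sqrt (∑ j, ‖z j‖ ^ 2)) :
    ‖∑ j, ∑ k, A j k * z j * z k‖ ≤ r * ∑ j, ‖z j‖ ^ 2 := by
  have hs : 0 ≤ ∑ j, ‖z j‖ ^ 2 := by positivity
  have hform : ∑ j, ∑ k, A j k * z j * z k = ∑ j, z j * A.mulVec z j := by
    simp only [Matrix.mulVec, dotProduct, Finset.mul_sum]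
    exact Finset.sum_congr rfl fun j _ => Finset.sum_congr rfl fun k _ => by ring
  calc ‖∑ j, ∑ k, A j k * z j * z k‖
      ≤ ∑ j, ‖z j‖ * ‖A.mulVec z j‖ := by
        rw [hform]
        exact (norm_sum_le _ _).trans_eq (Finset.sum_congr rfl fun j _ => norm_mul _ _)
    _ ≤ Real.sqrt (∑ j, ‖z j‖ ^ 2) * Real.sqrt (∑ j, ‖A.mulVec z j‖ ^ 2) :=
        Real.sum_mul_le_sqrt_mul_sqrt _ _ _
    _ ≤ Real.sqrt (∑ j, ‖z j‖ ^ 2) * (r * Real.sqrt (∑ j, ‖z j‖ ^ 2)) := by gcongr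
    _ = r * (Real.sqrt (∑ j, ‖z j‖ ^ 2) * Real.sqrt (∑ j, ‖z j‖ ^ 2)) := by ring
    _ = r * ∑ j, ‖z j‖ ^ 2 := by rw [Real.mul_self_sqrt hs]


/-- If `φ` is analytic near `0 ∈ ℂ^m` with `φ(z) = zᵀAz + O(|z|³)`,
where `A` is complex symmetric of operator norm strictly less than `1`, then
`|w − φ(z)| ≍ |w| + |z|²` on the Siegel half-space
`U_d = {(z,w) : Im w > ∑ |z_j|²}` near the origin; in particular the graph
`w = φ(z)` does not meet `U_d` near the origin. -/
theorem statement4 (m : ℕ) (hm : 1 ≤ m) (φ : (Fin m → ℂ) → ℂ)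
    (hφ : AnalyticAt ℂ φ 0)
    (A : Matrix (Fin m) (Fin m) ℂ) (hAsym : A.transpose = A)
    (hA : ∃ r : ℝ, r < 1 ∧ ∀ v : Fin m → ℂ,
      Real.sqrt (∑ j, ‖A.mulVec v j‖ ^ 2) ≤ r * Real.sqrt (∑ j, ‖v j‖ ^ 2))
    (hO : ∃ C₀ δ : ℝ, 0 < C₀ ∧ 0 < δ ∧ ∀ z : Fin m → ℂ,
      Real.sqrt (∑ j, ‖z j‖ ^ 2) < δ →
      ‖φ z - ∑ j, ∑ k, A j k * z j * z k‖ ≤ C₀ * Real.sqrt (∑ j, ‖z j‖ ^ 2) ^ 3) :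
    ∃ c C ε : ℝ, 0 < c ∧ 0 < C ∧ 0 < ε ∧
      ∀ (z : Fin m → ℂ) (w : ℂ),
        (∑ j, ‖z j‖ ^ 2) < w.im →
        (∑ j, ‖z j‖ ^ 2) + ‖w‖ ^ 2 < ε ^ 2 →
        c * (‖w‖ + ∑ j, ‖z j‖ ^ 2) ≤ ‖w - φ z‖ ∧
        ‖w - φ z‖ ≤ C * (‖w‖ + ∑ j, ‖z j‖ ^ 2) ∧
        w ≠ φ z := by
  obtain ⟨r₀, hr₀, hA⟩ := hA
  obtain ⟨C₀, δ, hC₀, hδ, hO⟩ := hO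
  obtain ⟨r, hr_nonneg, hr, hr₀r⟩ : ∃ r : ℝ, 0 ≤ r ∧ r < 1 ∧ r₀ ≤ r :=
    ⟨max r₀ 0, le_max_right _ _, max_lt hr₀ one_pos, le_max_left _ _⟩
  have hη : 0 < (1 - r) / (2 * C₀) := div_pos (by linarith) (by positivity)
  refine ⟨(1 - r) / 4, 1, min δ ((1 - r) / (2 * C₀)), by linarith, one_pos, lt_min hδ hη, ?_⟩
  intro z w hzw hε
  have hquad := norm_quadratic_form_le A r z
    ((hA z).trans (mul_le_mul_of_nonneg_right hr₀r (Real.sqrt_nonneg _)))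
  have herr := hO z
  have hs : 0 ≤ ∑ j, ‖z j‖ ^ 2 := by positivity
  have hw : ∑ j, ‖z j‖ ^ 2 < ‖w‖ := hzw.trans_le (Complex.im_le_norm w)
  generalize ∑ j, ‖z j‖ ^ 2 = s at *
  have hsqrt : Real.sqrt s < min δ ((1 - r) / (2 * C₀)) := by
    rw [Real.sqrt_lt' (lt_min hδ hη)]
    nlinarith [sq_nonneg ‖w‖]
  have hcube : C₀ * Real.sqrt s ^ 3 ≤ (1 - r) / 2 * s := by
    have hsmall : C₀ * Real.sqrt s ≤ (1 - r) / 2 := by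
      have h := (lt_div_iff₀ (by positivity)).1 (hsqrt.trans_le (min_le_right _ _))
      linarith
    calc C₀ * Real.sqrt s ^ 3 = C₀ * Real.sqrt s * Real.sqrt s ^ 2 := by ring
      _ = C₀ * Real.sqrt s * s := by rw [Real.sq_sqrt hs]
      _ ≤ (1 - r) / 2 * s := mul_le_mul_of_nonneg_right hsmall hs
  have hφz : ‖φ z‖ ≤ (1 + r) / 2 * s := by
    have h := norm_le_norm_add_norm_sub' (φ z) (∑ j, ∑ k, A j k * z j * z k)
    linarith [herr (hsqrt.trans_le (min_le_left _ _))]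
  have hlower : (1 - r) / 4 * (‖w‖ + s) ≤ ‖w - φ z‖ := by
    nlinarith [norm_sub_norm_le w (φ z)]
  refine ⟨hlower, ?_, ?_⟩
  · nlinarith [norm_sub_le w (φ z)]
  · rintro rfl
    rw [sub_self, norm_zero] at hlower
    nlinarith
end

section
/- Let d ≥ 2 and let p be a polynomial in (z_1,…,z_{d−1},w) with p(0) = 0, ∂p/∂z_j(0) = 0 for all j, ∂p/∂w(0) ≠ 0, and suppose the matrix (1/(2|∂p/∂w(0)|))·(∂²p/∂z_j∂z_k(0))_{j,k} has operator norm strictly less than 1. Then for a function q analytic in a neighborhood of 0 in ℂ^d, the following are equivalent: (i) there exist C, ε > 0 such that |q(z,w)| ≤ C|p(z,w)| for all (z,w) in the Siegel half-space U_d with |(z,w)| < ε; (ii) q belongs to the ideal (w, (z)²) of the ring of convergent power series at 0, i.e., q(z,w) = a(z,w)·w + Σ_{j,k=1}^{d−1} b_{jk}(z,w)·z_j z_k for some functions a, b_{jk} analytic near 0; equivalently, q(0) = 0 and ∂q/∂z_j(0) = 0 for all j = 1,…,d−1. -/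
open MvPolynomial

open Asymptotics Filter Topology

/-- Second order Taylor expansion of a polynomial at the origin. -/
theorem MvPolynomial.isBigO_sub_taylor_two {n : ℕ} (p : MvPolynomial (Fin n) ℂ) :
    (fun v : Fin n → ℂ => eval v p - (eval 0 p + ∑ i, v i * eval 0 (pderiv i p)
      + 1 / 2 * ∑ i, v i * ∑ j, eval 0 (pderiv i (pderiv j p)) * v j))
      =O[𝓝 0] fun v => ‖v‖ ^ 3 := by
  induction p using MvPolynomial.induction_on with
  | C a => simpa using isBigO_zero _ _
  | add p q hp hq =>
    refine (hp.add hq).congr_left fun v => ?_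
    simp only [map_add, mul_add, add_mul, Finset.sum_add_distrib]
    ring
  | mul_X p k hp =>
    have hlin (i : Fin n) : (fun v : Fin n → ℂ => v i) =O[𝓝 0] fun v => ‖v‖ :=
      IsBigO.of_norm_le fun v => norm_le_pi_norm v i
    have hcub : (fun v : Fin n → ℂ => v k *
        (1 / 2 * ∑ i, v i * ∑ j, eval 0 (pderiv i (pderiv j p)) * v j))
        =O[𝓝 0] fun v => ‖v‖ ^ 3 := by
      refine ((hlin k).mul (g₂ := fun v => ‖v‖ ^ 2) ?_).congr_right fun v => by ring
      refine IsBigO.const_mul_left (.fun_sum fun i _ => ?_) _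
      refine ((hlin i).mul (g₂ := fun v => ‖v‖) ?_).congr_right fun v => by ring
      exact .fun_sum fun j _ => (hlin j).const_mul_left _
    have hbdd : (fun v : Fin n → ℂ => v k) =O[𝓝 0] fun _ => (1 : ℝ) :=
      ((continuous_apply k).tendsto 0).isBigO_one ℝ
    have h := (hbdd.mul hp).congr_right (g₂ := fun v : Fin n → ℂ => ‖v‖ ^ 3) fun v => by ring
    refine (h.add hcub).congr_left fun v => ?_
    have h1 : ∑ i, v i * eval 0 (pderiv i (p * X k)) = v k * eval 0 p := by
      simp [pderiv_X, Pi.single_apply, apply_ite]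
    have h2 : ∑ i, v i * ∑ j, eval 0 (pderiv i (pderiv j (p * X k))) * v j
        = 2 * (v k * ∑ i, v i * eval 0 (pderiv i p)) := by
      have h3 (i j : Fin n) : eval 0 (pderiv i (pderiv j (p * X k)))
          = (if k = i then eval 0 (pderiv j p) else 0)
            + (if k = j then eval 0 (pderiv i p) else 0) := by
        simp only [pderiv_mul, pderiv_X, map_add, map_mul, Pi.single_apply]
        split_ifs <;> simp
      have h4 (i : Fin n) : ∑ j, eval 0 (pderiv i (pderiv j (p * X k))) * v j
          = (if k = i then ∑ j, v j * eval 0 (pderiv j p) else 0)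
            + v k * eval 0 (pderiv i p) := by
        simp only [h3, add_mul, Finset.sum_add_distrib, ite_mul, zero_mul, Finset.sum_ite_eq,
          Finset.mem_univ, if_true]
        split_ifs <;> simp only [Finset.sum_const_zero, mul_comm (v _)]
      simp only [h4, mul_add, Finset.sum_add_distrib, mul_ite, mul_zero, Finset.sum_ite_eq,
        Finset.mem_univ, if_true, two_mul, Finset.mul_sum]
      congr 1
      exact Finset.sum_congr rfl fun i _ => by ring
    rw [h1, h2]
    simp only [map_mul, eval_X, Pi.zero_apply, mul_zero]
    ring

/-- An analytic function agrees with its affine approximation up to second order. -/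
theorem AnalyticAt.isBigO_sub_fderiv {E F : Type*} [NormedAddCommGroup E] [NormedSpace ℂ E]
    [NormedAddCommGroup F] [NormedSpace ℂ F] {q : E → F} (hq : AnalyticAt ℂ q 0) :
    (fun v => q v - (q 0 + fderiv ℂ q 0 v)) =O[𝓝 0] fun v => ‖v‖ ^ 2 := by
  obtain ⟨P, hP⟩ := hq
  have h := hP.isBigO_sub_partialSum_pow 2
  simp only [zero_add] at h
  refine h.congr_left fun v => ?_
  rw [hP.hasFDerivAt.fderiv]
  simp [FormalMultilinearSeries.partialSum, Finset.sum_range_succ, hP.coeff_zero]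
  congr 1
  ext i
  simp [Subsingleton.elim i 0]

/-- A continuous function that is homogeneous of degree two and positive away from the origin
dominates a positive multiple of the squared Euclidean norm. -/
theorem exists_pos_mul_sum_sq_le_of_homogeneous {m : ℕ} {f : (Fin m → ℂ) → ℝ}
    (hf : Continuous f) (hhom : ∀ (t : ℝ) z, f ((t : ℂ) • z) = t ^ 2 * f z)
    (hpos : ∀ z, z ≠ 0 → 0 < f z) :
    ∃ δ > 0, ∀ z, δ * ∑ j, ‖z j‖ ^ 2 ≤ f z := by
  obtain ⟨a, ha, h⟩ := (isCompact_sphere (0 : Fin m → ℂ) 1).exists_forall_le' hf.continuousOn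
    (a := 0) fun z hz => hpos z (ne_zero_of_mem_unit_sphere ⟨z, hz⟩)
  refine ⟨a / (m + 1), by positivity, fun z => ?_⟩
  rcases eq_or_ne z 0 with rfl | hz
  · have := hhom 0 0
    simp at this
    simp [this]
  have hz' : 0 < ‖z‖ := norm_pos_iff.2 hz
  have hmem : ((‖z‖⁻¹ : ℝ) : ℂ) • z ∈ Metric.sphere (0 : Fin m → ℂ) 1 := by
    simp [norm_smul, hz'.ne']
  have h1 := h _ hmem
  rw [hhom, inv_pow, ← div_eq_inv_mul, le_div_iff₀ (by positivity)] at h1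
  have h2 : ∑ j, ‖z j‖ ^ 2 ≤ (m + 1) * ‖z‖ ^ 2 := by
    calc ∑ j, ‖z j‖ ^ 2 ≤ ∑ _j : Fin m, ‖z‖ ^ 2 := by
          gcongr with j; exact norm_le_pi_norm z j
      _ ≤ (m + 1) * ‖z‖ ^ 2 := by simp; nlinarith [sq_nonneg ‖z‖]
  calc a / (m + 1) * ∑ j, ‖z j‖ ^ 2 ≤ a / (m + 1) * ((m + 1) * ‖z‖ ^ 2) := by gcongr
    _ = a * ‖z‖ ^ 2 := by field_simp
    _ ≤ f z := h1

/-- The quadratic form of a matrix satisfying a strict operator norm bound satisfies the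
corresponding strict bound, uniformly. -/
theorem exists_norm_quadratic_form_le {m : ℕ} {A : Fin m → Fin m → ℂ} {c : ℝ}
    (hA : ∀ v : Fin m → ℂ, v ≠ 0 →
      √(∑ j, ‖∑ k, A j k * v k‖ ^ 2) < 2 * c * √(∑ k, ‖v k‖ ^ 2)) :
    ∃ δ > 0, ∀ z : Fin m → ℂ,
      ‖1 / 2 * ∑ j, z j * ∑ k, A j k * z k‖ + δ * ∑ j, ‖z j‖ ^ 2 ≤ c * ∑ j, ‖z j‖ ^ 2 := by
  suffices h : ∃ δ > 0, ∀ z : Fin m → ℂ, δ * ∑ j, ‖z j‖ ^ 2 ≤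
      c * ∑ j, ‖z j‖ ^ 2 - ‖1 / 2 * ∑ j, z j * ∑ k, A j k * z k‖ by
    obtain ⟨δ, hδ, h⟩ := h
    exact ⟨δ, hδ, fun z => by linarith [h z]⟩
  refine exists_pos_mul_sum_sq_le_of_homogeneous (by fun_prop) ?_ ?_
  · intro t z
    have h1 : ∑ j, ‖((t : ℂ) • z) j‖ ^ 2 = t ^ 2 * ∑ j, ‖z j‖ ^ 2 := by
      simp [mul_pow, Finset.mul_sum]
    have h2 : ∑ j, ((t : ℂ) • z) j * ∑ k, A j k * ((t : ℂ) • z) k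
        = (t : ℂ) ^ 2 * ∑ j, z j * ∑ k, A j k * z k := by
      simp only [Finset.mul_sum, Pi.smul_apply, smul_eq_mul]
      refine Finset.sum_congr rfl fun j _ => Finset.sum_congr rfl fun k _ => by ring
    simp only [h1, h2]
    simp
    ring_nf
  · intro z hz
    have hS : 0 < √(∑ k, ‖z k‖ ^ 2) := by
      obtain ⟨k, hk⟩ := Function.ne_iff.1 hz
      refine Real.sqrt_pos.2 (Finset.sum_pos' (fun _ _ => by positivity) ⟨k, by simp, ?_⟩)
      have : 0 < ‖z k‖ := norm_pos_iff.2 hk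
      positivity
    have hsq : √(∑ k, ‖z k‖ ^ 2) ^ 2 = ∑ k, ‖z k‖ ^ 2 := Real.sq_sqrt (by positivity)
    have hcs : ‖∑ j, z j * ∑ k, A j k * z k‖
        ≤ √(∑ k, ‖z k‖ ^ 2) * √(∑ j, ‖∑ k, A j k * z k‖ ^ 2) := by
      refine (norm_sum_le _ _).trans ?_
      simp only [norm_mul]
      exact Real.sum_mul_le_sqrt_mul_sqrt _ _ _
    have := mul_lt_mul_of_pos_left (hA z hz) hS
    rw [norm_mul, ← hsq]
    norm_num
    linarith

/-- The squared sup norm is at most the squared Euclidean norm. -/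
theorem pi_norm_sq_le_sum_sq {n : ℕ} (v : Fin n → ℂ) : ‖v‖ ^ 2 ≤ ∑ j, ‖v j‖ ^ 2 := by
  rw [← Real.le_sqrt (norm_nonneg v) (by positivity),
    pi_norm_le_iff_of_nonneg (Real.sqrt_nonneg _)]
  exact fun j => Real.le_sqrt_of_sq_le
    (Finset.single_le_sum (f := fun j => ‖v j‖ ^ 2) (fun _ _ => by positivity)
      (Finset.mem_univ j))

/-- In the Siegel half-space, near the origin, `‖v‖ ^ 2` is controlled by the last coordinate. -/
theorem norm_sq_le_two_mul_norm_last {m : ℕ} {v : Fin (m + 1) → ℂ}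
    (hv : ∑ j : Fin m, ‖v j.castSucc‖ ^ 2 < (v (Fin.last m)).im) (h1 : ‖v‖ ≤ 1) :
    ‖v‖ ^ 2 ≤ 2 * ‖v (Fin.last m)‖ := by
  have h := pi_norm_sq_le_sum_sq v
  rw [Fin.sum_univ_castSucc] at h
  have hlast : ‖v (Fin.last m)‖ ≤ 1 := (norm_le_pi_norm v _).trans h1
  have him : (v (Fin.last m)).im ≤ ‖v (Fin.last m)‖ :=
    (le_abs_self _).trans (Complex.abs_im_le_norm _)
  nlinarith [norm_nonneg (v (Fin.last m))]

/-- An affine function of a real variable that vanishes to second order from the right is zero. -/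
theorem eq_zero_and_eq_zero_of_affine_isBigO_sq {a b : ℂ}
    (h : (fun s : ℝ => a + s * b) =O[𝓝[>] 0] fun s => s ^ 2) : a = 0 ∧ b = 0 := by
  have ha : a = 0 := by
    have h0 : Tendsto (fun s : ℝ => s ^ 2) (𝓝[>] 0) (𝓝 0) := by
      have : Continuous fun s : ℝ => s ^ 2 := by fun_prop
      simpa using (this.tendsto 0).mono_left nhdsWithin_le_nhds
    have h1 : Tendsto (fun s : ℝ => a + s * b) (𝓝[>] 0) (𝓝 a) := by
      have : Continuous fun s : ℝ => a + s * b := by fun_prop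
      simpa using (this.tendsto 0).mono_left nhdsWithin_le_nhds
    exact tendsto_nhds_unique h1 (h.trans_tendsto h0)
  subst ha
  refine ⟨rfl, ?_⟩
  obtain ⟨K, hK⟩ := h.bound
  have hb : ∀ᶠ s : ℝ in 𝓝[>] 0, ‖b‖ ≤ K * s := by
    filter_upwards [hK, self_mem_nhdsWithin] with s hs hs0
    have hs0 : 0 < s := hs0
    simp only [zero_add, norm_mul, Complex.norm_real, Real.norm_eq_abs, abs_pow,
      abs_of_pos hs0] at hs
    nlinarith
  have h0 : Tendsto (fun s : ℝ => K * s) (𝓝[>] 0) (𝓝 0) := by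
    have : Continuous fun s : ℝ => K * s := by fun_prop
    simpa using (this.tendsto 0).mono_left nhdsWithin_le_nhds
  exact norm_le_zero_iff.1 (ge_of_tendsto h0 hb)

/-- Splitting the last coordinate off a quadratic form. -/
theorem sum_mul_sum_mul_castSucc {m : ℕ} (P : Fin (m + 1) → Fin (m + 1) → ℂ)
    (v : Fin (m + 1) → ℂ) :
    ∑ i, v i * ∑ j, P i j * v j
      = ∑ j : Fin m, v j.castSucc * ∑ k : Fin m, P j.castSucc k.castSucc * v k.castSucc
        + v (Fin.last m) * (∑ j, P (Fin.last m) j * v j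
          + ∑ j : Fin m, P j.castSucc (Fin.last m) * v j.castSucc) := by
  rw [Fin.sum_univ_castSucc]
  simp only [Fin.sum_univ_castSucc (n := m), mul_add, Finset.sum_add_distrib, Finset.mul_sum]
  have : ∀ j : Fin m, v j.castSucc * (P j.castSucc (Fin.last m) * v (Fin.last m))
      = v (Fin.last m) * (P j.castSucc (Fin.last m) * v j.castSucc) := fun j => by ring
  simp only [this]
  ring

/-- A polynomial whose `z`-gradient vanishes at the origin and whose `z`-Hessian there is strictly
dominated by its `w`-derivative is bounded below by a multiple of `w` on the Siegel half-space. -/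
theorem exists_pos_mul_norm_last_le_norm_eval {m : ℕ} {p : MvPolynomial (Fin (m + 1)) ℂ}
    (h0 : eval 0 p = 0)
    (hz : ∀ j : Fin m, eval 0 (pderiv j.castSucc p) = 0)
    (hw : eval 0 (pderiv (Fin.last m) p) ≠ 0)
    (hH : ∀ v : Fin m → ℂ, v ≠ 0 →
      √(∑ j : Fin m,
          ‖∑ k : Fin m, eval 0 (pderiv j.castSucc (pderiv k.castSucc p)) * v k‖ ^ 2)
        < 2 * ‖eval 0 (pderiv (Fin.last m) p)‖ * √(∑ k : Fin m, ‖v k‖ ^ 2)) :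
    ∃ δ > 0, ∀ᶠ v in 𝓝 (0 : Fin (m + 1) → ℂ),
      ∑ j : Fin m, ‖v j.castSucc‖ ^ 2 < (v (Fin.last m)).im →
        δ * ‖v (Fin.last m)‖ ≤ ‖eval v p‖ := by
  obtain ⟨δ₀, hδ₀, hB⟩ := exists_norm_quadratic_form_le hH
  set c := eval 0 (pderiv (Fin.last m) p) with hc
  set P : Fin (m + 1) → Fin (m + 1) → ℂ := fun i j => eval 0 (pderiv i (pderiv j p)) with hP
  obtain ⟨K, hK, hp⟩ := (MvPolynomial.isBigO_sub_taylor_two p).exists_pos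
  have hc0 : 0 < ‖c‖ := norm_pos_iff.2 hw
  set δ := min δ₀ ‖c‖ with hδdef
  have hδ : 0 < δ := lt_min hδ₀ hc0
  set L : (Fin (m + 1) → ℂ) → ℂ := fun v => 1 / 2 * (∑ j, P (Fin.last m) j * v j
    + ∑ j : Fin m, P j.castSucc (Fin.last m) * v j.castSucc) with hL
  have hL0 : ∀ᶠ v in 𝓝 (0 : Fin (m + 1) → ℂ), ‖L v‖ < δ / 4 := by
    have hcont : Continuous fun v => ‖L v‖ := by fun_prop
    exact (hcont.tendsto 0).eventually_lt_const (by simpa [L] using hδ)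
  have hsmall : ∀ᶠ v in 𝓝 (0 : Fin (m + 1) → ℂ), K * 2 * ‖v‖ < δ / 4 := by
    have hcont : Continuous fun v : Fin (m + 1) → ℂ => K * 2 * ‖v‖ := by fun_prop
    exact (hcont.tendsto 0).eventually_lt_const (by simpa using hδ)
  have hone : ∀ᶠ v in 𝓝 (0 : Fin (m + 1) → ℂ), ‖v‖ < 1 :=
    (continuous_norm.tendsto 0).eventually_lt_const (by simp)
  refine ⟨δ / 2, by positivity, ?_⟩
  filter_upwards [hp.bound, hL0, hsmall, hone] with v hv hLv hKv hv1 hU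
  have hsq := norm_sq_le_two_mul_norm_last hU hv1.le
  set w := v (Fin.last m) with hwdef
  set B := 1 / 2 * ∑ j : Fin m, v j.castSucc * ∑ k : Fin m, P j.castSucc k.castSucc * v k.castSucc
    with hBdef
  set S := ∑ j : Fin m, ‖v j.castSucc‖ ^ 2 with hS
  have hBv : ‖B‖ + δ₀ * S ≤ ‖c‖ * S := hB fun j => v j.castSucc
  have hSw : S ≤ ‖w‖ := hU.le.trans ((le_abs_self _).trans (Complex.abs_im_le_norm _))
  have hS0 : 0 ≤ S := by positivity
  have htaylor : eval 0 p + ∑ i, v i * eval 0 (pderiv i p)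
      + 1 / 2 * ∑ i, v i * ∑ j, eval 0 (pderiv i (pderiv j p)) * v j = w * c + B + w * L v := by
    have := sum_mul_sum_mul_castSucc P v
    simp only [hP] at this
    rw [this, Fin.sum_univ_castSucc (f := fun i => v i * eval 0 (pderiv i p))]
    simp only [h0, hz, mul_zero, Finset.sum_const_zero, hL, hBdef, hP]
    ring
  rw [htaylor, norm_pow, norm_norm] at hv
  have herr : K * ‖v‖ ^ 3 ≤ δ / 4 * ‖w‖ := by
    calc K * ‖v‖ ^ 3 = K * ‖v‖ * ‖v‖ ^ 2 := by ring
      _ ≤ K * ‖v‖ * (2 * ‖w‖) := by gcongr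
      _ = K * 2 * ‖v‖ * ‖w‖ := by ring
      _ ≤ δ / 4 * ‖w‖ := by gcongr
  have hwL : ‖w * L v‖ ≤ δ / 4 * ‖w‖ := by
    rw [norm_mul, mul_comm]; gcongr
  have htri : ‖w * c‖ ≤ ‖eval v p‖ + ‖eval v p - (w * c + B + w * L v)‖ + ‖B‖ + ‖w * L v‖ := by
    have e : w * c = eval v p - (eval v p - (w * c + B + w * L v)) - B - w * L v := by ring
    calc ‖w * c‖ = _ := congrArg norm e
      _ ≤ _ := (norm_sub_le _ _).trans <| by
        gcongr
        refine (norm_sub_le _ _).trans ?_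
        gcongr
        exact norm_sub_le _ _
  rw [norm_mul] at htri
  have h1 : δ * S ≤ δ₀ * S := by gcongr; exact min_le_left _ _
  have h2 : δ * (‖w‖ - S) ≤ ‖c‖ * (‖w‖ - S) := by
    exact mul_le_mul_of_nonneg_right (min_le_right _ _) (by linarith)
  linarith

/-- Let `p` be a polynomial in `d = m+1 ≥ 2` complex variables
`(z_1,…,z_m,w)` with `p(0) = 0`, vanishing `z`-gradient at `0`, `∂p/∂w(0) ≠ 0`, and
Hessian (in `z`) satisfying the strict contraction bound
`‖Hp(0)·v‖ < 2|∂p/∂w(0)|·‖v‖` for `v ≠ 0`. Then for `q` analytic near `0`,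
`q/p` is bounded near `0` within the Siegel half-space `U_d` if and only if
`q` lies in the ideal `(w, (z)²)`, i.e. `q(0) = 0` and `∂q/∂z_j(0) = 0` for all `j`. -/
theorem statement5 (m : ℕ) (hm : 1 ≤ m) (p : MvPolynomial (Fin (m + 1)) ℂ)
    (h0 : eval 0 p = 0)
    (hz : ∀ j : Fin m, eval 0 (pderiv j.castSucc p) = 0)
    (hw : eval 0 (pderiv (Fin.last m) p) ≠ 0)
    (hH : ∀ v : Fin m → ℂ, v ≠ 0 →
      Real.sqrt (∑ j : Fin m,
          ‖∑ k : Fin m, eval 0 (pderiv j.castSucc (pderiv k.castSucc p)) * v k‖ ^ 2)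
        < 2 * ‖eval 0 (pderiv (Fin.last m) p)‖ * Real.sqrt (∑ k : Fin m, ‖v k‖ ^ 2))
    (q : (Fin (m + 1) → ℂ) → ℂ) (hq : AnalyticAt ℂ q 0) :
    (∃ C ε : ℝ, 0 < C ∧ 0 < ε ∧ ∀ v : Fin (m + 1) → ℂ,
        (∑ j : Fin m, ‖v j.castSucc‖ ^ 2) < (v (Fin.last m)).im →
        (∑ j : Fin (m + 1), ‖v j‖ ^ 2) < ε ^ 2 →
        ‖q v‖ ≤ C * ‖eval v p‖)
      ↔ (q 0 = 0 ∧ ∀ j : Fin m, fderiv ℂ q 0 (Pi.single j.castSucc 1) = 0) := by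
  have hqT := hq.isBigO_sub_fderiv
  constructor
  · rintro ⟨C, ε, hC, hε, h⟩
    suffices hj : ∀ j : Fin m, q 0 = 0 ∧ fderiv ℂ q 0 (Pi.single j.castSucc 1) = 0 from
      ⟨(hj ⟨0, hm⟩).1, fun j => (hj j).2⟩
    intro j
    apply eq_zero_and_eq_zero_of_affine_isBigO_sq
    set γ : ℝ → Fin (m + 1) → ℂ := fun s =>
      (s : ℂ) • Pi.single j.castSucc 1
        + (s ^ 2 : ℂ) • Pi.single (Fin.last m) (2 * Complex.I) with hγ
    have hγc : Continuous γ := by fun_prop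
    have hγ0 : Tendsto γ (𝓝[>] 0) (𝓝 0) := by
      simpa [γ] using (hγc.tendsto 0).mono_left nhdsWithin_le_nhds
    have hlast (s : ℝ) : γ s (Fin.last m) = s ^ 2 * (2 * Complex.I) := by
      simp [γ, (Fin.castSucc_lt_last j).ne']
    have hcast (s : ℝ) (k : Fin m) : γ s k.castSucc = if k = j then (s : ℂ) else 0 := by
      simp [γ, Pi.single_apply, (Fin.castSucc_lt_last k).ne]
    have hsum (s : ℝ) : ∑ k : Fin m, ‖γ s k.castSucc‖ ^ 2 = s ^ 2 := by
      simp [hcast, apply_ite, ite_pow]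
    have hγO : (fun s => ‖γ s‖) =O[𝓝[>] 0] fun s => s := by
      have hcont : Continuous fun s : ℝ => (Pi.single j.castSucc 1
          + (s : ℂ) • Pi.single (Fin.last m) (2 * Complex.I) : Fin (m + 1) → ℂ) := by fun_prop
      have h1 := ((hcont.tendsto 0).mono_left nhdsWithin_le_nhds).isBigO_one ℝ (l := 𝓝[>] 0)
      have h2 : (fun s : ℝ => (s : ℂ)) =O[𝓝[>] 0] fun s => s :=
        IsBigO.of_bound 1 (by simp)
      refine IsBigO.norm_left ((h2.smul h1).congr (fun s => ?_) fun s => by simp)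
      simp only [hγ, smul_add, smul_smul, sq]
    have hγi (i : Fin (m + 1)) : (fun s => γ s i) =O[𝓝[>] 0] fun s => s :=
      (IsBigO.of_norm_le fun s => norm_le_pi_norm (γ s) i).trans hγO
    have hγO2 : (fun s => ‖γ s‖ ^ 2) =O[𝓝[>] 0] fun s => s ^ 2 := hγO.pow 2
    have hpO : (fun s => eval (γ s) p) =O[𝓝[>] 0] fun s => s ^ 2 := by
      have h3 : (fun s => ‖γ s‖ ^ 3) =O[𝓝[>] 0] fun s => s ^ 2 := by
        have hb : (fun s => ‖γ s‖) =O[𝓝[>] 0] fun _ => (1 : ℝ) := (hγ0.norm).isBigO_one ℝ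
        exact (hγO2.mul hb).congr (fun s => by ring) fun s => by ring
      have h1 : (fun s => γ s (Fin.last m)) =O[𝓝[>] 0] fun s => s ^ 2 := by
        simp only [hlast]
        exact (IsBigO.of_bound 2 (by simp [mul_comm]))
      have h2 : (fun s => 1 / 2 * ∑ i, γ s i * ∑ j, eval 0 (pderiv i (pderiv j p)) * γ s j)
          =O[𝓝[>] 0] fun s => s ^ 2 := by
        refine IsBigO.const_mul_left (.fun_sum fun i _ => ?_) _
        refine ((hγi i).mul (g₂ := fun s => s) ?_).congr_right fun s => by ring
        exact .fun_sum fun j _ => (hγi j).const_mul_left _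
      have hT := ((MvPolynomial.isBigO_sub_taylor_two p).comp_tendsto hγ0).trans h3
      refine ((hT.add h2).add (h1.mul (isBigO_const_const
        (eval 0 (pderiv (Fin.last m) p)) (one_ne_zero (α := ℝ)) _)
        |>.congr_right fun s => mul_one _)).congr_left (fun s => ?_)
      simp only [Function.comp_apply, Fin.sum_univ_castSucc (f := fun i => γ s i *
        eval 0 (pderiv i p)), h0, hz, mul_zero, Finset.sum_const_zero]
      ring
    have hqO : (fun s => q (γ s)) =O[𝓝[>] 0] fun s => s ^ 2 := by
      refine IsBigO.trans (IsBigO.of_bound C ?_) hpO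
      have hev : ∀ᶠ s in 𝓝[>] (0 : ℝ), ∑ k, ‖γ s k‖ ^ 2 < ε ^ 2 := by
        have hcont : Continuous fun v : Fin (m + 1) → ℂ => ∑ k, ‖v k‖ ^ 2 := by fun_prop
        exact ((hcont.tendsto 0).comp hγ0).eventually_lt_const (by simpa using by positivity)
      filter_upwards [hev, self_mem_nhdsWithin] with s hs hs0
      have hs0 : 0 < s := hs0
      refine h _ ?_ hs
      have him : (γ s (Fin.last m)).im = 2 * s ^ 2 := by
        rw [hlast]
        rw [← Complex.ofReal_pow, Complex.im_ofReal_mul]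
        simp
        ring
      rw [hsum, him]
      nlinarith
    have hT := (hqT.comp_tendsto hγ0).trans hγO2
    have hsqO : (fun s : ℝ => (s : ℂ) ^ 2 *
        fderiv ℂ q 0 (Pi.single (Fin.last m) (2 * Complex.I))) =O[𝓝[>] 0] fun s => s ^ 2 :=
      IsBigO.of_bound ‖fderiv ℂ q 0 (Pi.single (Fin.last m) (2 * Complex.I))‖ (by simp [mul_comm])
    refine ((hqO.sub hT).sub hsqO).congr_left fun s => ?_
    simp only [Function.comp_apply, hγ, map_add, map_smul, smul_eq_mul]
    ring
  · rintro ⟨hq0, hqz⟩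
    obtain ⟨δ, hδ, hp⟩ := exists_pos_mul_norm_last_le_norm_eval h0 hz hw hH
    obtain ⟨K, hK, hqK⟩ := hqT.exists_pos
    set b := fderiv ℂ q 0 (Pi.single (Fin.last m) 1) with hb
    have hfd (v : Fin (m + 1) → ℂ) : fderiv ℂ q 0 v = v (Fin.last m) * b := by
      conv_lhs => rw [pi_eq_sum_univ' v]
      simp [Fin.sum_univ_castSucc, hqz, hb]
    have hone : ∀ᶠ v in 𝓝 (0 : Fin (m + 1) → ℂ), ‖v‖ < 1 :=
      (continuous_norm.tendsto 0).eventually_lt_const (by simp)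
    obtain ⟨ε, hε, hball⟩ := Metric.eventually_nhds_iff.1 (hp.and (hqK.bound.and hone))
    refine ⟨(‖b‖ + 2 * K) / δ, ε, by positivity, hε, fun v hU hv => ?_⟩
    have hvε : dist v 0 < ε := by
      rw [dist_zero_right]
      exact lt_of_pow_lt_pow_left₀ 2 hε.le ((pi_norm_sq_le_sum_sq v).trans_lt hv)
    obtain ⟨hpv, hqv, hv1⟩ := hball hvε
    have hsq := norm_sq_le_two_mul_norm_last hU hv1.le
    rw [hq0, zero_add, hfd, norm_pow, norm_norm] at hqv
    have hqw : ‖q v‖ ≤ (‖b‖ + 2 * K) * ‖v (Fin.last m)‖ := by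
      have := norm_sub_norm_le (q v) (v (Fin.last m) * b)
      rw [norm_mul] at this
      nlinarith
    calc ‖q v‖ ≤ (‖b‖ + 2 * K) * ‖v (Fin.last m)‖ := hqw
      _ = (‖b‖ + 2 * K) / δ * (δ * ‖v (Fin.last m)‖) := by field_simp
      _ ≤ (‖b‖ + 2 * K) / δ * ‖eval v p‖ := by gcongr; exact hpv hU
end

section
/- Let L be a complex-analytic function on a neighborhood of 0 ∈ ℂ with L(0) = 0 such that every Taylor coefficient of L at 0 is purely imaginary (lies in iℝ). Define g(s) = i s² + 2i ∫_{[0,s]} x² L′(x) dx, where the integral is taken along the straight segment from 0 to s. Then there exists ε > 0 such that for all s ∈ ℂ with |s| < ε, Im g(s) ≤ |s e^{L(s)}|², with equality whenever s is real. That is, the analytic curve s ↦ (s e^{L(s)}, g(s)) avoids the Siegel half-space U₂ near the origin and lies on the boundary ∂U₂ = {(z,w) : Im w = |z|²} for real s. -/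
/-- `g L s = i s² + 2i ∫_{[0,s]} x² L′(x) dx`, where the integral over the straight
segment from `0` to `s` is realized as `∫_{t ∈ [0,1]} (ts)² L′(ts) · s dt`. -/
noncomputable def curveW (L : ℂ → ℂ) (s : ℂ) : ℂ :=
  Complex.I * s ^ 2 +
    2 * Complex.I * ∫ t in (0 : ℝ)..1, s * (((t : ℂ) * s) ^ 2 * deriv L ((t : ℂ) * s))

/-- A function holomorphic on a disc about `0` with purely imaginary Taylor coefficients has
zero real part on the real axis. -/
theorem re_eq_zero_of_iteratedDeriv_re {L : ℂ → ℂ} {r : ℝ}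
    (hd : DifferentiableOn ℂ L (Metric.ball 0 r))
    (hcoef : ∀ n : ℕ, (iteratedDeriv n L 0).re = 0) {x : ℝ} (hx : |x| < r) :
    (L x).re = 0 := by
  have hx' : (x : ℂ) ∈ Metric.ball (0 : ℂ) r := by simpa using hx
  have h := Complex.hasSum_re (Complex.hasSum_taylorSeries_on_ball hd hx')
  refine h.unique ?_
  convert hasSum_zero using 2 with n
  rw [sub_zero, ← Complex.ofReal_pow]
  simp [Complex.mul_re, Complex.mul_im, hcoef n, ← Complex.ofReal_natCast, ← Complex.ofReal_inv,
    -Complex.ofReal_pow]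

/-- The derivative of a function with zero real part on the real axis has zero real part there. -/
theorem deriv_re_eq_zero_of_re_eq_zero {L : ℂ → ℂ} {r : ℝ}
    (hd : DifferentiableOn ℂ L (Metric.ball 0 r))
    (hre : ∀ x : ℝ, |x| < r → (L x).re = 0) {x : ℝ} (hx : |x| < r) :
    (deriv L x).re = 0 := by
  have hx' : (x : ℂ) ∈ Metric.ball (0 : ℂ) r := by simpa using hx
  have h := ((hd.differentiableAt (Metric.isOpen_ball.mem_nhds hx')).hasDerivAt).real_of_complex
  refine h.unique ((hasDerivAt_const x (0 : ℝ)).congr_of_eventuallyEq ?_)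
  filter_upwards [continuous_abs.continuousAt.eventually_lt continuousAt_const hx] with y hy
  exact hre y hy

/-- If `x ↦ x² L′(x)` has primitive `F` on a disc about `0`, the integral in `curveW` is
`F s - F 0`. -/
theorem curveW_eq_of_primitive {L F : ℂ → ℂ} {r : ℝ}
    (hd : DifferentiableOn ℂ L (Metric.ball 0 r))
    (hF : ∀ z ∈ Metric.ball (0 : ℂ) r, HasDerivAt F (z ^ 2 * deriv L z) z)
    {s : ℂ} (hs : s ∈ Metric.ball (0 : ℂ) r) :
    curveW L s = Complex.I * s ^ 2 + 2 * Complex.I * (F s - F 0) := by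
  have hmem : ∀ t ∈ Set.uIcc (0 : ℝ) 1, (t : ℂ) * s ∈ Metric.ball (0 : ℂ) r := by
    intro t ht
    rw [Set.uIcc_of_le zero_le_one] at ht
    rw [mem_ball_zero_iff] at hs ⊢
    rw [norm_mul, Complex.norm_real, Real.norm_of_nonneg ht.1]
    exact (mul_le_of_le_one_left (norm_nonneg s) ht.2).trans_lt hs
  have hd' : ContinuousOn (deriv L) (Metric.ball 0 r) :=
    (hd.deriv Metric.isOpen_ball).continuousOn
  have hcm : ContinuousOn (fun t : ℝ => (t : ℂ) * s) (Set.uIcc 0 1) := by fun_prop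
  have hint := intervalIntegral.integral_eq_sub_of_hasDerivAt
    (f := fun t : ℝ => F ((t : ℂ) * s))
    (f' := fun t : ℝ => s * (((t : ℂ) * s) ^ 2 * deriv L ((t : ℂ) * s)))
    (a := 0) (b := 1) ?_ ?_
  · rw [curveW, hint]
    simp
  · intro t ht
    have h1 : HasDerivAt (fun t : ℝ => (t : ℂ) * s) (1 * s) t :=
      Complex.ofRealCLM.hasDerivAt.mul_const s
    exact ((hF _ (hmem t ht)).comp t h1).congr_deriv (by ring)
  · exact (continuousOn_const.mul ((hcm.pow 2).mul (hd'.comp hcm hmem))).intervalIntegrable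

/-- The derivative of `(Im s)² + |s|² Re L - Re F` along a vertical line, for `F′ = s² L′`. -/
theorem hasDerivAt_vertical {L F : ℂ → ℂ} {x y t : ℝ} {l : ℂ}
    (hL : HasDerivAt L l (x + (t * y : ℝ) * Complex.I))
    (hF : HasDerivAt F ((x + (t * y : ℝ) * Complex.I) ^ 2 * l) (x + (t * y : ℝ) * Complex.I)) :
    HasDerivAt (fun t : ℝ => (t * y) ^ 2 +
        (x ^ 2 + (t * y) ^ 2) * (L (x + (t * y : ℝ) * Complex.I)).re -
        (F (x + (t * y : ℝ) * Complex.I)).re)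
      (2 * t * y ^ 2 * (1 + (L (x + (t * y : ℝ) * Complex.I)).re +
        ((x + (t * y : ℝ) * Complex.I) * l).re)) t := by
  have hty : HasDerivAt (fun t : ℝ => t * y) y t := by
    simpa using (hasDerivAt_id t).mul_const y
  have hline : HasDerivAt (fun t : ℝ => (x : ℂ) + (t * y : ℝ) * Complex.I)
      ((y : ℂ) * Complex.I) t :=
    (hty.ofReal_comp.mul_const Complex.I).const_add _
  have hre : ∀ {f : ℝ → ℂ} {f' : ℂ}, HasDerivAt f f' t →
      HasDerivAt (fun t => (f t).re) f'.re t := fun h =>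
    Complex.reCLM.hasFDerivAt.comp_hasDerivAt t h
  have hL' := hre (hL.comp t hline)
  have hF' := hre (hF.comp t hline)
  refine (((hty.pow 2).add (((hty.pow 2).const_add (x ^ 2)).mul hL')).sub hF').congr_deriv ?_
  simp [pow_two, Complex.mul_re, Complex.mul_im]
  ring

/-- curve type, `M = 1`: If `L` is analytic near `0 ∈ ℂ`, `L(0) = 0`,
and every Taylor coefficient of `L` at `0` is purely imaginary, then with
`g(s) = i s² + 2i ∫_{[0,s]} x² L′(x) dx`, for all small `s` one has
`Im g(s) ≤ |s e^{L(s)}|²`, with equality whenever `s` is real: the curve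
`s ↦ (s e^{L(s)}, g(s))` avoids the Siegel half-space `U₂` and lies on `∂U₂` for
real `s`. -/
theorem statement8 (L : ℂ → ℂ) (hL : AnalyticAt ℂ L 0) (hL0 : L 0 = 0)
    (hcoef : ∀ n : ℕ, (iteratedDeriv n L 0).re = 0) :
    ∃ ε : ℝ, 0 < ε ∧ ∀ s : ℂ, ‖s‖ < ε →
      (curveW L s).im ≤ ‖s * Complex.exp (L s)‖ ^ 2 ∧
      (s.im = 0 → (curveW L s).im = ‖s * Complex.exp (L s)‖ ^ 2) := by
  obtain ⟨r, hr, hball⟩ : ∃ r > 0, ∀ z ∈ Metric.ball (0 : ℂ) r,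
      AnalyticAt ℂ L z ∧ -1 < (L z).re + (z * deriv L z).re := by
    have hc : ContinuousAt (fun z => (L z).re + (z * deriv L z).re) 0 :=
      (Complex.continuous_re.continuousAt.comp hL.continuousAt).add
        (Complex.continuous_re.continuousAt.comp (continuousAt_id.mul hL.deriv.continuousAt))
    have hlt : ∀ᶠ z in nhds (0 : ℂ), -1 < (L z).re + (z * deriv L z).re :=
      hc.eventually (lt_mem_nhds (by simp [hL0]))
    exact Metric.eventually_nhds_iff_ball.mp (hL.eventually_analyticAt.and hlt)
  have hd : DifferentiableOn ℂ L (Metric.ball 0 r) := fun z hz =>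
    (hball z hz).1.differentiableAt.differentiableWithinAt
  have hre : ∀ x : ℝ, |x| < r → (L x).re = 0 := fun x hx =>
    re_eq_zero_of_iteratedDeriv_re hd hcoef hx
  obtain ⟨F, hF⟩ := (((differentiableOn_id (𝕜 := ℂ)).pow 2).mul
    (hd.deriv Metric.isOpen_ball)).isExactOn_ball
  replace hF : ∀ z ∈ Metric.ball (0 : ℂ) r, HasDerivAt F (z ^ 2 * deriv L z) z := hF
  have him : ∀ s ∈ Metric.ball (0 : ℂ) r,
      (curveW L s).im = s.re ^ 2 - s.im ^ 2 + 2 * ((F s).re - (F 0).re) := by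
    intro s hs
    rw [curveW_eq_of_primitive hd hF hs]
    simp [pow_two, Complex.mul_re, Complex.mul_im]
  have hFre : ∀ x : ℝ, |x| < r → (F x).re = (F 0).re := by
    intro x hx
    have hderiv : ∀ y ∈ Metric.ball (0 : ℝ) r,
        HasDerivWithinAt (fun y : ℝ => (F y).re) 0 (Metric.ball 0 r) y := by
      intro y hy
      have hy' : |y| < r := by simpa using hy
      have h := (hF y (by simpa using hy')).real_of_complex
      have h0 : ((y : ℂ) ^ 2 * deriv L y).re = 0 := by
        rw [← Complex.ofReal_pow, Complex.re_ofReal_mul,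
          deriv_re_eq_zero_of_re_eq_zero hd hre hy', mul_zero]
      rw [h0] at h
      exact h.hasDerivWithinAt
    have h := (convex_ball (0 : ℝ) r).norm_image_sub_le_of_norm_hasDerivWithin_le (C := 0)
      hderiv (by simp) (Metric.mem_ball_self hr) (show x ∈ Metric.ball 0 r by simpa using hx)
    rw [zero_mul, norm_le_zero_iff, sub_eq_zero] at h
    simpa using h
  have hnorm : ∀ s : ℂ, ‖s * Complex.exp (L s)‖ ^ 2 =
      (s.re ^ 2 + s.im ^ 2) * Real.exp (2 * (L s).re) := by
    intro s
    rw [norm_mul, mul_pow, Complex.norm_exp, Complex.sq_norm, Complex.normSq_apply,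
      ← Real.exp_nat_mul]
    push_cast
    ring
  refine ⟨r, hr, fun s hs => ?_⟩
  have hsb : s ∈ Metric.ball (0 : ℂ) r := by simpa using hs
  have hsre : |s.re| < r := (Complex.abs_re_le_norm s).trans_lt hs
  rw [him s hsb, hnorm s]
  constructor
  · have hmem : ∀ t ∈ Set.Icc (0 : ℝ) 1,
        (s.re : ℂ) + (t * s.im : ℝ) * Complex.I ∈ Metric.ball (0 : ℂ) r := by
      intro t ht
      rw [mem_ball_zero_iff]
      refine lt_of_le_of_lt ?_ hs
      rw [Complex.norm_add_mul_I, Complex.norm_eq_sqrt_sq_add_sq]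
      refine Real.sqrt_le_sqrt ?_
      have : t ^ 2 ≤ 1 := pow_le_one₀ ht.1 ht.2
      nlinarith [sq_nonneg s.im]
    have hder := fun t ht => hasDerivAt_vertical (x := s.re) (y := s.im) (t := t)
      (hball _ (hmem t ht)).1.differentiableAt.hasDerivAt (hF _ (hmem t ht))
    have hmono := monotoneOn_of_hasDerivWithinAt_nonneg (convex_Icc (0 : ℝ) 1)
      (fun t ht => (hder t ht).continuousAt.continuousWithinAt)
      (fun t ht => (hder t (interior_subset ht)).hasDerivWithinAt)
      (fun t ht => by
        have ht' := interior_subset ht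
        have := (hball _ (hmem t ht')).2
        have h0 := ht'.1
        exact mul_nonneg (by positivity) (by linarith))
    have hend := hmono (Set.left_mem_Icc.mpr zero_le_one) (Set.right_mem_Icc.mpr zero_le_one)
      zero_le_one
    simp only [zero_mul, one_mul, Complex.ofReal_zero, add_zero, Complex.re_add_im,
      hre _ hsre, hFre _ hsre] at hend
    have hexp := mul_le_mul_of_nonneg_left (Real.add_one_le_exp (2 * (L s).re))
      (add_nonneg (sq_nonneg s.re) (sq_nonneg s.im))
    linarith
  · intro h0
    have hs' : s = (s.re : ℂ) := Complex.ext rfl (by simpa using h0)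
    have hLs : (L s).re = 0 := by rw [hs', hre _ hsre]
    have hFs : (F s).re = (F 0).re := by rw [hs', hFre _ hsre]
    simp [h0, hLs, hFs]
end

section
/- Let M, K be positive integers, let A₀ be a polynomial with real coefficients of degree less than 2K, and let L₁ be a complex-analytic function on a neighborhood of 0 ∈ ℂ with Re L₁(0) > 0. Set L(s) = i A₀(s^M) + s^{2MK} L₁(s) and define g(s) = i s^{2M} + 2Mi ∫_{[0,s]} x^{2M} L′(x) dx, where the integral is taken along the straight segment from 0 to s. Then there exists ε > 0 such that for all s ∈ ℂ with |s| < ε, Im g(s) ≤ |s^M e^{M L(s)}|². That is, the analytic curve s ↦ (s^M e^{M L(s)}, g(s)) avoids the Siegel half-space U₂ near the origin. -/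
/-- `gM M L s = i s^{2M} + 2Mi ∫_{[0,s]} x^{2M} L′(x) dx`, where the integral over
the straight segment from `0` to `s` is realized as `∫_{t ∈ [0,1]} (ts)^{2M} L′(ts) · s dt`. -/
noncomputable def curveWM (M : ℕ) (L : ℂ → ℂ) (s : ℂ) : ℂ :=
  Complex.I * s ^ (2 * M) +
    2 * (M : ℂ) * Complex.I *
      ∫ t in (0 : ℝ)..1, s * (((t : ℂ) * s) ^ (2 * M) * deriv L ((t : ℂ) * s))

open Filter Topology

lemma norm_sq_pow_sub_norm_sq_pow_mul_le (w : ℂ) (k : ℕ) :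
    ‖(w ^ 2) ^ k - ((‖w‖ ^ 2 : ℝ) : ℂ) ^ k‖ * ‖w‖ ≤ 2 * k * |w.im| * ‖w‖ ^ (2 * k) := by
  have h2 : ‖w ^ 2 - ((‖w‖ ^ 2 : ℝ) : ℂ)‖ = 2 * |w.im| * ‖w‖ := by
    have : w ^ 2 - ((‖w‖ ^ 2 : ℝ) : ℂ) = 2 * Complex.I * (w.im : ℂ) * w := by
      rw [← Complex.normSq_eq_norm_sq, Complex.normSq_eq_conj_mul_self]
      have h := Complex.sub_conj w
      push_cast at h
      linear_combination w * h
    rw [this]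
    simp
  induction k with
  | zero => simp
  | succ k ih =>
    have e : (w ^ 2) ^ (k + 1) - ((‖w‖ ^ 2 : ℝ) : ℂ) ^ (k + 1) =
        ((w ^ 2) ^ k - ((‖w‖ ^ 2 : ℝ) : ℂ) ^ k) * w ^ 2 +
          ((‖w‖ ^ 2 : ℝ) : ℂ) ^ k * (w ^ 2 - ((‖w‖ ^ 2 : ℝ) : ℂ)) := by ring
    have h3 : ‖(w ^ 2) ^ (k + 1) - ((‖w‖ ^ 2 : ℝ) : ℂ) ^ (k + 1)‖ ≤
        ‖(w ^ 2) ^ k - ((‖w‖ ^ 2 : ℝ) : ℂ) ^ k‖ * ‖w‖ ^ 2 +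
          (‖w‖ ^ 2) ^ k * (2 * |w.im| * ‖w‖) := by
      rw [e]
      refine (norm_add_le _ _).trans (le_of_eq ?_)
      rw [norm_mul, norm_mul, h2, norm_pow, norm_pow, Complex.norm_real, Real.norm_of_nonneg
        (by positivity)]
    calc _ ≤ (‖(w ^ 2) ^ k - ((‖w‖ ^ 2 : ℝ) : ℂ) ^ k‖ * ‖w‖ ^ 2 +
          (‖w‖ ^ 2) ^ k * (2 * |w.im| * ‖w‖)) * ‖w‖ := by gcongr
      _ = (‖(w ^ 2) ^ k - ((‖w‖ ^ 2 : ℝ) : ℂ) ^ k‖ * ‖w‖) * ‖w‖ ^ 2 +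
          2 * |w.im| * ‖w‖ ^ (2 * (k + 1)) := by ring
      _ ≤ (2 * k * |w.im| * ‖w‖ ^ (2 * k)) * ‖w‖ ^ 2 +
          2 * |w.im| * ‖w‖ ^ (2 * (k + 1)) := by gcongr
      _ = _ := by push_cast; ring

lemma le_re_leading_term (c w : ℂ) (K : ℕ) :
    c.re / (K + 1) * ‖w‖ ^ (2 * K + 2) - 4 * K * ‖c‖ * (|w.im| * ‖w‖ ^ (2 * K + 1)) ≤
      ‖w‖ ^ 2 * (c * w ^ (2 * K)).re - ((K / (K + 1) : ℂ) * c * w ^ (2 * K + 2)).re := by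
  have h1 := norm_sq_pow_sub_norm_sq_pow_mul_le w K
  have h2 := norm_sq_pow_sub_norm_sq_pow_mul_le w (K + 1)
  rcases eq_or_ne w 0 with rfl | hw
  · simp
  have hw' : 0 < ‖w‖ := norm_pos_iff.2 hw
  set E₁ := (w ^ 2) ^ K - ((‖w‖ ^ 2 : ℝ) : ℂ) ^ K with hE₁
  set E₂ := (w ^ 2) ^ (K + 1) - ((‖w‖ ^ 2 : ℝ) : ℂ) ^ (K + 1) with hE₂
  have hK : (K + 1 : ℂ) ≠ 0 := by exact_mod_cast K.succ_ne_zero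
  have e1 : c * w ^ (2 * K) = ((‖w‖ ^ (2 * K) : ℝ) : ℂ) * c + c * E₁ := by
    rw [hE₁]; push_cast; ring
  have e2 : (K / (K + 1) : ℂ) * c * w ^ (2 * K + 2) =
      ((K / (K + 1) * ‖w‖ ^ (2 * K + 2) : ℝ) : ℂ) * c + ((K / (K + 1) : ℝ) : ℂ) * (c * E₂) := by
    rw [hE₂]; push_cast; ring
  rw [e1, e2, Complex.add_re, Complex.add_re, Complex.re_ofReal_mul, Complex.re_ofReal_mul,
    Complex.re_ofReal_mul]
  have b1 : |(c * E₁).re| ≤ ‖c‖ * ‖E₁‖ := (Complex.abs_re_le_norm _).trans (norm_mul _ _).le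
  have b2 : |(c * E₂).re| ≤ ‖c‖ * ‖E₂‖ := (Complex.abs_re_le_norm _).trans (norm_mul _ _).le
  have h1' : ‖w‖ ^ 2 * ‖E₁‖ ≤ 2 * K * |w.im| * ‖w‖ ^ (2 * K + 1) := by
    calc _ = (‖E₁‖ * ‖w‖) * ‖w‖ := by ring
      _ ≤ (2 * K * |w.im| * ‖w‖ ^ (2 * K)) * ‖w‖ := by gcongr
      _ = _ := by ring
  have h2' : ‖E₂‖ ≤ 2 * (K + 1) * |w.im| * ‖w‖ ^ (2 * K + 1) := by
    refine le_of_mul_le_mul_right (h2.trans (le_of_eq ?_)) hw'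
    push_cast; ring
  have b1' : |‖w‖ ^ 2 * (c * E₁).re| ≤ ‖c‖ * (2 * K * |w.im| * ‖w‖ ^ (2 * K + 1)) := by
    rw [abs_mul, abs_of_nonneg (by positivity)]
    calc _ ≤ ‖w‖ ^ 2 * (‖c‖ * ‖E₁‖) := by gcongr
      _ = ‖c‖ * (‖w‖ ^ 2 * ‖E₁‖) := by ring
      _ ≤ _ := by gcongr
  have b2' : |(K / (K + 1) : ℝ) * (c * E₂).re| ≤ ‖c‖ * (2 * K * |w.im| * ‖w‖ ^ (2 * K + 1)) := by
    rw [abs_mul, abs_of_nonneg (by positivity)]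
    calc _ ≤ (K / (K + 1) : ℝ) * (‖c‖ * (2 * (K + 1) * |w.im| * ‖w‖ ^ (2 * K + 1))) := by
          gcongr; exact b2.trans (by gcongr)
      _ = _ := by field_simp
  have e3 : ‖w‖ ^ 2 * (‖w‖ ^ (2 * K) * c.re) - K / (K + 1) * ‖w‖ ^ (2 * K + 2) * c.re =
      c.re / (K + 1) * ‖w‖ ^ (2 * K + 2) := by field_simp; ring
  linarith [neg_abs_le (‖w‖ ^ 2 * (c * E₁).re), le_abs_self ((K / (K + 1) : ℝ) * (c * E₂).re)]

lemma abs_re_pow_sub_le (w : ℂ) (n : ℕ) :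
    |(w ^ (n + 1)).re - w.re ^ (n + 1)| ≤ (n + 1) * |w.im| * ‖w‖ ^ n := by
  have key : ‖w ^ (n + 1) - (w.re : ℂ) ^ (n + 1)‖ ≤ (n + 1) * |w.im| * ‖w‖ ^ n := by
    have h1 : ‖w - w.re‖ = |w.im| := by
      have : w - w.re = w.im * Complex.I := by linear_combination -(Complex.re_add_im w)
      rw [this]; simp
    induction n with
    | zero => simp [h1]
    | succ n ih =>
      have e : w ^ (n + 1 + 1) - (w.re : ℂ) ^ (n + 1 + 1) =
        w ^ (n + 1) * (w - w.re) + (w ^ (n + 1) - (w.re : ℂ) ^ (n + 1)) * w.re := by ring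
      rw [e]
      calc _ ≤ ‖w‖ ^ (n + 1) * |w.im| + ‖w ^ (n + 1) - (w.re : ℂ) ^ (n + 1)‖ * |w.re| := by
            refine (norm_add_le _ _).trans (le_of_eq ?_)
            rw [norm_mul, norm_mul, h1, norm_pow, Complex.norm_real, Real.norm_eq_abs]
        _ ≤ ‖w‖ ^ (n + 1) * |w.im| + ((n + 1) * |w.im| * ‖w‖ ^ n) * ‖w‖ := by
            gcongr; exact Complex.abs_re_le_norm w
        _ = _ := by push_cast; ring
  refine le_trans ?_ key
  have := Complex.abs_re_le_norm (w ^ (n + 1) - (w.re : ℂ) ^ (n + 1))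
  rwa [Complex.sub_re, ← Complex.ofReal_pow, Complex.ofReal_re, Complex.ofReal_pow] at this

lemma abs_im_pow_sub_mul_le (w : ℂ) (n : ℕ) :
    |(w ^ (n + 1)).im - (n + 1) * w.re ^ n * w.im| * ‖w‖ ≤ n ^ 2 * w.im ^ 2 * ‖w‖ ^ n := by
  induction n with
  | zero => simp
  | succ n ih =>
    have e : (w ^ (n + 1 + 1)).im - ((n + 1 : ℕ) + 1) * w.re ^ (n + 1) * w.im =
        ((w ^ (n + 1)).im - (n + 1) * w.re ^ n * w.im) * w.re +
          ((w ^ (n + 1)).re - w.re ^ (n + 1)) * w.im := by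
      rw [pow_succ w (n + 1), Complex.mul_im]; push_cast; ring
    rw [e]
    calc _ ≤ (|(w ^ (n + 1)).im - (n + 1) * w.re ^ n * w.im| * |w.re| +
          |(w ^ (n + 1)).re - w.re ^ (n + 1)| * |w.im|) * ‖w‖ := by
          rw [← abs_mul, ← abs_mul]; gcongr; exact abs_add_le _ _
      _ ≤ (|(w ^ (n + 1)).im - (n + 1) * w.re ^ n * w.im| * ‖w‖ +
          ((n + 1) * |w.im| * ‖w‖ ^ n) * |w.im|) * ‖w‖ := by
          gcongr
          · exact Complex.abs_re_le_norm w
          · exact abs_re_pow_sub_le w n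
      _ ≤ (n ^ 2 * w.im ^ 2 * ‖w‖ ^ n + ((n + 1) * |w.im| * ‖w‖ ^ n) * |w.im|) * ‖w‖ := by
          gcongr
      _ = (n ^ 2 + n + 1) * w.im ^ 2 * ‖w‖ ^ (n + 1) := by rw [← sq_abs w.im]; ring
      _ ≤ _ := by
          gcongr
          push_cast
          nlinarith [(Nat.cast_nonneg n : (0 : ℝ) ≤ n)]

lemma abs_im_pow_cancellation_le (w : ℂ) (hw1 : ‖w‖ ≤ 1) (m : ℕ) :
    |((m + 1 : ℝ) / (m + 3)) * (w ^ (m + 3)).im - ‖w‖ ^ 2 * (w ^ (m + 1)).im| ≤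
      (3 * (m + 2) ^ 2) * (w.im ^ 2 * ‖w‖) := by
  rcases eq_or_ne w 0 with rfl | hw
  · simp
  have hw' : 0 < ‖w‖ := norm_pos_iff.2 hw
  have h1 := abs_im_pow_sub_mul_le w m
  have h3 := abs_im_pow_sub_mul_le w (m + 2)
  set T₁ := (w ^ (m + 1)).im - (m + 1) * w.re ^ m * w.im with hT₁
  set T₃ := (w ^ (m + 2 + 1)).im - ((m + 2 : ℕ) + 1) * w.re ^ (m + 2) * w.im with hT₃
  have hsq : ‖w‖ ^ 2 = w.re ^ 2 + w.im ^ 2 := by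
    rw [← Complex.normSq_eq_norm_sq, Complex.normSq_apply]; ring
  have e : ((m + 1 : ℝ) / (m + 3)) * (w ^ (m + 3)).im - ‖w‖ ^ 2 * (w ^ (m + 1)).im =
      ((m + 1 : ℝ) / (m + 3)) * T₃ - ‖w‖ ^ 2 * T₁ - (m + 1) * w.re ^ m * w.im * w.im ^ 2 := by
    rw [hT₁, hT₃, hsq, show m + 2 + 1 = m + 3 from rfl]
    push_cast
    field_simp
    ring
  have hpow : ‖w‖ ^ (m + 1) ≤ ‖w‖ := by
    simpa using pow_le_pow_of_le_one hw'.le hw1 (show 1 ≤ m + 1 by omega)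
  have b3 : |((m + 1 : ℝ) / (m + 3)) * T₃| ≤ (m + 2) ^ 2 * (w.im ^ 2 * ‖w‖) := by
    have : |T₃| ≤ (m + 2) ^ 2 * w.im ^ 2 * ‖w‖ ^ (m + 1) := by
      refine le_of_mul_le_mul_right (h3.trans (le_of_eq ?_)) hw'
      push_cast; ring
    rw [abs_mul, abs_of_nonneg (by positivity)]
    calc _ ≤ 1 * ((m + 2) ^ 2 * w.im ^ 2 * ‖w‖ ^ (m + 1)) := by
          gcongr
          rw [div_le_one (by positivity)]; linarith
      _ ≤ 1 * ((m + 2) ^ 2 * w.im ^ 2 * ‖w‖) := by gcongr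
      _ = _ := by ring
  have b1 : |‖w‖ ^ 2 * T₁| ≤ (m + 2) ^ 2 * (w.im ^ 2 * ‖w‖) := by
    rw [abs_mul, abs_of_nonneg (by positivity)]
    calc _ = (|T₁| * ‖w‖) * ‖w‖ := by ring
      _ ≤ (m ^ 2 * w.im ^ 2 * ‖w‖ ^ m) * ‖w‖ := by gcongr
      _ = m ^ 2 * w.im ^ 2 * ‖w‖ ^ (m + 1) := by ring
      _ ≤ (m + 2) ^ 2 * w.im ^ 2 * ‖w‖ := by gcongr; linarith
      _ = _ := by ring
  have b0 : |(m + 1) * w.re ^ m * w.im * w.im ^ 2| ≤ (m + 2) ^ 2 * (w.im ^ 2 * ‖w‖) := by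
    rw [abs_mul, abs_mul, abs_mul, abs_pow, abs_of_nonneg (sq_nonneg w.im),
      abs_of_nonneg (show (0 : ℝ) ≤ m + 1 by positivity)]
    calc _ ≤ (m + 1) * ‖w‖ ^ m * ‖w‖ * w.im ^ 2 := by
          gcongr
          · exact Complex.abs_re_le_norm w
          · exact Complex.abs_im_le_norm w
      _ = (m + 1) * ‖w‖ ^ (m + 1) * w.im ^ 2 := by ring
      _ ≤ (m + 2) ^ 2 * ‖w‖ * w.im ^ 2 := by
          gcongr
          nlinarith [(Nat.cast_nonneg m : (0 : ℝ) ≤ m)]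
      _ = _ := by ring
  rw [e]
  have := abs_sub (((m + 1 : ℝ) / (m + 3)) * T₃ - ‖w‖ ^ 2 * T₁)
    ((m + 1) * w.re ^ m * w.im * w.im ^ 2)
  have := abs_sub (((m + 1 : ℝ) / (m + 3)) * T₃) (‖w‖ ^ 2 * T₁)
  linarith

lemma exists_polynomial_cancellation (A : Polynomial ℝ) :
    ∃ B : Polynomial ℝ, B.derivative = Polynomial.X ^ 2 * A.derivative ∧ B.eval 0 = 0 ∧
      ∃ C : ℝ, 0 ≤ C ∧ ∀ w : ℂ, ‖w‖ ≤ 1 →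
        |(Polynomial.aeval w B).im - ‖w‖ ^ 2 * (Polynomial.aeval w A).im| ≤
          C * (w.im ^ 2 * ‖w‖) := by
  induction A using Polynomial.induction_on' with
  | add p q hp hq =>
    obtain ⟨B₁, d₁, z₁, C₁, p₁, h₁⟩ := hp
    obtain ⟨B₂, d₂, z₂, C₂, p₂, h₂⟩ := hq
    refine ⟨B₁ + B₂, by simp [d₁, d₂, mul_add], by simp [z₁, z₂], C₁ + C₂, by positivity,
      fun w hw => ?_⟩
    have := abs_add_le ((Polynomial.aeval w B₁).im - ‖w‖ ^ 2 * (Polynomial.aeval w p).im)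
      ((Polynomial.aeval w B₂).im - ‖w‖ ^ 2 * (Polynomial.aeval w q).im)
    have e : (Polynomial.aeval w (B₁ + B₂)).im - ‖w‖ ^ 2 * (Polynomial.aeval w (p + q)).im =
        ((Polynomial.aeval w B₁).im - ‖w‖ ^ 2 * (Polynomial.aeval w p).im) +
        ((Polynomial.aeval w B₂).im - ‖w‖ ^ 2 * (Polynomial.aeval w q).im) := by
      simp; ring
    rw [e]
    linarith [h₁ w hw, h₂ w hw]
  | monomial n a =>
    rcases n with _ | m
    · exact ⟨0, by simp, by simp, 0, le_rfl, fun w _ => by simp⟩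
    refine ⟨Polynomial.monomial (m + 3) (a * ((m + 1) / (m + 3))), ?_, by simp,
      |a| * (3 * (m + 2) ^ 2), by positivity, fun w hw => ?_⟩
    · rw [Polynomial.derivative_monomial, Polynomial.derivative_monomial,
        Polynomial.X_pow_mul_monomial]
      congr 1
      push_cast
      field_simp
    · have e : (Polynomial.aeval w (Polynomial.monomial (m + 3) (a * ((m + 1 : ℝ) / (m + 3))))).im -
          ‖w‖ ^ 2 * (Polynomial.aeval w (Polynomial.monomial (m + 1) a)).im =
          a * (((m + 1 : ℝ) / (m + 3)) * (w ^ (m + 3)).im - ‖w‖ ^ 2 * (w ^ (m + 1)).im) := by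
        rw [Polynomial.aeval_monomial, Polynomial.aeval_monomial, Complex.coe_algebraMap,
          Complex.im_ofReal_mul, Complex.im_ofReal_mul]
        ring
      rw [e, abs_mul, mul_assoc]
      gcongr
      exact abs_im_pow_cancellation_le w hw m

lemma norm_segment_integral_sub_le {f p P : ℂ → ℂ} {r C : ℝ} {m n : ℕ}
    (hf : ContinuousOn f (Metric.ball 0 r)) (hp : Continuous p)
    (hP : ∀ x, HasDerivAt P (x ^ m * p x) x) (hP0 : P 0 = 0)
    (hfp : ∀ x ∈ Metric.ball (0 : ℂ) r, ‖f x - p x‖ ≤ C * ‖x‖ ^ n) (hC : 0 ≤ C)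
    {s : ℂ} (hs : s ∈ Metric.ball (0 : ℂ) r) :
    ‖(∫ t in (0 : ℝ)..1, s * (((t : ℂ) * s) ^ m * f ((t : ℂ) * s))) - P s‖ ≤
      C * ‖s‖ ^ (m + n + 1) := by
  have hnorm : ∀ t ∈ Set.Icc (0 : ℝ) 1, ‖(t : ℂ) * s‖ ≤ ‖s‖ := fun t ht => by
    rw [norm_mul, Complex.norm_real, Real.norm_of_nonneg ht.1]
    exact mul_le_of_le_one_left (norm_nonneg _) ht.2
  have hmem : ∀ t ∈ Set.Icc (0 : ℝ) 1, (t : ℂ) * s ∈ Metric.ball (0 : ℂ) r := fun t ht => by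
    rw [mem_ball_zero_iff] at hs ⊢
    exact (hnorm t ht).trans_lt hs
  have hcs : Continuous fun t : ℝ => (t : ℂ) * s := by fun_prop
  have hint : IntervalIntegrable (fun t : ℝ => s * (((t : ℂ) * s) ^ m * f ((t : ℂ) * s)))
      MeasureTheory.volume 0 1 := by
    apply ContinuousOn.intervalIntegrable_of_Icc zero_le_one
    have : ContinuousOn (fun t : ℝ => f ((t : ℂ) * s)) (Set.Icc 0 1) :=
      hf.comp hcs.continuousOn hmem
    exact continuousOn_const.mul ((hcs.pow m).continuousOn.mul this)
  have hint' : IntervalIntegrable (fun t : ℝ => s * (((t : ℂ) * s) ^ m * p ((t : ℂ) * s)))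
      MeasureTheory.volume 0 1 := by
    apply Continuous.intervalIntegrable
    fun_prop
  have hFTC : ∫ t in (0 : ℝ)..1, s * (((t : ℂ) * s) ^ m * p ((t : ℂ) * s)) = P s := by
    have := intervalIntegral.integral_eq_sub_of_hasDerivAt (f := fun t : ℝ => P ((t : ℂ) * s))
      (fun t _ => ?_) hint'
    · rw [this]; simp [hP0]
    · have h1 : HasDerivAt (fun z : ℂ => z * s) s (t : ℂ) := by
        simpa using (hasDerivAt_id (t : ℂ)).mul_const s
      have h2 := ((hP ((t : ℂ) * s)).comp (t : ℂ) h1).comp_ofReal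
      rw [mul_comm] at h2
      exact h2
  rw [← hFTC, ← intervalIntegral.integral_sub hint hint']
  have := intervalIntegral.norm_integral_le_of_norm_le_const (a := (0 : ℝ)) (b := 1)
    (C := C * ‖s‖ ^ (m + n + 1))
    (f := fun t : ℝ => s * (((t : ℂ) * s) ^ m * f ((t : ℂ) * s)) -
      s * (((t : ℂ) * s) ^ m * p ((t : ℂ) * s))) (fun t ht => ?_)
  · simpa using this
  rw [Set.uIoc_of_le zero_le_one] at ht
  have ht' : t ∈ Set.Icc (0 : ℝ) 1 := ⟨ht.1.le, ht.2⟩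
  rw [← mul_sub, ← mul_sub, norm_mul, norm_mul, norm_pow]
  calc _ ≤ ‖s‖ * (‖s‖ ^ m * (C * ‖s‖ ^ n)) := by
        gcongr
        · exact hnorm t ht'
        · refine (hfp _ (hmem t ht')).trans ?_
          gcongr
          exact hnorm t ht'
    _ = _ := by ring

lemma exists_eventually_deriv_pow_mul_sub_le {L₁ : ℂ → ℂ} (hL₁ : AnalyticAt ℂ L₁ 0) (n : ℕ) :
    ∃ C : ℝ, 0 ≤ C ∧ ∀ᶠ x in 𝓝 (0 : ℂ), ‖L₁ x - L₁ 0‖ ≤ C * ‖x‖ ∧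
      ‖deriv (fun y => y ^ (n + 1) * L₁ y) x - (n + 1) * L₁ 0 * x ^ n‖ ≤ C * ‖x‖ ^ (n + 1) := by
  obtain ⟨C₁, hC₁, h₁⟩ := hL₁.differentiableAt.isBigO_sub.exists_nonneg
  have h₂ : ∀ᶠ x in 𝓝 (0 : ℂ), ‖deriv L₁ x‖ < ‖deriv L₁ 0‖ + 1 :=
    hL₁.deriv.continuousAt.norm.eventually_lt continuousAt_const (lt_add_one _)
  refine ⟨(n + 1) * C₁ + (‖deriv L₁ 0‖ + 1), by positivity, ?_⟩
  filter_upwards [h₁.bound, h₂, hL₁.eventually_analyticAt] with x hx₁ hx₂ hx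
  rw [sub_zero] at hx₁
  constructor
  · refine hx₁.trans ?_
    gcongr
    nlinarith [norm_nonneg (deriv L₁ 0), mul_nonneg (Nat.cast_nonneg n : (0 : ℝ) ≤ n) hC₁]
  · have hd : HasDerivAt (fun y => y ^ (n + 1) * L₁ y)
        (((n + 1 : ℕ) : ℂ) * x ^ n * L₁ x + x ^ (n + 1) * deriv L₁ x) x :=
      (hasDerivAt_pow (n + 1) x).mul hx.differentiableAt.hasDerivAt
    rw [hd.deriv]
    have e : ((n + 1 : ℕ) : ℂ) * x ^ n * L₁ x + x ^ (n + 1) * deriv L₁ x -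
        (n + 1) * L₁ 0 * x ^ n =
        ((n + 1 : ℕ) : ℂ) * x ^ n * (L₁ x - L₁ 0) + x ^ (n + 1) * deriv L₁ x := by
      push_cast; ring
    rw [e]
    calc _ ≤ (n + 1) * ‖x‖ ^ n * ‖L₁ x - L₁ 0‖ + ‖x‖ ^ (n + 1) * ‖deriv L₁ x‖ := by
          refine (norm_add_le _ _).trans (le_of_eq ?_)
          rw [norm_mul, norm_mul, norm_mul, norm_pow, norm_pow, Complex.norm_natCast]
          push_cast; ring
      _ ≤ (n + 1) * ‖x‖ ^ n * (C₁ * ‖x‖) + ‖x‖ ^ (n + 1) * (‖deriv L₁ 0‖ + 1) := by gcongr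
      _ = _ := by ring

lemma eventually_norm_segment_integral_sub_le {M K n : ℕ} (hn : 2 * M * K = n + 1)
    {A B : Polynomial ℝ} (hB : B.derivative = Polynomial.X ^ 2 * A.derivative)
    (hB0 : B.eval 0 = 0) (hM : 0 < M) {L₁ L : ℂ → ℂ} (hL₁ : AnalyticAt ℂ L₁ 0)
    (hL : ∀ s : ℂ, L s = Complex.I * Polynomial.aeval (s ^ M) A + s ^ (n + 1) * L₁ s)
    {C : ℝ} (hC : 0 ≤ C)
    (hbound : ∀ᶠ x in 𝓝 (0 : ℂ),
      ‖deriv (fun y => y ^ (n + 1) * L₁ y) x - (n + 1) * L₁ 0 * x ^ n‖ ≤ C * ‖x‖ ^ (n + 1)) :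
    ∀ᶠ s in 𝓝 (0 : ℂ),
      ‖(∫ t in (0 : ℝ)..1, s * (((t : ℂ) * s) ^ (2 * M) * deriv L ((t : ℂ) * s))) -
        (Complex.I * Polynomial.aeval (s ^ M) B +
          (K / (K + 1) : ℂ) * L₁ 0 * s ^ (2 * M + n + 1))‖ ≤ C * ‖s‖ ^ (2 * M + (n + 1) + 1) := by
  have hpoly : ∀ (Q : Polynomial ℝ) (x : ℂ),
      HasDerivAt (fun s : ℂ => Complex.I * Polynomial.aeval (s ^ M) Q)
        (Complex.I * (Polynomial.aeval (x ^ M) Q.derivative * (M * x ^ (M - 1)))) x :=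
    fun Q x => ((Q.hasDerivAt_aeval (x ^ M)).comp x (hasDerivAt_pow M x)).const_mul _
  have hLfun : L = fun s => Complex.I * Polynomial.aeval (s ^ M) A + s ^ (n + 1) * L₁ s :=
    funext hL
  obtain ⟨r, hr, hball⟩ := Metric.eventually_nhds_iff_ball.1
    (hbound.and hL₁.eventually_analyticAt)
  have hdiff : DifferentiableOn ℂ L (Metric.ball 0 r) := fun x hx => by
    rw [hLfun]
    exact ((hpoly A x).differentiableAt.add
      ((differentiableAt_id.pow _).mul (hball x hx).2.differentiableAt)).differentiableWithinAt
  filter_upwards [Metric.ball_mem_nhds 0 hr] with s hs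
  refine norm_segment_integral_sub_le
    (p := fun x => Complex.I * (Polynomial.aeval (x ^ M) A.derivative * (M * x ^ (M - 1))) +
      (n + 1) * L₁ 0 * x ^ n)
    (P := fun x => Complex.I * Polynomial.aeval (x ^ M) B +
      (K / (K + 1) : ℂ) * L₁ 0 * x ^ (2 * M + n + 1))
    (hdiff.deriv Metric.isOpen_ball).continuousOn ?_ (fun x => ?_) ?_ (fun x hx => ?_) hC hs
  · fun_prop
  · have h := (hpoly B x).add
      ((hasDerivAt_pow (2 * M + n + 1) x).const_mul ((K / (K + 1) : ℂ) * L₁ 0))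
    refine h.congr_deriv ?_
    have hK : (K + 1 : ℂ) ≠ 0 := by exact_mod_cast K.succ_ne_zero
    have hn' : (n : ℂ) = 2 * M * K - 1 := by
      rw [eq_sub_iff_add_eq]; exact_mod_cast hn.symm
    rw [hB, map_mul, map_pow, Polynomial.aeval_X, Nat.add_sub_cancel]
    push_cast
    rw [hn']
    field_simp
    ring
  · have : Polynomial.aeval (0 : ℂ) B = 0 := by
      have h := Polynomial.aeval_algebraMap_apply ℂ (0 : ℝ) B
      simpa [hB0] using h
    simp [hM.ne', this]
  · have hd : deriv L x = Complex.I *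
        (Polynomial.aeval (x ^ M) A.derivative * (M * x ^ (M - 1))) +
        deriv (fun y => y ^ (n + 1) * L₁ y) x := by
      rw [hLfun]
      exact ((hpoly A x).add
        ((differentiableAt_id.pow _).mul (hball x hx).2.differentiableAt).hasDerivAt).deriv
    rw [hd, add_sub_add_left_eq_sub]
    exact (hball x hx).1

/-- isolated type: Let `M, K ≥ 1`, `A₀ ∈ ℝ[s]` of degree `< 2K`,
`L₁` analytic near `0` with `Re L₁(0) > 0`, and
`L(s) = i A₀(s^M) + s^{2MK} L₁(s)`. With
`g(s) = i s^{2M} + 2Mi ∫_{[0,s]} x^{2M} L′(x) dx`, for all small `s`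
`Im g(s) ≤ |s^M e^{M L(s)}|²`: the curve `s ↦ (s^M e^{M L(s)}, g(s))` avoids the
Siegel half-space `U₂` near the origin. -/
theorem statement9 (M K : ℕ) (hM : 0 < M) (hK : 0 < K)
    (A₀ : Polynomial ℝ) (hdeg : A₀.degree < (2 * K : ℕ))
    (L₁ : ℂ → ℂ) (hL₁ : AnalyticAt ℂ L₁ 0) (hre : 0 < (L₁ 0).re)
    (L : ℂ → ℂ)
    (hLdef : ∀ s : ℂ,
      L s = Complex.I * Polynomial.aeval (s ^ M) A₀ + s ^ (2 * M * K) * L₁ s) :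
    ∃ ε : ℝ, 0 < ε ∧ ∀ s : ℂ, ‖s‖ < ε →
      (curveWM M L s).im ≤ ‖s ^ M * Complex.exp ((M : ℂ) * L s)‖ ^ 2 := by
  obtain ⟨B, hB, hB0, C₁, hC₁, hcancel⟩ := exists_polynomial_cancellation A₀
  obtain ⟨n, hn⟩ : ∃ n, 2 * M * K = n + 1 :=
    Nat.exists_eq_succ_of_ne_zero (by positivity)
  obtain ⟨C, hC, hbound⟩ := exists_eventually_deriv_pow_mul_sub_le hL₁ n
  have hint := eventually_norm_segment_integral_sub_le hn hB hB0 hM hL₁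
    (L := L) (fun s => by rw [hLdef, hn]) hC (hbound.mono fun _ h => h.2)
  set c := L₁ 0 with hc
  have hM' : (0 : ℝ) < M := by exact_mod_cast hM
  set C₂ : ℝ := 2 * M * (4 * K * ‖c‖) with hC₂
  have hsmall : ∀ᶠ s in 𝓝 (0 : ℂ), ‖s‖ < 1 ∧ 2 * M * C₁ * ‖s‖ < 1 ∧
      (C₂ ^ 2 / 4 + 4 * M * C) * ‖s‖ < 2 * M * (c.re / (K + 1)) := by
    have ht : ∀ a b : ℝ, 0 < b → ∀ᶠ s in 𝓝 (0 : ℂ), a * ‖s‖ < b := fun a b hb =>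
      ContinuousAt.eventually_lt (by fun_prop) continuousAt_const (by simpa using hb)
    filter_upwards [ht 1 1 one_pos, ht (2 * M * C₁) 1 one_pos,
      ht (C₂ ^ 2 / 4 + 4 * M * C) (2 * M * (c.re / (K + 1))) (by positivity)] with s h₁ h₂ h₃
    exact ⟨by simpa using h₁, h₂, h₃⟩
  obtain ⟨ε, hε, hball⟩ := Metric.eventually_nhds_iff.1 (hint.and (hbound.and hsmall))
  refine ⟨ε, hε, fun s hs => ?_⟩
  obtain ⟨hJ, ⟨hL₁s, -⟩, hs₁, hs₂, hs₃⟩ := hball (by simpa using hs)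
  set J := ∫ t in (0 : ℝ)..1, s * (((t : ℂ) * s) ^ (2 * M) * deriv L ((t : ℂ) * s)) with hJdef
  set w := s ^ M with hw
  have hρs : ‖w‖ ≤ ‖s‖ := by
    rw [hw, norm_pow]
    exact pow_le_of_le_one (norm_nonneg _) hs₁.le hM.ne'
  have hρ1 : ‖w‖ ≤ 1 := hρs.trans hs₁.le
  have hpow : s ^ (2 * M + n + 1) = w ^ (2 * K + 2) := by
    rw [hw, ← pow_mul, add_assoc, ← hn]; congr 1; ring
  have hpow' : ‖s‖ ^ (2 * M + (n + 1) + 1) = ‖w‖ ^ (2 * K + 2) * ‖s‖ := by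
    rw [← norm_pow w, ← hpow, norm_pow]; ring
  rw [hpow, hpow'] at hJ
  have hLs : L s = Complex.I * Polynomial.aeval w A₀ + c * w ^ (2 * K) +
      w ^ (2 * K) * (L₁ s - c) := by
    rw [hLdef, show 2 * M * K = M * (2 * K) by ring, pow_mul]; ring
  have hLre : -(Polynomial.aeval w A₀).im + (c * w ^ (2 * K)).re - C * (‖w‖ ^ (2 * K) * ‖s‖) ≤
      (L s).re := by
    have h := Complex.abs_re_le_norm (w ^ (2 * K) * (L₁ s - c))
    rw [norm_mul, norm_pow] at h
    have h' : ‖w‖ ^ (2 * K) * ‖L₁ s - c‖ ≤ ‖w‖ ^ (2 * K) * (C * ‖s‖) := by gcongr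
    rw [hLs, Complex.add_re, Complex.add_re, Complex.I_mul_re]
    linarith [neg_abs_le (w ^ (2 * K) * (L₁ s - c)).re]
  have hJre : J.re ≤ -(Polynomial.aeval w B).im +
      ((K / (K + 1) : ℂ) * c * w ^ (2 * K + 2)).re + C * (‖w‖ ^ (2 * K + 2) * ‖s‖) := by
    have h := (Complex.re_le_norm _).trans hJ
    rw [Complex.sub_re, Complex.add_re, Complex.I_mul_re] at h
    linarith
  have hlhs : (curveWM M L s).im = (w ^ 2).re + 2 * M * J.re := by
    have : curveWM M L s = Complex.I * w ^ 2 + ((2 * M : ℝ) : ℂ) * (Complex.I * J) := by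
      rw [curveWM, ← hJdef, hw]; push_cast; ring
    rw [this, Complex.add_im, Complex.im_ofReal_mul, Complex.I_mul_im, Complex.I_mul_im]
  have hrhs : ‖w‖ ^ 2 * (1 + 2 * M * (L s).re) ≤ ‖w * Complex.exp (M * L s)‖ ^ 2 := by
    have hexp : ‖Complex.exp (M * L s)‖ ^ 2 = Real.exp (2 * M * (L s).re) := by
      rw [Complex.norm_exp, ← Real.exp_nat_mul, ← Complex.ofReal_natCast, Complex.re_ofReal_mul]
      congr 1; push_cast; ring
    rw [norm_mul, mul_pow, hexp]
    gcongr
    linarith [Real.add_one_le_exp (2 * M * (L s).re)]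
  have hsq : ‖w‖ ^ 2 - (w ^ 2).re = 2 * w.im ^ 2 := by
    rw [← Complex.normSq_eq_norm_sq, Complex.normSq_apply, pow_two w, Complex.mul_re]; ring
  have hcan := (abs_le.1 (hcancel w hρ1)).1
  have hlead := le_re_leading_term c w K
  have hq : C₁ * (w.im ^ 2 * ‖w‖) * (2 * M) ≤ w.im ^ 2 := by
    calc _ = w.im ^ 2 * (2 * M * C₁ * ‖w‖) := by ring
      _ ≤ w.im ^ 2 * (2 * M * C₁ * ‖s‖) := by gcongr
      _ ≤ w.im ^ 2 * 1 := by gcongr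
      _ = _ := mul_one _
  have hamgm : C₂ * (|w.im| * ‖w‖ ^ (2 * K + 1)) ≤
      w.im ^ 2 + C₂ ^ 2 / 4 * (‖w‖ ^ (2 * K + 2) * ‖s‖) := by
    have h : (‖w‖ ^ (2 * K + 1)) ^ 2 ≤ ‖w‖ ^ (2 * K + 2) * ‖s‖ := by
      calc _ = ‖w‖ ^ (2 * K + 2) * ‖w‖ ^ (2 * K) := by ring
        _ ≤ ‖w‖ ^ (2 * K + 2) * ‖w‖ := by
          gcongr
          exact pow_le_of_le_one (norm_nonneg _) hρ1 (by positivity)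
        _ ≤ _ := by gcongr
    have h' : C₂ ^ 2 / 4 * (‖w‖ ^ (2 * K + 1)) ^ 2 ≤
      C₂ ^ 2 / 4 * (‖w‖ ^ (2 * K + 2) * ‖s‖) := by gcongr
    nlinarith [sq_nonneg (|w.im| - C₂ / 2 * ‖w‖ ^ (2 * K + 1)), sq_abs w.im]
  have hfin : ‖w‖ ^ (2 * K + 2) * ((C₂ ^ 2 / 4 + 4 * M * C) * ‖s‖) ≤
      ‖w‖ ^ (2 * K + 2) * (2 * M * (c.re / (K + 1))) := by gcongr
  have hLre' := mul_le_mul_of_nonneg_left hLre (sq_nonneg ‖w‖)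
  rw [show ‖w‖ ^ 2 * (-(Polynomial.aeval w A₀).im + (c * w ^ (2 * K)).re -
      C * (‖w‖ ^ (2 * K) * ‖s‖)) = -(‖w‖ ^ 2 * (Polynomial.aeval w A₀).im) +
      ‖w‖ ^ 2 * (c * w ^ (2 * K)).re - C * (‖w‖ ^ (2 * K + 2) * ‖s‖) by ring] at hLre'
  have hdiff : c.re / (K + 1) * ‖w‖ ^ (2 * K + 2) -
      4 * K * ‖c‖ * (|w.im| * ‖w‖ ^ (2 * K + 1)) - C₁ * (w.im ^ 2 * ‖w‖) -
      2 * C * (‖w‖ ^ (2 * K + 2) * ‖s‖) ≤ ‖w‖ ^ 2 * (L s).re - J.re := by linarith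
  have hdiff' := mul_le_mul_of_nonneg_left hdiff (show 0 ≤ 2 * (M : ℝ) by positivity)
  rw [hlhs]
  refine le_trans ?_ hrhs
  rw [hC₂] at hamgm hfin
  linarith
end

section
/- Let M, K be positive integers, let A₀ be a polynomial with real coefficients of degree less than 2K, and let L₁ be a complex-analytic function on a neighborhood of 0 ∈ ℂ with Re L₁(0) > 0. Set L(s) = i A₀(s^M) + s^{2MK} L₁(s) and define g(s) = i s^{2M} + 2Mi ∫_{[0,s]} x^{2M} L′(x) dx along the straight segment from 0 to s. Then there exist constants c > 0 and ε > 0 such that for all s ∈ ℂ with |s| < ε, |s e^{L(s)}|^{2M} − Im g(s) ≥ c |s|^{2M(1+K)}. In particular, the curve s ↦ (s^M e^{M L(s)}, g(s)) meets the boundary ∂U₂ = {(z,w) : Im w = |z|²} only at s = 0 near the origin. -/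
open Filter Topology

theorem Complex.abs_im_pow_sub_le (u : ℂ) (n : ℕ) :
    |(u ^ (n + 2)).im - (n + 2) * u.im * (u ^ (n + 1)).re| ≤
      (n + 2) ^ 2 * (u.im ^ 2 * ‖u‖ ^ n) := by
  induction n with
  | zero =>
    have h : (u ^ (0 + 2)).im - ((0 : ℕ) + 2) * u.im * (u ^ (0 + 1)).re = 0 := by
      simp [pow_two]; ring
    rw [h, abs_zero]; positivity
  | succ n ih =>
    have e : (u ^ (n + 1 + 2)).im - ((n + 1 : ℕ) + 2) * u.im * (u ^ (n + 1 + 1)).re =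
        u.re * ((u ^ (n + 2)).im - (n + 2) * u.im * (u ^ (n + 1)).re) +
          (n + 2) * u.im ^ 2 * (u ^ (n + 1)).im := by
      rw [pow_succ' u (n + 1 + 1), pow_succ' u (n + 1)]
      simp only [Complex.mul_im, Complex.mul_re]
      push_cast
      ring
    have h1 : |u.re| ≤ ‖u‖ := Complex.abs_re_le_norm u
    have h2 : |(u ^ (n + 1)).im| ≤ ‖u‖ ^ (n + 1) := by
      simpa using Complex.abs_im_le_norm (u ^ (n + 1))
    rw [e]
    calc _ ≤ |u.re| * |(u ^ (n + 2)).im - (n + 2) * u.im * (u ^ (n + 1)).re| +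
          (n + 2) * u.im ^ 2 * |(u ^ (n + 1)).im| := by
            refine (abs_add_le _ _).trans_eq ?_
            rw [abs_mul, abs_mul, abs_of_nonneg (by positivity : 0 ≤ (n + 2 : ℝ) * u.im ^ 2)]
      _ ≤ ‖u‖ * ((n + 2) ^ 2 * (u.im ^ 2 * ‖u‖ ^ n)) +
          (n + 2) * u.im ^ 2 * ‖u‖ ^ (n + 1) := by gcongr
      _ = ((n + 2) ^ 2 + (n + 2)) * (u.im ^ 2 * ‖u‖ ^ (n + 1)) := by ring
      _ ≤ _ := by
        gcongr
        push_cast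
        nlinarith [(Nat.cast_nonneg n : (0 : ℝ) ≤ n)]

theorem Complex.abs_im_pow_defect_le (u : ℂ) (k : ℕ) :
    |(k : ℝ) / (k + 2) * (u ^ (k + 2)).im - ‖u‖ ^ 2 * (u ^ k).im| ≤
      2 * (k + 3) ^ 2 * (u.im ^ 2 * ‖u‖ ^ k) := by
  have e : (k : ℝ) / (k + 2) * (u ^ (k + 2)).im - ‖u‖ ^ 2 * (u ^ k).im =
      -(2 / (k + 2)) * ((u ^ (k + 2)).im - (k + 2) * u.im * (u ^ (k + 1)).re) := by
    rw [Complex.sq_norm, Complex.normSq_apply, pow_succ' u (k + 1), pow_succ' u k]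
    simp only [Complex.mul_im, Complex.mul_re]
    field_simp
    ring
  rw [e, abs_mul, abs_neg, abs_of_nonneg (by positivity : 0 ≤ (2 / (k + 2) : ℝ))]
  have h2 : (2 / (k + 2) : ℝ) ≤ 2 := by
    rw [div_le_iff₀ (by positivity)]; nlinarith [(Nat.cast_nonneg k : (0 : ℝ) ≤ k)]
  calc _ ≤ 2 * (((k : ℝ) + 2) ^ 2 * (u.im ^ 2 * ‖u‖ ^ k)) := by
        gcongr; exact Complex.abs_im_pow_sub_le u k
    _ ≤ 2 * (((k : ℝ) + 3) ^ 2 * (u.im ^ 2 * ‖u‖ ^ k)) := by gcongr; norm_num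
    _ = _ := by ring

theorem exists_abs_sum_im_pow_defect_le (a : ℕ → ℝ) (N : ℕ) :
    ∃ C : ℝ, 0 ≤ C ∧ ∀ u : ℂ, ‖u‖ ≤ 1 →
      |∑ k ∈ Finset.range N,
          a k * ((k : ℝ) / (k + 2) * (u ^ (k + 2)).im - ‖u‖ ^ 2 * (u ^ k).im)| ≤
        C * (u.im ^ 2 * ‖u‖) := by
  refine ⟨∑ k ∈ Finset.range N, |a k| * (2 * (k + 3) ^ 2), by positivity, fun u hu => ?_⟩
  rw [Finset.sum_mul]
  refine (Finset.abs_sum_le_sum_abs _ _).trans (Finset.sum_le_sum fun k _ => ?_)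
  rw [abs_mul, mul_assoc]
  gcongr
  rcases Nat.eq_zero_or_pos k with rfl | hk
  · simp; positivity
  · refine (Complex.abs_im_pow_defect_le u k).trans ?_
    gcongr
    exact pow_le_of_le_one (norm_nonneg _) hu hk.ne'

theorem Complex.norm_sq_pow_sub_le (u : ℂ) (n : ℕ) :
    ‖(u ^ 2) ^ n - ((‖u‖ : ℂ) ^ 2) ^ n‖ * ‖u‖ ≤ 2 * n * |u.im| * ‖u‖ ^ (2 * n) := by
  have h0 : u ^ 2 - (‖u‖ : ℂ) ^ 2 = 2 * Complex.I * u.im * u := by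
    rw [← Complex.mul_conj']
    apply Complex.ext <;> simp [pow_two] <;> ring
  have h1 : ‖u ^ 2 - (‖u‖ : ℂ) ^ 2‖ = 2 * |u.im| * ‖u‖ := by
    rw [h0]; simp
  induction n with
  | zero => simp
  | succ n ih =>
    have e : (u ^ 2) ^ (n + 1) - ((‖u‖ : ℂ) ^ 2) ^ (n + 1) =
        ((u ^ 2) ^ n - ((‖u‖ : ℂ) ^ 2) ^ n) * u ^ 2 +
          ((‖u‖ : ℂ) ^ 2) ^ n * (u ^ 2 - (‖u‖ : ℂ) ^ 2) := by ring
    rw [e]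
    calc _ ≤ (‖(u ^ 2) ^ n - ((‖u‖ : ℂ) ^ 2) ^ n‖ * ‖u‖ ^ 2 +
          (‖u‖ ^ 2) ^ n * (2 * |u.im| * ‖u‖)) * ‖u‖ := by
            gcongr
            refine (norm_add_le _ _).trans_eq ?_
            rw [norm_mul, norm_mul, h1]
            simp
      _ = (‖(u ^ 2) ^ n - ((‖u‖ : ℂ) ^ 2) ^ n‖ * ‖u‖) * ‖u‖ ^ 2 +
          2 * |u.im| * ‖u‖ ^ (2 * (n + 1)) := by ring
      _ ≤ (2 * n * |u.im| * ‖u‖ ^ (2 * n)) * ‖u‖ ^ 2 +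
          2 * |u.im| * ‖u‖ ^ (2 * (n + 1)) := by gcongr
      _ = _ := by push_cast; ring

theorem Complex.leading_defect_ge (l u : ℂ) (K : ℕ) :
    l.re / (K + 1) * ‖u‖ ^ (2 * K + 2) - 4 * K * ‖l‖ * (|u.im| * ‖u‖ ^ (2 * K + 1)) ≤
      ‖u‖ ^ 2 * (u ^ (2 * K) * l).re - (K : ℝ) / (K + 1) * (l * u ^ (2 * K + 2)).re := by
  rcases eq_or_ne u 0 with rfl | hu
  · simp
  have hr : 0 < ‖u‖ := norm_pos_iff.mpr hu
  have key (n : ℕ) : |((u ^ (2 * n) * l).re) - ‖u‖ ^ (2 * n) * l.re| * ‖u‖ ≤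
      2 * n * |u.im| * ‖u‖ ^ (2 * n) * ‖l‖ := by
    have e : (u ^ (2 * n) * l).re - ‖u‖ ^ (2 * n) * l.re =
        (((u ^ 2) ^ n - ((‖u‖ : ℂ) ^ 2) ^ n) * l).re := by
      rw [sub_mul, Complex.sub_re, ← pow_mul, ← pow_mul, ← Complex.ofReal_pow,
        Complex.re_ofReal_mul]
    rw [e]
    calc _ ≤ (‖(u ^ 2) ^ n - ((‖u‖ : ℂ) ^ 2) ^ n‖ * ‖l‖) * ‖u‖ := by
          gcongr
          refine (Complex.abs_re_le_norm _).trans_eq (norm_mul _ _)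
      _ = (‖(u ^ 2) ^ n - ((‖u‖ : ℂ) ^ 2) ^ n‖ * ‖u‖) * ‖l‖ := by ring
      _ ≤ _ := mul_le_mul_of_nonneg_right (Complex.norm_sq_pow_sub_le u n) (norm_nonneg l)
  have k1 := key K
  have k2 := key (K + 1)
  have c1 : ‖u‖ * (‖u‖ ^ (2 * K) * l.re - (u ^ (2 * K) * l).re) ≤
      2 * K * |u.im| * ‖u‖ ^ (2 * K) * ‖l‖ := by
    refine le_trans ?_ k1
    rw [mul_comm, abs_sub_comm]
    gcongr
    exact le_abs_self _
  have c2 : ‖u‖ * ((l * u ^ (2 * K + 2)).re - ‖u‖ ^ (2 * K + 2) * l.re) ≤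
      2 * (K + 1) * |u.im| * ‖u‖ ^ (2 * K + 2) * ‖l‖ := by
    have k2' := k2
    push_cast at k2'
    refine le_trans ?_ k2'
    rw [mul_comm, mul_comm l]
    gcongr
    exact le_abs_self _
  have d2 := mul_le_mul_of_nonneg_left c2 (by positivity : (0 : ℝ) ≤ K / (K + 1))
  have d1 := mul_le_mul_of_nonneg_left c1 (by positivity : (0 : ℝ) ≤ ‖u‖ ^ 2)
  refine le_of_mul_le_mul_left ?_ hr
  have e2 : (K : ℝ) / (K + 1) * (2 * (K + 1) * |u.im| * ‖u‖ ^ (2 * K + 2) * ‖l‖) =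
      2 * K * |u.im| * ‖u‖ ^ (2 * K + 2) * ‖l‖ := by field_simp
  rw [e2] at d2
  have e3 : l.re / (K + 1) = l.re - (K : ℝ) / (K + 1) * l.re := by field_simp; ring
  rw [e3]
  have := add_le_add d1 d2
  refine sub_nonneg.mp (le_trans (sub_nonneg.mpr this) (le_of_eq ?_))
  ring

theorem intervalIntegral_segment_eq {F f : ℂ → ℂ} (hF : ∀ x, HasDerivAt F (f x) x)
    (hf : Continuous f) (h0 : F 0 = 0) (s : ℂ) :
    ∫ t in (0 : ℝ)..1, s * f ((t : ℂ) * s) = F s := by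
  have h : ∀ t : ℝ, HasDerivAt (fun t : ℝ => F ((t : ℂ) * s)) (s * f ((t : ℂ) * s)) t := by
    intro t
    have h1 : HasDerivAt (fun t : ℝ => (t : ℂ) * s) s t := by
      simpa using (Complex.ofRealCLM.hasDerivAt (x := t)).mul_const s
    have := (hF ((t : ℂ) * s)).comp t h1
    rwa [mul_comm] at this
  rw [intervalIntegral.integral_eq_sub_of_hasDerivAt (fun t _ => h t)
    (Continuous.intervalIntegrable (by fun_prop) _ _)]
  simp [h0]

theorem exists_norm_segment_integral_sub_le {L F f : ℂ → ℂ} {n m : ℕ} {C ε : ℝ}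
    (hL : ContinuousOn (deriv L) (Metric.ball 0 ε))
    (hF : ∀ x, HasDerivAt F (x ^ m * f x) x) (hf : Continuous f) (h0 : F 0 = 0)
    (hC : 0 ≤ C)
    (hE : ∀ x : ℂ, ‖x‖ < ε → ‖deriv L x - f x‖ ≤ C * ‖x‖ ^ n) (s : ℂ) (hs : ‖s‖ < ε) :
    ‖(∫ t in (0 : ℝ)..1, s * (((t : ℂ) * s) ^ m * deriv L ((t : ℂ) * s))) - F s‖ ≤
      C * ‖s‖ ^ (m + n + 1) := by
  have hle : ∀ t ∈ Set.uIcc (0 : ℝ) 1, ‖(t : ℂ) * s‖ ≤ ‖s‖ := by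
    intro t ht
    rw [Set.uIcc_of_le zero_le_one] at ht
    rw [norm_mul, Complex.norm_real, Real.norm_of_nonneg ht.1]
    exact mul_le_of_le_one_left (norm_nonneg _) ht.2
  have hcont : ContinuousOn (fun t : ℝ => deriv L ((t : ℂ) * s)) (Set.uIcc 0 1) :=
    hL.comp (by fun_prop) fun t ht => by
      simpa using (hle t ht).trans_lt hs
  rw [← intervalIntegral_segment_eq hF (by fun_prop) h0 s,
    ← intervalIntegral.integral_sub
      (ContinuousOn.intervalIntegrable (by fun_prop))
      (Continuous.intervalIntegrable (by fun_prop) _ _)]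
  have hb : ∀ t ∈ Set.uIoc (0 : ℝ) 1,
      ‖s * (((t : ℂ) * s) ^ m * deriv L ((t : ℂ) * s)) -
        s * (((t : ℂ) * s) ^ m * f ((t : ℂ) * s))‖ ≤ C * ‖s‖ ^ (m + n + 1) := by
    intro t ht
    have h1 := hle t (Set.uIoc_subset_uIcc ht)
    rw [← mul_sub, ← mul_sub, norm_mul, norm_mul, norm_pow]
    calc _ ≤ ‖s‖ * (‖s‖ ^ m * (C * ‖s‖ ^ n)) := by
          gcongr
          exact (hE _ (h1.trans_lt hs)).trans (by gcongr)
      _ = _ := by ring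
  simpa using intervalIntegral.norm_integral_le_of_norm_le_const hb

theorem AnalyticAt.exists_norm_sub_le_and_norm_deriv_le {f : ℂ → ℂ} (hf : AnalyticAt ℂ f 0) :
    ∃ C ε : ℝ, 0 ≤ C ∧ 0 < ε ∧ AnalyticOnNhd ℂ f (Metric.ball 0 ε) ∧
      ∀ s : ℂ, ‖s‖ < ε → ‖f s - f 0‖ ≤ C * ‖s‖ ∧ ‖deriv f s‖ ≤ C := by
  obtain ⟨C, hC, h1⟩ := hf.differentiableAt.isBigO_sub.exists_nonneg
  have h1 := h1.bound
  have h2 : ∀ᶠ s in 𝓝 (0 : ℂ), ‖deriv f s‖ < ‖deriv f 0‖ + 1 :=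
    hf.deriv.continuousAt.norm.eventually_lt_const (by simp)
  obtain ⟨ε, hε, h⟩ := Metric.eventually_nhds_iff_ball.mp
    ((h1.and h2).and hf.eventually_analyticAt)
  refine ⟨C + (‖deriv f 0‖ + 1), ε, by positivity, hε, fun s hs => (h s hs).2, fun s hs => ?_⟩
  obtain ⟨⟨a, b⟩, -⟩ := h s (by simpa using hs)
  simp only [sub_zero] at a
  refine ⟨a.trans ?_, by linarith⟩
  gcongr
  have := norm_nonneg (deriv f 0)
  linarith

/-- The part of the integral of `x ^ (2 * M) * L′ x` coming from `i A₀(x ^ M) + l x ^ (2MK)`,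
written in the variable `u = s ^ M`. -/
noncomputable def leadingIntegral (K : ℕ) (a : ℕ → ℝ) (l u : ℂ) : ℂ :=
  ∑ k ∈ Finset.range (2 * K), Complex.I * (a k : ℂ) * ((k / (k + 2) : ℝ) : ℂ) * u ^ (k + 2) +
    ((K / (K + 1) : ℝ) : ℂ) * (l * u ^ (2 * K + 2))

/-- The derivative of `i A₀(x ^ M) + l x ^ (2MK)`. -/
noncomputable def leadingDeriv (M K : ℕ) (a : ℕ → ℝ) (l x : ℂ) : ℂ :=
  ∑ k ∈ Finset.range (2 * K), Complex.I * (a k : ℂ) * ((M * k : ℕ) * x ^ (M * k - 1)) +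
    ((2 * M * K : ℕ) * x ^ (2 * M * K - 1)) * l

theorem hasDerivAt_leadingIntegral {M K : ℕ} (hM : 0 < M) (hK : 0 < K) (a : ℕ → ℝ) (l x : ℂ) :
    HasDerivAt (fun s => leadingIntegral K a l (s ^ M))
      (x ^ (2 * M) * leadingDeriv M K a l x) x := by
  unfold leadingIntegral leadingDeriv
  have hp (j : ℕ) : HasDerivAt (fun s : ℂ => (s ^ M) ^ j)
      ((M * j : ℕ) * x ^ (M * j - 1)) x := by
    simpa only [← pow_mul] using hasDerivAt_pow (M * j) x
  have hM0 : (M : ℂ) ≠ 0 := by exact_mod_cast hM.ne'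
  refine ((HasDerivAt.fun_sum (u := Finset.range (2 * K)) fun k _ =>
    (hp (k + 2)).const_mul (Complex.I * (a k : ℂ) * ((k / (k + 2) : ℝ) : ℂ))).add
    (((hp (2 * K + 2)).const_mul l).const_mul ((K / (K + 1) : ℝ) : ℂ))).congr_deriv ?_
  symm
  rw [mul_add, Finset.mul_sum]
  congr 1
  · refine Finset.sum_congr rfl fun k _ => ?_
    rcases Nat.eq_zero_or_pos k with rfl | hk
    · simp
    · have hMk : 0 < M * k := Nat.mul_pos hM hk
      have e : M * (k + 2) - 1 = 2 * M + (M * k - 1) := by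
        rw [mul_add]; omega
      have hk2 : (k : ℂ) + 2 ≠ 0 := by exact_mod_cast (by omega : k + 2 ≠ 0)
      rw [e, pow_add]
      push_cast
      field_simp
  · have hMK : 0 < 2 * M * K := by positivity
    have e : M * (2 * K + 2) - 1 = 2 * M + (2 * M * K - 1) := by
      have : M * (2 * K + 2) = 2 * M * K + 2 * M := by ring
      omega
    have hk2 : (K : ℂ) + 1 ≠ 0 := by exact_mod_cast (by omega : K + 1 ≠ 0)
    rw [e, pow_add]
    push_cast
    field_simp

theorem leadingIntegral_re (K : ℕ) (a : ℕ → ℝ) (l u : ℂ) :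
    (leadingIntegral K a l u).re =
      -∑ k ∈ Finset.range (2 * K), a k * ((k : ℝ) / (k + 2) * (u ^ (k + 2)).im) +
        (K : ℝ) / (K + 1) * (l * u ^ (2 * K + 2)).re := by
  unfold leadingIntegral
  rw [Complex.add_re, Complex.re_ofReal_mul, Complex.re_sum, ← Finset.sum_neg_distrib]
  congr 1
  refine Finset.sum_congr rfl fun k _ => ?_
  rw [mul_assoc, mul_assoc, Complex.I_mul_re, Complex.im_ofReal_mul, Complex.im_ofReal_mul]

/-- isolated type, lower bound: Let `M, K ≥ 1`, `A₀ ∈ ℝ[s]` of degree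
`< 2K`, `L₁` analytic near `0` with `Re L₁(0) > 0`, and
`L(s) = i A₀(s^M) + s^{2MK} L₁(s)`. With
`g(s) = i s^{2M} + 2Mi ∫_{[0,s]} x^{2M} L′(x) dx`, there are `c, ε > 0` such that for
all `|s| < ε`, `|s e^{L(s)}|^{2M} − Im g(s) ≥ c |s|^{2M(1+K)}`; in particular the
curve `s ↦ (s^M e^{M L(s)}, g(s))` meets the boundary `∂U₂` only at `s = 0`
near the origin. -/
theorem statement10 (M K : ℕ) (hM : 0 < M) (hK : 0 < K)
    (A₀ : Polynomial ℝ) (hdeg : A₀.degree < (2 * K : ℕ))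
    (L₁ : ℂ → ℂ) (hL₁ : AnalyticAt ℂ L₁ 0) (hre : 0 < (L₁ 0).re)
    (L : ℂ → ℂ)
    (hLdef : ∀ s : ℂ,
      L s = Complex.I * Polynomial.aeval (s ^ M) A₀ + s ^ (2 * M * K) * L₁ s) :
    ∃ c ε : ℝ, 0 < c ∧ 0 < ε ∧ ∀ s : ℂ, ‖s‖ < ε →
      c * ‖s‖ ^ (2 * M * (1 + K)) ≤ ‖s * Complex.exp (L s)‖ ^ (2 * M) - (curveWM M L s).im ∧
      (s ≠ 0 → (curveWM M L s).im ≠ ‖s ^ M * Complex.exp ((M : ℂ) * L s)‖ ^ 2) := by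
  set l := L₁ 0
  set a := A₀.coeff with ha
  have hA (u : ℂ) : Polynomial.aeval u A₀ = ∑ k ∈ Finset.range (2 * K), (a k : ℂ) * u ^ k := by
    have hn : A₀.natDegree < 2 * K := by
      rcases eq_or_ne A₀ 0 with h | h
      · simp [h, hK]
      · exact (Polynomial.natDegree_lt_iff_degree_lt h).mpr hdeg
    rw [Polynomial.aeval_eq_sum_range' hn]
    simp [Complex.real_smul, ha]
  obtain ⟨C, δ, hC, hδ, han, hbd⟩ := hL₁.exists_norm_sub_le_and_norm_deriv_le
  have hLd (x : ℂ) (hx : ‖x‖ < δ) : HasDerivAt L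
      (∑ k ∈ Finset.range (2 * K), Complex.I * (a k : ℂ) * ((M * k : ℕ) * x ^ (M * k - 1)) +
        (((2 * M * K : ℕ) * x ^ (2 * M * K - 1)) * L₁ x + x ^ (2 * M * K) * deriv L₁ x)) x := by
    have hL : L = fun s => ∑ k ∈ Finset.range (2 * K), Complex.I * (a k : ℂ) * s ^ (M * k) +
        s ^ (2 * M * K) * L₁ s := by
      funext s
      rw [hLdef, hA, Finset.mul_sum]
      simp only [pow_mul, mul_assoc]
    rw [hL]
    refine (HasDerivAt.fun_sum fun k _ => (hasDerivAt_pow (M * k) x).const_mul _).add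
      ((hasDerivAt_pow (2 * M * K) x).mul (han x (by simpa using hx)).differentiableAt.hasDerivAt)
  have hE (x : ℂ) (hx : ‖x‖ < δ) : ‖deriv L x - leadingDeriv M K a l x‖ ≤
      ((2 * M * K : ℕ) * C + C) * ‖x‖ ^ (2 * M * K) := by
    have e : deriv L x - leadingDeriv M K a l x =
        ((2 * M * K : ℕ) * x ^ (2 * M * K - 1)) * (L₁ x - l) +
          x ^ (2 * M * K) * deriv L₁ x := by
      rw [(hLd x hx).deriv, leadingDeriv]; ring
    obtain ⟨h1, h2⟩ := hbd x hx
    rw [e]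
    refine (norm_add_le _ _).trans ?_
    rw [norm_mul, norm_mul, norm_mul, norm_pow, norm_pow, Complex.norm_natCast]
    calc _ ≤ (2 * M * K : ℕ) * ‖x‖ ^ (2 * M * K - 1) * (C * ‖x‖) + ‖x‖ ^ (2 * M * K) * C := by
          gcongr
      _ = (2 * M * K : ℕ) * C * (‖x‖ ^ (2 * M * K - 1) * ‖x‖) + C * ‖x‖ ^ (2 * M * K) := by ring
      _ = _ := by rw [pow_sub_one_mul (by positivity)]; ring
  have hLan : ContinuousOn (deriv L) (Metric.ball 0 δ) := by
    have hd : DifferentiableOn ℂ L (Metric.ball 0 δ) := fun x hx =>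
      (hLd x (by simpa using hx)).differentiableAt.differentiableWithinAt
    exact (hd.deriv Metric.isOpen_ball).continuousOn
  set C₁ : ℝ := (2 * M * K : ℕ) * C + C
  have hC₁0 : 0 ≤ C₁ := by positivity
  have hint := exists_norm_segment_integral_sub_le (m := 2 * M) hLan
    (hasDerivAt_leadingIntegral hM hK a l) (by unfold leadingDeriv; fun_prop)
    (by simp [leadingIntegral, hM.ne']) hC₁0 hE
  obtain ⟨C₂, hC₂, hsum⟩ := exists_abs_sum_im_pow_defect_le a (2 * K)
  set C₃ : ℝ := 4 * K * ‖l‖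
  have hM0 : (0 : ℝ) < M := by exact_mod_cast hM
  set c : ℝ := M * l.re / (K + 1) with hc
  have hc0 : 0 < c := by positivity
  set D : ℝ := 2 * M * C₂ + 2 * M * (C + C₁) + (M * C₃) ^ 2 with hD
  have hD0 : 0 ≤ D := by positivity
  refine ⟨c, min (min δ 1) (min 1 c / (D + 1)), hc0, by positivity, fun s hs => ?_⟩
  obtain ⟨⟨hs1, hs2⟩, hs3⟩ : (‖s‖ < δ ∧ ‖s‖ < 1) ∧ ‖s‖ < min 1 c / (D + 1) := by
    simpa only [lt_min_iff] using hs
  have hsD : D * ‖s‖ ≤ min 1 c := by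
    rw [lt_div_iff₀ (by positivity)] at hs3
    nlinarith [norm_nonneg s]
  have hsnorm : ‖s ^ M * Complex.exp ((M : ℂ) * L s)‖ ^ 2 =
      ‖s * Complex.exp (L s)‖ ^ (2 * M) := by
    rw [Complex.exp_nat_mul, ← mul_pow, norm_pow, ← pow_mul, mul_comm M 2]
  have main : c * ‖s‖ ^ (2 * M * (1 + K)) ≤
      ‖s * Complex.exp (L s)‖ ^ (2 * M) - (curveWM M L s).im := by
    set u := s ^ M with hu
    have hr : ‖u‖ = ‖s‖ ^ M := norm_pow s M
    have hru : ‖u‖ ≤ ‖s‖ := by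
      rw [hr]; exact pow_le_of_le_one (norm_nonneg _) hs2.le hM.ne'
    have hu1 : ‖u‖ ≤ 1 := hru.trans hs2.le
    have hexp : ‖u‖ ^ 2 * (1 + 2 * M * (L s).re) ≤ ‖s * Complex.exp (L s)‖ ^ (2 * M) := by
      rw [norm_mul, Complex.norm_exp, mul_pow, ← Real.exp_nat_mul, hr, ← pow_mul, mul_comm M 2]
      gcongr
      have := Real.add_one_le_exp (((2 * M : ℕ) : ℝ) * (L s).re)
      push_cast at this ⊢
      linarith
    have hLre : -∑ k ∈ Finset.range (2 * K), a k * (u ^ k).im + (u ^ (2 * K) * l).re -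
        C * (‖u‖ ^ (2 * K) * ‖s‖) ≤ (L s).re := by
      have e : L s = Complex.I * (∑ k ∈ Finset.range (2 * K), (a k : ℂ) * u ^ k) +
          u ^ (2 * K) * l + u ^ (2 * K) * (L₁ s - l) := by
        rw [hLdef, hA, ← hu]
        have : s ^ (2 * M * K) = u ^ (2 * K) := by rw [hu, ← pow_mul]; congr 1; ring
        rw [this]; ring
      have h1 : |(u ^ (2 * K) * (L₁ s - l)).re| ≤ C * (‖u‖ ^ (2 * K) * ‖s‖) := by
        refine (Complex.abs_re_le_norm _).trans ?_
        rw [norm_mul, norm_pow]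
        calc _ ≤ ‖u‖ ^ (2 * K) * (C * ‖s‖) := by gcongr; exact (hbd s hs1).1
          _ = _ := by ring
      have h2 := (abs_le.mp h1).1
      rw [e, Complex.add_re, Complex.add_re, Complex.I_mul_re, Complex.im_sum]
      simp only [Complex.im_ofReal_mul]
      linarith
    have hg : (curveWM M L s).im ≤ (u ^ 2).re + 2 * M *
        ((leadingIntegral K a l u).re + C₁ * (‖u‖ ^ (2 * K + 2) * ‖s‖)) := by
      have h1 := hint s hs1
      set J := ∫ t in (0 : ℝ)..1, s * (((t : ℂ) * s) ^ (2 * M) * deriv L ((t : ℂ) * s)) with hJ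
      have e : (curveWM M L s).im = (u ^ 2).re + 2 * M * J.re := by
        have e1 : curveWM M L s = Complex.I * (u ^ 2 + ((2 * M : ℝ) : ℂ) * J) := by
          rw [curveWM, ← hJ, hu, ← pow_mul, mul_comm M 2]
          push_cast; ring
        rw [e1, Complex.I_mul_im, Complex.add_re, Complex.re_ofReal_mul]
      have h2 : J.re - (leadingIntegral K a l u).re ≤ C₁ * (‖u‖ ^ (2 * K + 2) * ‖s‖) := by
        have h3 : ‖s‖ ^ (2 * M + 2 * M * K + 1) = ‖u‖ ^ (2 * K + 2) * ‖s‖ := by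
          rw [hr]; ring
        rw [← h3, ← Complex.sub_re]
        exact (Complex.re_le_norm _).trans h1
      rw [e]
      gcongr
      linarith
    rw [leadingIntegral_re] at hg
    have hS := (abs_le.mp (hsum u hu1)).1
    simp only [mul_sub] at hS
    rw [Finset.sum_sub_distrib] at hS
    have hmul : ∑ k ∈ Finset.range (2 * K), a k * (‖u‖ ^ 2 * (u ^ k).im) =
        ‖u‖ ^ 2 * ∑ k ∈ Finset.range (2 * K), a k * (u ^ k).im := by
      rw [Finset.mul_sum]
      exact Finset.sum_congr rfl fun k _ => by ring
    rw [hmul] at hS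
    have hlead := Complex.leading_defect_ge l u K
    have hy : ‖u‖ ^ 2 - (u ^ 2).re = 2 * u.im ^ 2 := by
      rw [Complex.sq_norm, Complex.normSq_apply, pow_two u, Complex.mul_re]; ring
    have hpow : ‖s‖ ^ (2 * M * (1 + K)) = ‖u‖ ^ (2 * K + 2) := by
      rw [hr]; ring
    rw [hpow]
    set R := ‖u‖ ^ (2 * K + 2) with hR
    have hR0 : 0 ≤ R := by positivity
    have hLre' := mul_le_mul_of_nonneg_left hLre (by positivity : 0 ≤ 2 * M * ‖u‖ ^ 2)
    have hRe : ‖u‖ ^ 2 * ‖u‖ ^ (2 * K) = R := by rw [hR]; ring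
    have hq : (‖u‖ ^ (2 * K + 1)) ^ 2 ≤ R * ‖s‖ := by
      have e : (‖u‖ ^ (2 * K + 1)) ^ 2 = R * ‖u‖ ^ (2 * K) := by rw [hR]; ring
      rw [e]
      gcongr
      exact (pow_le_of_le_one (norm_nonneg _) hu1 (by positivity)).trans hru
    have hamgm : 2 * M * C₃ * (|u.im| * ‖u‖ ^ (2 * K + 1)) ≤
        u.im ^ 2 + (M * C₃) ^ 2 * (R * ‖s‖) := by
      have h1 := two_mul_le_add_sq |u.im| (M * C₃ * ‖u‖ ^ (2 * K + 1))
      have h2 := mul_le_mul_of_nonneg_left hq (sq_nonneg (M * C₃))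
      rw [sq_abs, mul_pow] at h1
      linarith
    have hy2 : 2 * M * (C₂ * (u.im ^ 2 * ‖u‖)) ≤ u.im ^ 2 := by
      have h1 : 2 * M * C₂ * ‖s‖ ≤ 1 := by
        refine le_trans ?_ (hsD.trans (min_le_left _ _))
        gcongr
        rw [hD]
        have : 0 ≤ 2 * M * (C + C₁) + (M * C₃) ^ 2 := by positivity
        linarith
      calc _ ≤ 2 * M * (C₂ * (u.im ^ 2 * ‖s‖)) := by gcongr
        _ = u.im ^ 2 * (2 * M * C₂ * ‖s‖) := by ring
        _ ≤ u.im ^ 2 * 1 := by gcongr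
        _ = _ := mul_one _
    have hrem : (2 * M * (C + C₁) + (M * C₃) ^ 2) * (R * ‖s‖) ≤ c * R := by
      have h1 : (2 * M * (C + C₁) + (M * C₃) ^ 2) * ‖s‖ ≤ c := by
        refine le_trans ?_ (hsD.trans (min_le_right _ _))
        gcongr
        rw [hD]
        have : 0 ≤ 2 * M * C₂ := by positivity
        linarith
      calc _ = ((2 * M * (C + C₁) + (M * C₃) ^ 2) * ‖s‖) * R := by ring
        _ ≤ _ := by gcongr
    have hS' := mul_le_mul_of_nonneg_left hS (by positivity : (0 : ℝ) ≤ 2 * M)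
    have hlead' := mul_le_mul_of_nonneg_left hlead (by positivity : (0 : ℝ) ≤ 2 * M)
    have hce : 2 * M * (l.re / (K + 1) * R) = 2 * c * R := by rw [hc]; ring
    have hCe : 2 * M * ‖u‖ ^ 2 * (C * (‖u‖ ^ (2 * K) * ‖s‖)) = 2 * M * C * (R * ‖s‖) := by
      rw [← hRe]; ring
    linarith
  refine ⟨main, fun hs0 heq => ?_⟩
  rw [heq, hsnorm, sub_self] at main
  have : 0 < c * ‖s‖ ^ (2 * M * (1 + K)) := by
    have := norm_pos_iff.mpr hs0
    positivity
  linarith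
end

section
/- Let M, K be positive integers, let α ∈ ℂ with Im α < 0, and let φ be a complex-analytic function on a neighborhood of 0 ∈ ℂ with φ(t) = i t^{2M} + α t^{2M(K+1)} + o(t^{2M(K+1)}) as t → 0 (i.e., the Taylor coefficient of t^{2M} is i, the coefficient of t^{2M(K+1)} is α, and all other coefficients of order at most 2M(K+1) vanish). Then there exists ε > 0 such that Im φ(t) ≤ |t|^{2M} for all t ∈ ℂ with |t| < ε; that is, the curve t ↦ (c t^M, φ(t)) with |c| = 1 avoids the Siegel half-space U₂ near the origin. -/
open Asymptotics Filter

/-- On the circle of radius `r`, the map `u ↦ u ^ n` is Lipschitz at the point `r`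
with constant `n r ^ (n - 1)`. -/
theorem norm_pow_succ_sub_norm_pow_succ_le (u : ℂ) (k : ℕ) :
    ‖u ^ (k + 1) - (‖u‖ : ℂ) ^ (k + 1)‖ ≤ (k + 1) * ‖u‖ ^ k * ‖u - (‖u‖ : ℂ)‖ := by
  induction k with
  | zero => simp
  | succ k ih =>
    have h : u ^ (k + 1 + 1) - (‖u‖ : ℂ) ^ (k + 1 + 1) =
        u ^ (k + 1) * (u - (‖u‖ : ℂ)) + (u ^ (k + 1) - (‖u‖ : ℂ) ^ (k + 1)) * (‖u‖ : ℂ) := by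
      ring
    rw [h]
    refine (norm_add_le _ _).trans ?_
    rw [norm_mul, norm_mul, norm_pow, Complex.norm_real, norm_norm]
    have := mul_le_mul_of_nonneg_right ih (norm_nonneg u)
    push_cast
    linear_combination this

theorem sq_norm_sub_norm (u : ℂ) : ‖u - (‖u‖ : ℂ)‖ ^ 2 = 2 * ‖u‖ * (‖u‖ - u.re) := by
  have h : ‖u‖ ^ 2 = u.re * u.re + u.im * u.im := by
    rw [Complex.sq_norm, Complex.normSq_apply]
  rw [Complex.sq_norm, Complex.normSq_apply]
  simp only [Complex.sub_re, Complex.sub_im, Complex.ofReal_re, Complex.ofReal_im, sub_zero]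
  linear_combination -h

/-- The estimate `Im (i u + α u ^ (K + 1)) ≤ |u|` for small `u`, with room for an error term. -/
theorem re_add_im_mul_pow_succ_le (K : ℕ) (α u : ℂ)
    (hu : (‖α‖ * (K + 1)) ^ 2 * ‖u‖ ^ K ≤ -α.im) :
    u.re + (α * u ^ (K + 1)).im + -α.im / 2 * ‖u‖ ^ (K + 1) ≤ ‖u‖ := by
  rcases eq_or_ne u 0 with rfl | hu0
  · simp
  have hr : 0 < ‖u‖ := norm_pos_iff.2 hu0
  have hd := sq_norm_sub_norm u
  have him : (α * u ^ (K + 1)).im ≤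
      α.im * ‖u‖ ^ (K + 1) + ‖α‖ * ((K + 1) * ‖u‖ ^ K * ‖u - (‖u‖ : ℂ)‖) := by
    have h : α * u ^ (K + 1) =
        α * ((‖u‖ ^ (K + 1) : ℝ) : ℂ) + α * (u ^ (K + 1) - (‖u‖ : ℂ) ^ (K + 1)) := by
      push_cast
      ring
    rw [h, Complex.add_im, Complex.im_mul_ofReal]
    gcongr
    refine (Complex.im_le_norm _).trans ?_
    rw [norm_mul]
    gcongr
    exact norm_pow_succ_sub_norm_pow_succ_le u K
  set r := ‖u‖
  set d := ‖u - (r : ℂ)‖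
  set C := ‖α‖ * ((K : ℝ) + 1) with hC
  have h1 := sq_nonneg (d - C * r ^ (K + 1))
  have h2 := mul_le_mul_of_nonneg_right hu (pow_nonneg hr.le (K + 2))
  have h3 := mul_le_mul_of_nonneg_left him (mul_nonneg zero_le_two hr.le)
  refine le_of_mul_le_mul_left ?_ (mul_pos two_pos hr)
  rw [hC] at h1 h2
  linear_combination h1 + h2 + h3 + hd

/-- If `φ` is analytic near `0 ∈ ℂ` with
`φ(t) = i t^{2M} + α t^{2M(K+1)} + o(t^{2M(K+1)})` where `Im α < 0`, then
`Im φ(t) ≤ |t|^{2M}` for all small `t`: the curve `t ↦ (c t^M, φ(t))` with `|c| = 1`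
avoids the Siegel half-space `U₂` near the origin. -/
theorem statement11 (M K : ℕ) (hM : 0 < M) (hK : 0 < K)
    (α : ℂ) (hα : α.im < 0) (φ : ℂ → ℂ) (hφ : AnalyticAt ℂ φ 0)
    (hexp : (fun t : ℂ =>
        φ t - (Complex.I * t ^ (2 * M) + α * t ^ (2 * M * (K + 1))))
      =o[nhds 0] fun t : ℂ => t ^ (2 * M * (K + 1))) :
    ∃ ε : ℝ, 0 < ε ∧ ∀ t : ℂ, ‖t‖ < ε → (φ t).im ≤ ‖t‖ ^ (2 * M) := by
  have hcont : Tendsto (fun t : ℂ => (‖α‖ * (K + 1)) ^ 2 * ‖t ^ (2 * M)‖ ^ K)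
      (nhds 0) (nhds 0) := by
    have h : Continuous fun t : ℂ => (‖α‖ * (K + 1)) ^ 2 * ‖t ^ (2 * M)‖ ^ K := by fun_prop
    simpa [hM.ne', hK.ne'] using h.tendsto 0
  have hsmall := hcont.eventually (eventually_le_nhds (neg_pos.2 hα))
  have herr := hexp.bound (half_pos (neg_pos.2 hα))
  obtain ⟨ε, hε, h⟩ := Metric.eventually_nhds_iff.1 (hsmall.and herr)
  refine ⟨ε, hε, fun t ht => ?_⟩
  obtain ⟨h1, h2⟩ := h (by simpa using ht)
  have h3 := re_add_im_mul_pow_succ_le K α (t ^ (2 * M)) h1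
  have h4 := (Complex.im_le_norm _).trans h2
  rw [pow_mul t (2 * M) (K + 1), norm_pow] at h4
  simp only [Complex.sub_im, Complex.add_im, Complex.I_mul_im] at h4
  rw [← norm_pow]
  linarith
end

section
/- Let M be a positive integer and let q be a complex-analytic function on a neighborhood of (0,0) ∈ ℂ². Suppose there exist C, ε > 0 such that |q(z,w)| ≤ C|w|^M for all (z,w) in the Siegel half-space U₂ with |(z,w)| < ε. Then q belongs to the ideal (w, z²)^M of the ring of germs of analytic functions at (0,0): there exist functions a₀, a₁, …, a_M analytic near (0,0) such that q(z,w) = Σ_{j=0}^{M} a_j(z,w) · w^j · z^{2(M−j)} near (0,0). -/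
open Filter

open scoped Topology

/-- Hadamard's lemma for analytic functions: `f` differs from `f x` by an analytic family of
continuous linear maps, evaluated at the displacement. -/
theorem AnalyticAt.exists_analyticAt_eq_add_apply_sub {𝕜 E F : Type*}
    [NontriviallyNormedField 𝕜] [NormedAddCommGroup E] [NormedSpace 𝕜 E]
    [NormedAddCommGroup F] [NormedSpace 𝕜 F] [CompleteSpace F] {f : E → F} {x : E}
    (hf : AnalyticAt 𝕜 f x) :
    ∃ L : E → E →L[𝕜] F, AnalyticAt 𝕜 L x ∧ ∀ᶠ y in 𝓝 x, f y = f x + L y (y - x) := by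
  obtain ⟨p, r, hp⟩ := hf
  have hpos : 0 < p.shift.radius := by
    rw [FormalMultilinearSeries.radius_shift]
    exact hp.r_pos.trans_le hp.r_le
  have hL := (p.shift.hasFPowerSeriesOnBall hpos).comp_sub x
  rw [zero_add] at hL
  refine ⟨fun y ↦ p.shift.sum (y - x), hL.analyticAt, ?_⟩
  filter_upwards [Metric.eball_mem_nhds x hp.r_pos] with y hy
  have hy' : y - x ∈ Metric.eball (0 : E) r := by
    simpa [edist_eq_enorm_sub] using hy
  have hy'' : y - x ∈ Metric.eball (0 : E) p.shift.radius := by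
    rw [FormalMultilinearSeries.radius_shift]
    exact Metric.eball_subset_eball hp.r_le hy'
  have h₁ := (ContinuousLinearMap.apply 𝕜 F (y - x)).hasSum (p.shift.hasSum hy'')
  have h₂ := hp.hasSum hy'
  rw [add_sub_cancel] at h₂
  have h₃ := (hasSum_nat_add_iff' 1).2 h₂
  have h₄ := h₁.unique (by
    convert h₃ using 2 with n
    simp only [ContinuousLinearMap.apply_apply, FormalMultilinearSeries.shift,
      ContinuousMultilinearMap.curryRight_apply]
    congr 1
    ext i
    refine Fin.lastCases ?_ (fun j ↦ ?_) i <;> simp)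
  simp only [ContinuousLinearMap.apply_apply, Finset.sum_range_one, hp.coeff_zero] at h₄
  rw [h₄]
  abel

/-- Taylor expansion of an analytic germ on `ℂ²` up to weight two, where `z` has weight one and `w`
has weight two. -/
theorem AnalyticAt.exists_eq_weighted_taylor {f : ℂ × ℂ → ℂ} (hf : AnalyticAt ℂ f 0) :
    ∃ (c d : ℂ) (A B : ℂ × ℂ → ℂ), AnalyticAt ℂ A 0 ∧ AnalyticAt ℂ B 0 ∧
      ∀ᶠ x : ℂ × ℂ in 𝓝 0, f x = c + d * x.1 + x.1 ^ 2 * A x + x.2 * B x := by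
  have split : ∀ {g : ℂ × ℂ → ℂ}, AnalyticAt ℂ g 0 → ∃ A B : ℂ × ℂ → ℂ,
      AnalyticAt ℂ A 0 ∧ AnalyticAt ℂ B 0 ∧
      ∀ᶠ x : ℂ × ℂ in 𝓝 0, g x = g 0 + x.1 * A x + x.2 * B x := by
    intro g hg
    obtain ⟨L, hL, h⟩ := hg.exists_analyticAt_eq_add_apply_sub
    refine ⟨fun x ↦ L x (1, 0), fun x ↦ L x (0, 1),
      ((ContinuousLinearMap.apply ℂ ℂ ((1, 0) : ℂ × ℂ)).analyticAt _).comp hL,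
      ((ContinuousLinearMap.apply ℂ ℂ ((0, 1) : ℂ × ℂ)).analyticAt _).comp hL, ?_⟩
    filter_upwards [h] with x hx
    have hdecomp : x = x.1 • ((1, 0) : ℂ × ℂ) + x.2 • ((0, 1) : ℂ × ℂ) := by
      ext <;> simp
    have hLx : L x x = x.1 * L x (1, 0) + x.2 * L x (0, 1) := by
      conv_lhs => rw [hdecomp, map_add, map_smul, map_smul, ← hdecomp]
      simp
    rw [hx, sub_zero, hLx]
    ring
  obtain ⟨A, B, hA, hB, h⟩ := split hf
  obtain ⟨A', B', hA', hB', h'⟩ := split hA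
  refine ⟨f 0, A 0, A', fun x ↦ x.1 * B' x + B x, hA', (analyticAt_fst.mul hB').add hB, ?_⟩
  filter_upwards [h, h'] with x hx hx'
  rw [hx, hx']
  ring

/-- An analytic function on `ℂ²` vanishing on the Siegel half-space vanishes identically. -/
theorem AnalyticOnNhd.eq_zero_of_siegel {f : ℂ × ℂ → ℂ} (hf : AnalyticOnNhd ℂ f Set.univ)
    (h : ∀ z w : ℂ, ‖z‖ ^ 2 < w.im → f (z, w) = 0) : f = 0 := by
  refine hf.eq_of_eventuallyEq (z₀ := (0, Complex.I)) analyticOnNhd_const ?_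
  have hopen : IsOpen {x : ℂ × ℂ | ‖x.1‖ ^ 2 < x.2.im} :=
    isOpen_lt (by fun_prop) (by fun_prop)
  filter_upwards [hopen.mem_nhds (by simp : ((0 : ℂ), Complex.I) ∈ _)] with x hx
  exact h x.1 x.2 hx

/-- A function of the form `α + β t + t² γ(t)`, with `γ` having a limit, can be `O(t²)` as `t → 0⁺`
only if `α = β = 0`. -/
theorem coeff_eq_zero_of_norm_le_sq {α β γ₀ : ℂ} {γ : ℝ → ℂ} {K : ℝ}
    (hγ : Tendsto γ (𝓝[>] 0) (𝓝 γ₀))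
    (h : ∀ᶠ t : ℝ in 𝓝[>] 0, ‖α + β * t + t ^ 2 * γ t‖ ≤ K * t ^ 2) : α = 0 ∧ β = 0 := by
  have ht : Tendsto (fun t : ℝ ↦ (t : ℂ)) (𝓝[>] 0) (𝓝 0) :=
    (Complex.continuous_ofReal.tendsto' 0 0 (by simp)).mono_left nhdsWithin_le_nhds
  have ht' : Tendsto (fun t : ℝ ↦ t) (𝓝[>] 0) (𝓝 0) := tendsto_id.mono_left nhdsWithin_le_nhds
  have hα : α = 0 := by
    have h₁ : Tendsto (fun t : ℝ ↦ α + β * t + t ^ 2 * γ t) (𝓝[>] 0) (𝓝 α) := by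
      simpa using (tendsto_const_nhds.add (ht.const_mul β)).add ((ht.pow 2).mul hγ)
    have h₂ : Tendsto (fun t : ℝ ↦ K * t ^ 2) (𝓝[>] 0) (𝓝 0) := by
      simpa using (ht'.pow 2).const_mul K
    exact tendsto_nhds_unique h₁ (squeeze_zero_norm' h h₂)
  subst hα
  refine ⟨rfl, ?_⟩
  have h₁ : Tendsto (fun t : ℝ ↦ β + t * γ t) (𝓝[>] 0) (𝓝 β) := by
    simpa using tendsto_const_nhds.add (ht.mul hγ)
  have h₂ : Tendsto (fun t : ℝ ↦ K * t) (𝓝[>] 0) (𝓝 0) := by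
    simpa using ht'.const_mul K
  refine tendsto_nhds_unique h₁ (squeeze_zero_norm' ?_ h₂)
  filter_upwards [h, self_mem_nhdsWithin] with t hb (htpos : 0 < t)
  have hfac : 0 + β * (t : ℂ) + t ^ 2 * γ t = t * (β + t * γ t) := by ring
  rw [hfac, norm_mul, Complex.norm_real, Real.norm_of_nonneg htpos.le] at hb
  exact le_of_mul_le_mul_left (by linarith) htpos

/-- Points of the Siegel half-space are moved into any neighbourhood of the origin by the weighted
dilations `(z, w) ↦ (tz, t²w)`. -/
theorem tendsto_weighted_dilation (z w : ℂ) :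
    Tendsto (fun t : ℝ ↦ ((t * z, t ^ 2 * w) : ℂ × ℂ)) (𝓝[>] 0) (𝓝 0) := by
  have : Continuous (fun t : ℝ ↦ ((t * z, t ^ 2 * w) : ℂ × ℂ)) := by fun_prop
  exact (this.tendsto' 0 0 (by simp)).mono_left nhdsWithin_le_nhds

/-- A germ in `(w, z²)^M` is, modulo `(w, z²)^(M+1)`, the sum of weighted homogeneous polynomials of
weights `2M` and `2M + 1`. -/
theorem exists_weighted_expansion_succ (M : ℕ) {a : ℕ → ℂ × ℂ → ℂ}
    (ha : ∀ j, AnalyticAt ℂ (a j) 0) :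
    ∃ (c d : ℕ → ℂ) (b : ℕ → ℂ × ℂ → ℂ), (∀ j, AnalyticAt ℂ (b j) 0) ∧
      ∀ᶠ x : ℂ × ℂ in 𝓝 0,
        ∑ j ∈ Finset.range (M + 1), a j x * x.2 ^ j * x.1 ^ (2 * (M - j)) =
          (∑ j ∈ Finset.range (M + 1), c j * x.2 ^ j * x.1 ^ (2 * (M - j))) +
          x.1 * (∑ j ∈ Finset.range (M + 1), d j * x.2 ^ j * x.1 ^ (2 * (M - j))) +
          ∑ j ∈ Finset.range (M + 1 + 1), b j x * x.2 ^ j * x.1 ^ (2 * (M + 1 - j)) := by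
  choose c d A B hA hB h using fun j ↦ (ha j).exists_eq_weighted_taylor
  refine ⟨c, d, fun j ↦ (if j ≤ M then A j else 0) + (if j = 0 then 0 else B (j - 1)),
    fun j ↦ ?_, ?_⟩
  · refine AnalyticAt.add ?_ ?_ <;> split_ifs
    exacts [hA j, analyticAt_const, analyticAt_const, hB (j - 1)]
  · filter_upwards [(Finset.eventually_all (Finset.range (M + 1))).2 fun j _ ↦ h j] with x hx
    have hAsum : ∑ j ∈ Finset.range (M + 1 + 1),
        (if j ≤ M then A j else 0) x * x.2 ^ j * x.1 ^ (2 * (M + 1 - j)) =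
        ∑ j ∈ Finset.range (M + 1), x.1 ^ 2 * A j x * x.2 ^ j * x.1 ^ (2 * (M - j)) := by
      rw [Finset.sum_range_succ, if_neg (by omega)]
      simp only [Pi.zero_apply, zero_mul, add_zero]
      refine Finset.sum_congr rfl fun j hj ↦ ?_
      have hjM : j ≤ M := Nat.lt_succ_iff.1 (Finset.mem_range.1 hj)
      rw [if_pos hjM, show 2 * (M + 1 - j) = 2 * (M - j) + 2 by omega, pow_add]
      ring
    have hBsum : ∑ j ∈ Finset.range (M + 1 + 1),
        (if j = 0 then 0 else B (j - 1)) x * x.2 ^ j * x.1 ^ (2 * (M + 1 - j)) =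
        ∑ j ∈ Finset.range (M + 1), x.2 * B j x * x.2 ^ j * x.1 ^ (2 * (M - j)) := by
      rw [Finset.sum_range_succ']
      simp only [if_true, Pi.zero_apply, zero_mul, add_zero]
      refine Finset.sum_congr rfl fun j _ ↦ ?_
      rw [if_neg (Nat.succ_ne_zero j), Nat.add_sub_cancel, Nat.add_sub_add_right, pow_succ]
      ring
    simp only [Pi.add_apply, add_mul, Finset.sum_add_distrib]
    rw [hAsum, hBsum, Finset.mul_sum, ← Finset.sum_add_distrib, ← Finset.sum_add_distrib,
      ← Finset.sum_add_distrib]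
    refine Finset.sum_congr rfl fun j hj ↦ ?_
    rw [hx j hj]
    ring

/-- The weighted homogeneity of the generators of `(w, z²)^M`. -/
theorem sum_weighted_dilation (M : ℕ) (g : ℕ → ℂ) (t z w : ℂ) :
    ∑ j ∈ Finset.range (M + 1), g j * (t ^ 2 * w) ^ j * (t * z) ^ (2 * (M - j)) =
      t ^ (2 * M) * ∑ j ∈ Finset.range (M + 1), g j * w ^ j * z ^ (2 * (M - j)) := by
  rw [Finset.mul_sum]
  refine Finset.sum_congr rfl fun j hj ↦ ?_
  have hjM : j ≤ M := Nat.lt_succ_iff.1 (Finset.mem_range.1 hj)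
  rw [show 2 * M = 2 * j + 2 * (M - j) by omega, pow_add]
  simp only [mul_pow, ← pow_mul]
  ring

/-- An analytic germ which is `O(|w|^M)` on the Siegel half-space lies in `(w, z²)^M`. -/
theorem exists_expansion_of_siegel_bound (M : ℕ) {q : ℂ × ℂ → ℂ} (hq : AnalyticAt ℂ q 0)
    {C : ℝ} (hbdd : ∀ᶠ x : ℂ × ℂ in 𝓝 0, ‖x.1‖ ^ 2 < x.2.im → ‖q x‖ ≤ C * ‖x.2‖ ^ M) :
    ∃ a : ℕ → ℂ × ℂ → ℂ, (∀ j, AnalyticAt ℂ (a j) 0) ∧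
      ∀ᶠ x : ℂ × ℂ in 𝓝 0,
        q x = ∑ j ∈ Finset.range (M + 1), a j x * x.2 ^ j * x.1 ^ (2 * (M - j)) := by
  induction M generalizing C with
  | zero => exact ⟨fun _ ↦ q, fun _ ↦ hq, by simp⟩
  | succ M ih =>
    obtain ⟨a, ha, hqa⟩ := ih (C := |C|) <| by
      have hsmall : ∀ᶠ x : ℂ × ℂ in 𝓝 0, ‖x.2‖ < 1 :=
        (by fun_prop : Continuous fun x : ℂ × ℂ ↦ ‖x.2‖).tendsto' 0 0 (by simp)
          |>.eventually_lt_const one_pos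
      filter_upwards [hbdd, hsmall] with x hx hx1 hS
      calc ‖q x‖ ≤ C * ‖x.2‖ ^ (M + 1) := hx hS
        _ ≤ |C| * ‖x.2‖ ^ (M + 1) := by gcongr; exact le_abs_self C
        _ ≤ |C| * ‖x.2‖ ^ M := by
          gcongr ?_ * ?_
          exact pow_le_pow_of_le_one (norm_nonneg _) hx1.le M.le_succ
    obtain ⟨c, d, b, hb, hab⟩ := exists_weighted_expansion_succ M ha
    have hvanish : ∀ z w : ℂ, ‖z‖ ^ 2 < w.im →
        (∑ j ∈ Finset.range (M + 1), c j * w ^ j * z ^ (2 * (M - j))) = 0 ∧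
        z * (∑ j ∈ Finset.range (M + 1), d j * w ^ j * z ^ (2 * (M - j))) = 0 := by
      intro z w hS
      have hdil := tendsto_weighted_dilation z w
      refine coeff_eq_zero_of_norm_le_sq (K := C * ‖w‖ ^ (M + 1))
        (γ := fun t : ℝ ↦ ∑ j ∈ Finset.range (M + 1 + 1),
          b j (t * z, t ^ 2 * w) * w ^ j * z ^ (2 * (M + 1 - j)))
        (γ₀ := ∑ j ∈ Finset.range (M + 1 + 1), b j 0 * w ^ j * z ^ (2 * (M + 1 - j))) ?_ ?_
      · refine tendsto_finsetSum _ fun j _ ↦ ?_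
        exact (((hb j).continuousAt.tendsto.comp hdil).mul_const _).mul_const _
      · filter_upwards [hdil.eventually hbdd, hdil.eventually hqa, hdil.eventually hab,
          self_mem_nhdsWithin] with t h₁ h₂ h₃ (ht : 0 < t)
        have hS' : ‖(t : ℂ) * z‖ ^ 2 < ((t : ℂ) ^ 2 * w).im := by
          rw [← Complex.ofReal_pow, Complex.im_ofReal_mul, norm_mul, mul_pow, Complex.norm_real,
            Real.norm_eq_abs, sq_abs]
          gcongr
        have h := h₁ hS'
        rw [h₂, h₃] at h
        simp only [sum_weighted_dilation M _ (t : ℂ) z w,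
          sum_weighted_dilation (M + 1) (fun j ↦ b j (t * z, t ^ 2 * w)) (t : ℂ) z w] at h
        have hnorm : ‖(t : ℂ) ^ (2 * M)‖ = t ^ (2 * M) := by
          rw [norm_pow, Complex.norm_real, Real.norm_of_nonneg ht.le]
        refine le_of_mul_le_mul_left (a := ‖(t : ℂ) ^ (2 * M)‖) ?_ (by rw [hnorm]; positivity)
        rw [← norm_mul]
        refine (le_of_eq_of_le ?_ h).trans_eq ?_
        · congr 1
          ring
        · rw [hnorm, norm_mul, norm_pow, Complex.norm_real, Real.norm_of_nonneg ht.le, mul_pow,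
            ← pow_mul]
          ring
    have hpoly : ∀ e : ℕ → ℂ, AnalyticOnNhd ℂ (fun x : ℂ × ℂ ↦
        ∑ j ∈ Finset.range (M + 1), e j * x.2 ^ j * x.1 ^ (2 * (M - j))) Set.univ :=
      fun e x _ ↦ Finset.analyticAt_fun_sum _ fun j _ ↦
        (analyticAt_const.mul (analyticAt_snd.pow _)).mul (analyticAt_fst.pow _)
    have hc := AnalyticOnNhd.eq_zero_of_siegel
      (f := fun x ↦ ∑ j ∈ Finset.range (M + 1), c j * x.2 ^ j * x.1 ^ (2 * (M - j)))
      (hpoly c) fun z w h ↦ (hvanish z w h).1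
    have hd := AnalyticOnNhd.eq_zero_of_siegel
      (f := fun x ↦ x.1 * ∑ j ∈ Finset.range (M + 1), d j * x.2 ^ j * x.1 ^ (2 * (M - j)))
      (analyticOnNhd_fst.mul (hpoly d)) fun z w h ↦ (hvanish z w h).2
    refine ⟨b, hb, ?_⟩
    filter_upwards [hqa, hab] with x h₁ h₂
    have hcx := congrFun hc x
    have hdx := congrFun hd x
    simp only [Pi.zero_apply] at hcx hdx
    rw [h₁, h₂, hcx, hdx, zero_add, zero_add]

/-- If `q` is analytic near `(0,0) ∈ ℂ²` and `|q(z,w)| ≤ C|w|^M` on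
the part of the Siegel half-space `U₂ = {(z,w) : Im w > |z|²}` near the origin,
then `q` belongs to the ideal `(w, z²)^M` of the ring of germs of analytic functions
at `(0,0)`: `q(z,w) = ∑_{j=0}^{M} a_j(z,w) w^j z^{2(M−j)}` near `(0,0)` with each
`a_j` analytic near `(0,0)`. -/
theorem statement13 (M : ℕ) (hM : 0 < M) (q : ℂ × ℂ → ℂ)
    (hq : AnalyticAt ℂ q 0)
    (hbdd : ∃ C ε : ℝ, 0 < C ∧ 0 < ε ∧ ∀ z w : ℂ,
      ‖z‖ ^ 2 < w.im → ‖z‖ ^ 2 + ‖w‖ ^ 2 < ε ^ 2 → ‖q (z, w)‖ ≤ C * ‖w‖ ^ M) :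
    ∃ a : Fin (M + 1) → (ℂ × ℂ → ℂ),
      (∀ j, AnalyticAt ℂ (a j) 0) ∧
      ∀ᶠ zw : ℂ × ℂ in nhds 0,
        q zw = ∑ j : Fin (M + 1), a j zw * zw.2 ^ (j : ℕ) * zw.1 ^ (2 * (M - (j : ℕ))) := by
  obtain ⟨C, ε, -, hε, hbdd⟩ := hbdd
  have hnear : ∀ᶠ x : ℂ × ℂ in 𝓝 0, ‖x.1‖ ^ 2 + ‖x.2‖ ^ 2 < ε ^ 2 :=
    (by fun_prop : Continuous fun x : ℂ × ℂ ↦ ‖x.1‖ ^ 2 + ‖x.2‖ ^ 2).tendsto' 0 0 (by simp)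
      |>.eventually_lt_const (by positivity)
  obtain ⟨a, ha, h⟩ := exists_expansion_of_siegel_bound M hq (C := C) <| by
    filter_upwards [hnear] with x hx hS
    exact hbdd x.1 x.2 hS hx
  refine ⟨fun j ↦ a j, fun j ↦ ha j, ?_⟩
  filter_upwards [h] with x hx
  rw [hx, Finset.sum_range]
end

section
/- Let N ≥ 2 and let (A_1,…,A_d) be a row contraction of N×N complex matrices such that A_1* e_1 = e_1, where e_1 = (1,0,…,0)ᵀ. Then A_j* e_1 = 0 for j = 2,…,d; consequently the first row of A_1 is (1,0,…,0) and the first row of each A_j (j ≥ 2) is zero, so writing Ã_j for the lower-right (N−1)×(N−1) block of A_j, one has det(I_N − Σ_{j=1}^d z_j A_j) = (1 − z_1)·det(I_{N−1} − Σ_{j=1}^d z_j Ã_j) for all z ∈ ℂ^d. Moreover (Ã_1,…,Ã_d) is again a row contraction. -/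
open Matrix
open scoped ComplexOrder

/-- If a row contraction has the unit vector `Pi.single i 1` as row `i` of `A j₀`, then row `i` of
every other entry vanishes. -/
theorem row_eq_zero_of_rowContraction {ι m : Type*} [Fintype ι] [Fintype m] [DecidableEq m]
    {A : ι → Matrix m m ℂ} (hA : (1 - ∑ j, A j * (A j)ᴴ).PosSemidef) {i : m} {j₀ : ι}
    (h : A j₀ i = Pi.single i 1) {j : ι} (hj : j ≠ j₀) : A j i = 0 := by
  classical
  have hdiag := hA.diag_nonneg (i := i)
  have hsum : ∑ j, ∑ k, Complex.normSq (A j i k) ≤ 1 := by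
    have hcast : (0 : ℂ) ≤ ((1 - ∑ j, ∑ k, Complex.normSq (A j i k) : ℝ) : ℂ) := by
      simpa [Matrix.sum_apply, Matrix.mul_apply, Complex.mul_conj] using hdiag
    linarith [Complex.zero_le_real.mp hcast]
  have hrow : ∑ k, Complex.normSq (A j₀ i k) = 1 := by
    rw [h, Finset.sum_eq_single i] <;> simp +contextual
  have hnonneg (l : ι) : 0 ≤ ∑ k, Complex.normSq (A l i k) :=
    Finset.sum_nonneg fun k _ => Complex.normSq_nonneg _
  have hpair : ∑ k, Complex.normSq (A j i k) + ∑ k, Complex.normSq (A j₀ i k) ≤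
      ∑ l, ∑ k, Complex.normSq (A l i k) := by
    rw [← Finset.sum_pair (f := fun l => ∑ k, Complex.normSq (A l i k)) hj]
    exact Finset.sum_le_sum_of_subset_of_nonneg (Finset.subset_univ _) fun l _ _ => hnonneg l
  have hzero : ∑ k, Complex.normSq (A j i k) = 0 := le_antisymm (by linarith) (hnonneg j)
  funext k
  exact Complex.normSq_eq_zero.mp
    ((Finset.sum_eq_zero_iff_of_nonneg fun k _ => Complex.normSq_nonneg _).mp hzero k
      (Finset.mem_univ k))

/-- The determinant of a matrix whose first row is a multiple of the first unit vector. -/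
theorem det_of_row_zero_eq_single {R : Type*} [CommRing R] {n : ℕ}
    {M : Matrix (Fin (n + 1)) (Fin (n + 1)) R} {c : R} (h : M 0 = Pi.single 0 c) :
    M.det = c * (M.submatrix Fin.succ Fin.succ).det := by
  rw [Matrix.det_succ_row_zero, Fin.sum_univ_succ]
  simp [h]

/-- The lower-right compression of a row contraction is a row contraction. -/
theorem rowContraction_submatrix_succ {ι : Type*} [Fintype ι] {n : ℕ}
    {A : ι → Matrix (Fin (n + 1)) (Fin (n + 1)) ℂ}
    (hA : (1 - ∑ j, A j * (A j)ᴴ).PosSemidef) :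
    (1 - ∑ j, (A j).submatrix Fin.succ Fin.succ *
      ((A j).submatrix Fin.succ Fin.succ)ᴴ).PosSemidef := by
  have hsplit : 1 - ∑ j, (A j).submatrix Fin.succ Fin.succ *
        ((A j).submatrix Fin.succ Fin.succ)ᴴ =
      (1 - ∑ j, A j * (A j)ᴴ).submatrix Fin.succ Fin.succ +
        ∑ j, vecMulVec (fun a : Fin n => A j a.succ 0) (star fun a : Fin n => A j a.succ 0) := by
    ext a b
    simp [Matrix.sum_apply, Matrix.mul_apply, Fin.sum_univ_succ, Finset.sum_add_distrib,
      vecMulVec_apply, Matrix.one_apply]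
    ring
  rw [hsplit]
  exact (hA.submatrix _).add
    (posSemidef_sum _ fun j _ => posSemidef_vecMulVec_self_star _)

/-- If `(A_0,…,A_d)` is a row contraction of `N×N` complex matrices
(`N = n+2 ≥ 2`) and `A_0* e₁ = e₁`, then `A_j* e₁ = 0` for every `j ≠ 0`;
consequently the first row of `A_0` is `(1,0,…,0)` and the first row of each `A_j`
(`j ≠ 0`) vanishes, and with `Ã_j` the lower-right `(N−1)×(N−1)` block of `A_j`,
`det(I − ∑ z_j A_j) = (1 − z_0)·det(I − ∑ z_j Ã_j)` for all `z`; moreover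
`(Ã_0,…,Ã_d)` is again a row contraction. -/
theorem statement15 (n d : ℕ)
    (A : Fin (d + 1) → Matrix (Fin (n + 2)) (Fin (n + 2)) ℂ)
    (hA : (1 - ∑ j, A j * (A j)ᴴ).PosSemidef)
    (hfix : (A 0)ᴴ.mulVec (Pi.single 0 1) = Pi.single 0 1) :
    (∀ j : Fin (d + 1), j ≠ 0 → (A j)ᴴ.mulVec (Pi.single 0 1) = 0) ∧
    (A 0 0 = Pi.single 0 1) ∧
    (∀ j : Fin (d + 1), j ≠ 0 → A j 0 = 0) ∧
    (∀ z : Fin (d + 1) → ℂ,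
      (1 - ∑ j, z j • A j).det =
        (1 - z 0) * (1 - ∑ j, z j • (A j).submatrix Fin.succ Fin.succ).det) ∧
    (1 - ∑ j, (A j).submatrix Fin.succ Fin.succ *
        ((A j).submatrix Fin.succ Fin.succ)ᴴ).PosSemidef := by
  have hrow : A 0 0 = Pi.single 0 1 := by
    funext k
    have hk := congrArg star (congrFun hfix k)
    rcases eq_or_ne k 0 with rfl | hne
    · simpa using hk
    · simpa [hne] using hk
  have hrows : ∀ j : Fin (d + 1), j ≠ 0 → A j 0 = 0 := fun j hj =>
    row_eq_zero_of_rowContraction hA hrow hj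
  refine ⟨fun j hj => ?_, hrow, hrows, fun z => ?_, rowContraction_submatrix_succ hA⟩
  · funext k
    simp [hrows j hj]
  · have hfirst : (1 - ∑ j, z j • A j) 0 = Pi.single 0 (1 - z 0) := by
      funext k
      have htail (j : Fin d) : A j.succ 0 = 0 := hrows _ j.succ_ne_zero
      rcases eq_or_ne k 0 with rfl | hne
      · simp [Matrix.sum_apply, Fin.sum_univ_succ, hrow, htail]
      · simp [Matrix.sum_apply, Fin.sum_univ_succ, hrow, htail, hne, hne.symm]
    rw [det_of_row_zero_eq_single hfirst]
    congr 2
    ext a b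
    simp [Matrix.sum_apply, Matrix.one_apply]
end
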